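/- Let H ⊆ ℝ² be a subset whose subspace topology is Polish, and let p < q be rational numbers. Equip the set 𝒥_{p,q} of arcs with the Borel structure inherited from the space of nonempty compact subsets of ℝ² with the Hausdorff metric (equivalently, the Vietoris topology). Then the equivalence relation ≈ on 𝒥_{p,q}, relating I and J iff e₁(I) and e₁(J) lie in the same path component of H, is a hyperfinite Borel equivalence relation. -/

import Mathlib

/-- `E` is a Borel equivalence relation on the measurable space `X`. -/
def IsBorelEquivRel {X : Type} [MeasurableSpace X] (E : X → X → Prop) : Prop :=
  Equivalence E ∧ MeasurableSet {p : X × X | E p.1 p.2}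

/-- A finite Borel equivalence relation: every class is finite. -/
def IsFiniteBorelEquivRel {X : Type} [MeasurableSpace X] (E : X → X → Prop) : Prop :=
  IsBorelEquivRel E ∧ ∀ x, {y | E x y}.Finite

/-- `E` is hyperfinite: an increasing union of finite Borel equivalence relations. -/
def IsHyperfinite {X : Type} [MeasurableSpace X] (E : X → X → Prop) : Prop :=
  ∃ F : ℕ → X → X → Prop,
    (∀ n, IsFiniteBorelEquivRel (F n)) ∧
    (∀ n x y, F n x y → F (n + 1) x y) ∧
    (∀ x y, E x y ↔ ∃ n, F n x y)

/-- Borel reducibility of `E` to `F`. -/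
def IsBorelReducible {X Y : Type} [MeasurableSpace X] [MeasurableSpace Y]
    (E : X → X → Prop) (F : Y → Y → Prop) : Prop :=
  ∃ f : X → Y, Measurable f ∧ ∀ x y, E x y ↔ F (f x) (f y)

/-- `E` is essentially hyperfinite: Borel reducible to a hyperfinite Borel
equivalence relation on some standard Borel space. -/
def IsEssentiallyHyperfinite {X : Type} [MeasurableSpace X] (E : X → X → Prop) : Prop :=
  ∃ (Y : Type) (mY : MeasurableSpace Y), @StandardBorelSpace Y mY ∧
    ∃ F : Y → Y → Prop, @IsBorelEquivRel Y mY F ∧ @IsHyperfinite Y mY F ∧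
      @IsBorelReducible X Y _ mY E F

/-- `J` is an arc in the plane with endpoints `u` and `v`: the image of a continuous
injective map from the unit interval sending `0` to `u` and `1` to `v`. -/
def IsArcWith (J : Set (ℝ × ℝ)) (u v : ℝ × ℝ) : Prop :=
  ∃ f : unitInterval → ℝ × ℝ, Continuous f ∧ Function.Injective f ∧
    Set.range f = J ∧ f 0 = u ∧ f 1 = v

/-- `J` is an arc in the plane. -/
def IsArc (J : Set (ℝ × ℝ)) : Prop := ∃ u v, IsArcWith J u v

open TopologicalSpace in
/-- Borel structure on the hyperspace of nonempty compact subsets of the plane,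
with the topology of the Hausdorff metric (equivalently, the Vietoris topology). -/
noncomputable instance : MeasurableSpace (NonemptyCompacts (ℝ × ℝ)) := borel _

open TopologicalSpace in
instance : BorelSpace (NonemptyCompacts (ℝ × ℝ)) := ⟨rfl⟩

open Set Filter Topology Metric

local notation "𝕀" => unitInterval

/-- A continuous real function whose cosine stays nonnegative cannot leave `[-π/2, π/2]`. -/
lemma mem_Icc_of_cos_nonneg {g : ℝ → ℝ} (hg : ContinuousOn g (Icc 0 1))
    (hcos : ∀ t ∈ Icc (0:ℝ) 1, 0 ≤ Real.cos (g t))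
    (h0 : g 0 ∈ Icc (-(Real.pi / 2)) (Real.pi / 2)) :
    g 1 ∈ Icc (-(Real.pi / 2)) (Real.pi / 2) := by
  have hpi := Real.pi_pos
  constructor
  · by_contra! h
    have hy : max (g 1) (-(Real.pi)) < -(Real.pi / 2) := max_lt h (by linarith)
    obtain ⟨y, hy1, hy2⟩ := exists_between hy
    obtain ⟨t, ht, hgt⟩ := intermediate_value_Icc' zero_le_one hg
      (show y ∈ Icc (g 1) (g 0) from ⟨(le_max_left _ _).trans hy1.le, by linarith [h0.1]⟩)
    have := hcos t ht
    rw [hgt, ← Real.cos_neg] at this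
    have h3 : -(Real.pi) < y := (le_max_right _ _).trans_lt hy1
    exact absurd this (not_le.2 (Real.cos_neg_of_pi_div_two_lt_of_lt (by linarith) (by linarith)))
  · by_contra! h
    have hy : Real.pi / 2 < min (g 1) Real.pi := lt_min h (by linarith)
    obtain ⟨y, hy1, hy2⟩ := exists_between hy
    obtain ⟨t, ht, hgt⟩ := intermediate_value_Icc zero_le_one hg
      (show y ∈ Icc (g 0) (g 1) from ⟨by linarith [h0.2], hy2.le.trans (min_le_left _ _)⟩)
    have := hcos t ht
    rw [hgt] at this
    have h3 : y < Real.pi := hy2.trans_le (min_le_right _ _)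
    exact absurd this (not_le.2 (Real.cos_neg_of_pi_div_two_lt_of_lt (by linarith) (by linarith)))

/-- A continuous branch of the argument of `α s - β t` for disjoint plane curves. -/
lemma exists_angle {α β : ℝ → ℂ} (hα : Continuous α) (hβ : Continuous β)
    (hne : ∀ s t, α s ≠ β t) (hre : (α 0 - β 0).re = 0) (him : (α 0 - β 0).im < 0) :
    ∃ r θ : ℝ → ℝ → ℝ, Continuous (Function.uncurry θ) ∧ θ 0 0 = -(Real.pi / 2) ∧
      (∀ s t, 0 < r s t) ∧
      ∀ s t, (α s).re - (β t).re = r s t * Real.cos (θ s t) ∧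
        (α s).im - (β t).im = r s t * Real.sin (θ s t) := by
  have h0 : α 0 - β 0 ≠ 0 := sub_ne_zero.2 (hne 0 0)
  rcases Complex.isCoveringMapOn_exp.existsUnique_continuousMap_lifts (A := ℝ × ℝ)
    ⟨fun z => α z.1 - β z.2, by fun_prop⟩ (a₀ := ((0:ℝ), (0:ℝ))) (Complex.exp_log h0)
    (fun z ↦ sub_ne_zero.2 (hne z.1 z.2)) with ⟨Θ, ⟨hΘ0, hΘ⟩, -⟩
  refine ⟨fun s t => Real.exp (Θ (s, t)).re, fun s t => (Θ (s, t)).im, ?_, ?_, ?_, ?_⟩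
  · exact Complex.continuous_im.comp Θ.continuous
  · simp only [hΘ0, Complex.log_im, ContinuousMap.coe_mk]
    rw [Complex.arg_eq_neg_pi_div_two_iff.2 ⟨hre, him⟩]
  · intro s t; positivity
  · intro s t
    have := congrFun hΘ (s, t)
    simp only [Function.comp_apply, ContinuousMap.coe_mk] at this
    constructor
    · rw [← Complex.sub_re, ← this, Complex.exp_re]
    · rw [← Complex.sub_im, ← this, Complex.exp_im]

section cross

variable {α β : ℝ → ℂ}

lemma angle_corners {r θ : ℝ → ℝ → ℝ} (hθ : Continuous (Function.uncurry θ))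
    (h00 : θ 0 0 = -(Real.pi / 2)) (hr : ∀ s t, 0 < r s t)
    (h : ∀ s t, (α s).re - (β t).re = r s t * Real.cos (θ s t) ∧
        (α s).im - (β t).im = r s t * Real.sin (θ s t))
    (hL : ∀ t ∈ Icc (0:ℝ) 1, (α 0).re ≤ (β t).re)
    (hR : ∀ t ∈ Icc (0:ℝ) 1, (α 1).re ≤ (β t).re)
    (hB : ∀ s ∈ Icc (0:ℝ) 1, (β 0).re ≤ (α s).re)
    (h10 : (α 1).re = (β 0).re) (h10' : (β 0).im < (α 1).im) :
    θ 0 1 ∈ Icc (-(3 * Real.pi / 2)) (-(Real.pi / 2)) ∧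
    θ 1 1 ∈ Icc (Real.pi / 2) (3 * Real.pi / 2) := by
  have hpi := Real.pi_pos
  have c1 : ∀ s, Continuous fun t => θ s t := fun s => hθ.comp (by fun_prop : Continuous fun t =>
    (s, t))
  have c2 : ∀ t, Continuous fun s => θ s t := fun t => hθ.comp (by fun_prop : Continuous fun s =>
    (s, t))
  have e1 := mem_Icc_of_cos_nonneg (g := fun s => θ s 0) (c2 0).continuousOn (fun s hs => by
    have := (h s 0).1
    exact nonneg_of_mul_nonneg_right (this ▸ sub_nonneg.2 (hB s hs)) (hr s 0)) (by
      simp only [h00, mem_Icc]; constructor <;> linarith)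
  have e10 : θ 1 0 = Real.pi / 2 := by
    have h1 := (h 1 0).1
    have h2 := (h 1 0).2
    rw [h10, sub_self] at h1
    have hc : Real.cos (θ 1 0) = 0 := by
      rcases mul_eq_zero.1 h1.symm with h | h
      · exact absurd h (hr 1 0).ne'
      · exact h
    by_contra hne
    rcases (e1.1).eq_or_lt with h' | h'
    · rw [← h', Real.sin_neg, Real.sin_pi_div_two] at h2
      have := hr 1 0
      nlinarith
    · exact absurd hc (Real.cos_pos_of_mem_Ioo ⟨h', lt_of_le_of_ne e1.2 hne⟩).ne'
  have e2 := mem_Icc_of_cos_nonneg (g := fun t => θ 0 t + Real.pi)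
    ((c1 0).add continuous_const).continuousOn
    (fun t ht => by
      rw [Real.cos_add_pi]
      have := (h 0 t).1
      have h5 : r 0 t * (-Real.cos (θ 0 t)) = (β t).re - (α 0).re := by linarith
      exact nonneg_of_mul_nonneg_right (h5 ▸ sub_nonneg.2 (hL t ht)) (hr 0 t)) (by
      simp only [h00, mem_Icc]; constructor <;> linarith)
  have e3 := mem_Icc_of_cos_nonneg (g := fun t => θ 1 t - Real.pi)
    ((c1 1).sub continuous_const).continuousOn
    (fun t ht => by
      rw [Real.cos_sub_pi]
      have := (h 1 t).1
      have h5 : r 1 t * (-Real.cos (θ 1 t)) = (β t).re - (α 1).re := by linarith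
      exact nonneg_of_mul_nonneg_right (h5 ▸ sub_nonneg.2 (hR t ht)) (hr 1 t)) (by
      simp only [e10, mem_Icc]; constructor <;> linarith)
  simp only [mem_Icc] at e2 e3 ⊢
  refine ⟨⟨?_, ?_⟩, ?_, ?_⟩ <;> linarith [e2.1, e2.2, e3.1, e3.2]

/-- Two curves in a half plane with interleaved boundary endpoints cross. -/
lemma exists_eq_of_interleaved (hα : Continuous α) (hβ : Continuous β)
    (hA : ∀ s ∈ Icc (0:ℝ) 1, 0 ≤ (α s).re) (hB : ∀ s ∈ Icc (0:ℝ) 1, 0 ≤ (β s).re)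
    (a0 : (α 0).re = 0) (a1 : (α 1).re = 0) (b0 : (β 0).re = 0) (b1 : (β 1).re = 0)
    (h1 : (α 0).im < (β 0).im) (h2 : (β 0).im < (α 1).im) (h3 : (α 1).im < (β 1).im) :
    ∃ s t, α s = β t := by
  by_contra! hne
  have hpi := Real.pi_pos
  obtain ⟨r, θ, hθ, h00, hr, h⟩ := exists_angle hα hβ hne (by simp [a0, b0]) (by simpa using h1)
  obtain ⟨e1, e2⟩ := angle_corners hθ h00 hr h (fun t ht => a0.trans_le (hB t ht)) (fun t ht =>
    a1.trans_le (hB t ht))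
    (fun t ht => b0.trans_le (hA t ht)) (by rw [a1, b0]) h2
  have e01 : θ 0 1 = -(Real.pi / 2) := by
    have g1 := (h 0 1).1
    have g2 := (h 0 1).2
    rw [a0, b1, sub_self] at g1
    have hc : Real.cos (θ 0 1) = 0 := by
      rcases mul_eq_zero.1 g1.symm with h | h
      · exact absurd h (hr 0 1).ne'
      · exact h
    by_contra hne
    rcases (e1.1).eq_or_lt with h' | h'
    · rw [← h', show -(3 * Real.pi / 2) = Real.pi / 2 - 2 * Real.pi by ring,
        Real.sin_sub_two_pi, Real.sin_pi_div_two] at g2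
      have := hr 0 1
      nlinarith
    · have h'' := lt_of_le_of_ne e1.2 hne
      have : 0 < Real.cos (θ 0 1 + Real.pi) :=
        Real.cos_pos_of_mem_Ioo ⟨by linarith, by linarith⟩
      rw [Real.cos_add_pi] at this
      linarith
  have c2 : Continuous fun s => θ s 1 := hθ.comp (by fun_prop : Continuous fun s : ℝ => (s, (1:ℝ)))
  have e3 := mem_Icc_of_cos_nonneg (g := fun s => θ s 1) c2.continuousOn (fun s hs => by
    have := (h s 1).1
    rw [b1, sub_zero] at this
    exact nonneg_of_mul_nonneg_right (this ▸ hA s hs) (hr s 1)) (by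
      simp only [e01, mem_Icc]; constructor <;> linarith)
  have e11 : θ 1 1 = Real.pi / 2 := le_antisymm e3.2 e2.1
  have g2 := (h 1 1).2
  rw [e11, Real.sin_pi_div_two] at g2
  have := hr 1 1
  linarith

/-- A curve joining two boundary points of a strip meets each curve which starts between them on
the boundary and ends on the far side of the strip. -/
lemma exists_eq_of_strip {d : ℝ} (hα : Continuous α) (hβ : Continuous β)
    (hA : ∀ s ∈ Icc (0:ℝ) 1, 0 ≤ (α s).re) (hB : ∀ s ∈ Icc (0:ℝ) 1, 0 ≤ (β s).re)
    (hA' : ∀ s ∈ Icc (0:ℝ) 1, (α s).re ≤ d)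
    (a0 : (α 0).re = 0) (a1 : (α 1).re = 0) (b0 : (β 0).re = 0) (b1 : (β 1).re = d)
    (h1 : (α 0).im < (β 0).im) (h2 : (β 0).im < (α 1).im) :
    ∃ s t, α s = β t := by
  by_contra! hne
  have hpi := Real.pi_pos
  obtain ⟨r, θ, hθ, h00, hr, h⟩ := exists_angle hα hβ hne (by simp [a0, b0]) (by simpa using h1)
  obtain ⟨e1, e2⟩ := angle_corners hθ h00 hr h (fun t ht => a0.trans_le (hB t ht)) (fun t ht =>
    a1.trans_le (hB t ht))
    (fun t ht => b0.trans_le (hA t ht)) (by rw [a1, b0]) h2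
  have c2 : Continuous fun s => θ s 1 := hθ.comp (by fun_prop : Continuous fun s : ℝ => (s, (1:ℝ)))
  have e3 := mem_Icc_of_cos_nonneg (g := fun s => θ s 1 + Real.pi)
    (c2.add continuous_const).continuousOn
    (fun s hs => by
    have := (h s 1).1
    rw [b1] at this
    rw [Real.cos_add_pi]
    have h5 : r s 1 * (-Real.cos (θ s 1)) = d - (α s).re := by linarith
    exact nonneg_of_mul_nonneg_right (h5 ▸ sub_nonneg.2 (hA' s hs)) (hr s 1)) (by
      simp only [mem_Icc]; constructor <;> linarith [e1.1, e1.2])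
  simp only [mem_Icc] at e3
  linarith [e2.1, e3.2]

end cross

section joined
variable {X : Type*} [TopologicalSpace X] {F : Set X} {x y : X}

/-- A path inside a set, viewed as a curve parametrised by the whole real line. -/
lemma JoinedIn.exists_curve (h : JoinedIn F x y) :
    ∃ f : ℝ → X, Continuous f ∧ (∀ t, f t ∈ F) ∧ f 0 = x ∧ f 1 = y := by
  obtain ⟨γ, hγ⟩ := h
  exact ⟨γ.extend, γ.continuous_extend, fun t => hγ _, by simp, by simp⟩

lemma joinedIn_of_continuousOn {f : ℝ → X} {a b : ℝ} (hf : ContinuousOn f (Icc a b))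
    (hab : a ≤ b) (h : ∀ t ∈ Icc a b, f t ∈ F) : JoinedIn F (f a) (f b) := by
  have hc : IsPathConnected (Icc a b) :=
    (convex_Icc a b).isPathConnected ⟨a, left_mem_Icc.2 hab⟩
  exact ((hc.image' hf).joinedIn (f a) (mem_image_of_mem f (left_mem_Icc.2 hab)) (f b)
    (mem_image_of_mem f (right_mem_Icc.2 hab))).mono (image_subset_iff.2 h)

lemma joinedIn_of_continuousOn_uIcc {f : ℝ → X} {a b : ℝ} (hf : ContinuousOn f (uIcc a b))
    (h : ∀ t ∈ uIcc a b, f t ∈ F) : JoinedIn F (f a) (f b) := by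
  rcases le_total a b with hab | hab
  · rw [uIcc_of_le hab] at hf h
    exact joinedIn_of_continuousOn hf hab h
  · rw [uIcc_of_ge hab] at hf h
    exact (joinedIn_of_continuousOn hf hab h).symm

end joined

/-- Curves in a half-plane chart with interleaved boundary endpoints cross. -/
lemma chart_cross {X : Type*} [TopologicalSpace X] {Δ P Q : Set X} {m : X → ℂ}
    (hm : ContinuousOn m Δ) (hinj : InjOn m Δ)
    (hre : ∀ z ∈ Δ, 0 ≤ (m z).re) (hP : P ⊆ Δ) (hQ : Q ⊆ Δ) {x₁ y₁ x₂ y₂ : X}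
    (h₁ : JoinedIn P x₁ y₁) (h₂ : JoinedIn Q x₂ y₂) (rx₁ : (m x₁).re = 0) (ry₁ : (m y₁).re = 0)
    (rx₂ : (m x₂).re = 0) (ry₂ : (m y₂).re = 0) (i₁ : (m x₁).im < (m x₂).im)
    (i₂ : (m x₂).im < (m y₁).im) (i₃ : (m y₁).im < (m y₂).im) : (P ∩ Q).Nonempty := by
  obtain ⟨f, fc, fP, rfl, rfl⟩ := h₁.exists_curve
  obtain ⟨g, gc, gQ, rfl, rfl⟩ := h₂.exists_curve
  obtain ⟨s, t, hst⟩ := exists_eq_of_interleaved (α := m ∘ f) (β := m ∘ g)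
    (hm.comp_continuous fc fun t => hP (fP t)) (hm.comp_continuous gc fun t => hQ (gQ t))
    (fun s _ => hre _ (hP (fP s))) (fun s _ => hre _ (hQ (gQ s))) rx₁ ry₁ rx₂ ry₂ i₁ i₂ i₃
  have : f s = g t := hinj (hP (fP s)) (hQ (gQ t)) hst
  exact ⟨f s, fP s, this ▸ gQ t⟩

/-- The half-plane coordinate adapted to the vertical line `x = c` and the side `σ`. -/
noncomputable def halfMap (c σ : ℝ) (z : ℝ × ℝ) : ℂ := ⟨σ * (z.1 - c), z.2⟩

lemma continuous_halfMap (c σ : ℝ) : Continuous (halfMap c σ) := by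
  have : halfMap c σ = fun z => ((σ * (z.1 - c) : ℝ) : ℂ) + (z.2 : ℝ) * Complex.I := by
    ext z; apply Complex.ext <;> simp [halfMap]
  rw [this]; fun_prop

lemma halfMap_injective (c : ℝ) {σ : ℝ} (hσ : σ ≠ 0) : Function.Injective (halfMap c σ) := by
  intro z w h
  have h1 := congrArg Complex.re h
  have h2 := congrArg Complex.im h
  simp only [halfMap] at h1 h2
  have := mul_left_cancel₀ hσ h1
  exact Prod.ext (by linarith) h2

/-- Curves on one side of a vertical line with interleaved endpoints on the line cross. -/
lemma half_cross {c σ : ℝ} (hσ : σ ≠ 0) {P Q : Set (ℝ × ℝ)}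
    (hP : P ⊆ {z | 0 ≤ σ * (z.1 - c)}) (hQ : Q ⊆ {z | 0 ≤ σ * (z.1 - c)}) {x₁ y₁ x₂ y₂ : ℝ × ℝ}
    (h₁ : JoinedIn P x₁ y₁) (h₂ : JoinedIn Q x₂ y₂) (rx₁ : x₁.1 = c) (ry₁ : y₁.1 = c)
    (rx₂ : x₂.1 = c) (ry₂ : y₂.1 = c) (i₁ : x₁.2 < x₂.2)
    (i₂ : x₂.2 < y₁.2) (i₃ : y₁.2 < y₂.2) : (P ∩ Q).Nonempty :=
  chart_cross (m := halfMap c σ) (Δ := {z | 0 ≤ σ * (z.1 - c)})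
      (continuous_halfMap c σ).continuousOn
    (halfMap_injective c hσ).injOn (fun z hz => by simpa [halfMap] using hz) hP hQ h₁ h₂
    (by simp [halfMap, rx₁]) (by simp [halfMap, ry₁]) (by simp [halfMap, rx₂])
    (by simp [halfMap, ry₂]) i₁ i₂ i₃

/-- A curve joining two points of the line `x = c` inside the strip between `x = c` and `x = d`
meets every curve from a point between them to the line `x = d`. -/
lemma strip_cross {c d σ : ℝ} (hσ : σ ≠ 0) {P Q : Set (ℝ × ℝ)}
    (hP : P ⊆ {z | 0 ≤ σ * (z.1 - c)}) (hP' : P ⊆ {z | σ * (z.1 - d) ≤ 0})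
    (hQ : Q ⊆ {z | 0 ≤ σ * (z.1 - c)}) {x₁ y₁ x₂ y₂ : ℝ × ℝ}
    (h₁ : JoinedIn P x₁ y₁) (h₂ : JoinedIn Q x₂ y₂) (rx₁ : x₁.1 = c) (ry₁ : y₁.1 = c)
    (rx₂ : x₂.1 = c) (ry₂ : y₂.1 = d) (i₁ : x₁.2 < x₂.2)
    (i₂ : x₂.2 < y₁.2) : (P ∩ Q).Nonempty := by
  obtain ⟨f, fc, fP, rfl, rfl⟩ := h₁.exists_curve
  obtain ⟨g, gc, gQ, rfl, rfl⟩ := h₂.exists_curve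
  obtain ⟨s, t, hst⟩ := exists_eq_of_strip (α := halfMap c σ ∘ f) (β := halfMap c σ ∘ g)
    (d := σ * (d - c)) ((continuous_halfMap c σ).comp fc) ((continuous_halfMap c σ).comp gc)
    (fun s _ => hP (fP s)) (fun s _ => hQ (gQ s))
    (fun s _ => by have := hP' (fP s); simp only [mem_ofPred_eq, halfMap,
        Function.comp] at *; linarith)
    (by simp [halfMap, rx₁]) (by simp [halfMap, ry₁]) (by simp [halfMap, rx₂])
    (by simp [halfMap, ry₂]) i₁ i₂
  have : f s = g t := halfMap_injective c hσ hst
  exact ⟨f s, fP s, this ▸ gQ t⟩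

/-- Restrict a joining path to the path component it lives in. -/
lemma JoinedIn.to_component {X : Type*} [TopologicalSpace X] {F : Set X} {x a b : X}
    (hxa : JoinedIn F x a) (h : JoinedIn F a b) : JoinedIn {z | JoinedIn F x z} a b := by
  obtain ⟨f, fc, fF, rfl, rfl⟩ := h.exists_curve
  refine joinedIn_of_continuousOn_uIcc fc.continuousOn fun t _ => ?_
  exact hxa.trans (joinedIn_of_continuousOn_uIcc fc.continuousOn fun t _ => fF t)

/-- The identification of the plane with the complex numbers. -/
def toC (z : ℝ × ℝ) : ℂ := ⟨z.1, z.2⟩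

lemma continuous_toC : Continuous toC := by
  have : toC = halfMap 0 1 := by ext z; simp [toC, halfMap]
  rw [this]; exact continuous_halfMap 0 1

lemma toC_injective : Function.Injective toC := by
  intro z w h
  exact Prod.ext (congrArg Complex.re h) (congrArg Complex.im h)

/-- The index set of the countable family of half-plane charts: closed half planes with rational
boundary, and closed rational discs punctured at one of four boundary points. -/
abbrev ChartIndex := (ℚ × Bool) ⊕ (ℚ × ℚ × ℚ × Fin 4)

/-- The sign attached to a boolean. -/
def boolSign (b : Bool) : ℝ := if b then 1 else -1

/-- The four poles of the disc charts. -/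
noncomputable def pole (k : Fin 4) : ℂ := Complex.I ^ (k : ℕ)

lemma norm_pole (k : Fin 4) : ‖pole k‖ = 1 := by simp [pole]

lemma pole_ne_zero (k : Fin 4) : pole k ≠ 0 := by simp [pole]

/-- The domain of a chart. -/
noncomputable def chartDom : ChartIndex → Set (ℝ × ℝ)
  | .inl (t, b) => {z | 0 ≤ boolSign b * (z.1 - t)}
  | .inr (u, v, ρ, k) => {z | 0 < (ρ : ℝ) ∧ ‖toC z - toC (u, v)‖ ≤ ρ ∧
      toC z - toC (u, v) ≠ ρ * pole k}

/-- The map of a chart, with values in the closed right half plane. -/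
noncomputable def chartMap : ChartIndex → ℝ × ℝ → ℂ
  | .inl (t, b) => halfMap t (boolSign b)
  | .inr (u, v, ρ, k) => fun z =>
      (1 + (toC z - toC (u, v)) / (ρ * pole k)) / (1 - (toC z - toC (u, v)) / (ρ * pole k))

lemma boolSign_ne_zero (b : Bool) : boolSign b ≠ 0 := by cases b <;> simp [boolSign]

lemma cayley_re (w : ℂ) : ((1 + w) / (1 - w)).re = (1 - ‖w‖ ^ 2) / Complex.normSq (1 - w) := by
  rw [Complex.div_re, ← add_div, ← Complex.normSq_eq_norm_sq]
  congr 1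
  simp [Complex.normSq_apply]; ring

section chart
variable (i : ChartIndex)

lemma one_sub_ne_zero_of_mem {u v ρ : ℚ} {k : Fin 4} {z : ℝ × ℝ}
    (hz : z ∈ chartDom (.inr (u, v, ρ, k))) :
    1 - (toC z - toC (u, v)) / (ρ * pole k) ≠ 0 := by
  obtain ⟨h1, h2, h3⟩ := hz
  have hρ : (ρ : ℂ) * pole k ≠ 0 := mul_ne_zero (by exact_mod_cast h1.ne') (pole_ne_zero k)
  rw [sub_ne_zero]
  intro h
  rw [eq_div_iff hρ, one_mul] at h
  exact h3 h.symm

lemma continuousOn_chartMap : ContinuousOn (chartMap i) (chartDom i) := by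
  rcases i with ⟨t, b⟩ | ⟨u, v, ρ, k⟩
  · exact (continuous_halfMap _ _).continuousOn
  · have := continuous_toC
    refine ContinuousOn.div (by fun_prop) (by fun_prop) fun z hz => one_sub_ne_zero_of_mem hz

lemma injOn_chartMap : InjOn (chartMap i) (chartDom i) := by
  rcases i with ⟨t, b⟩ | ⟨u, v, ρ, k⟩
  · exact (halfMap_injective _ (boolSign_ne_zero b)).injOn
  · intro z hz z' hz' h
    have h1 := one_sub_ne_zero_of_mem hz
    have h2 := one_sub_ne_zero_of_mem hz'
    have hρ : (ρ : ℂ) * pole k ≠ 0 := mul_ne_zero (by exact_mod_cast hz.1.ne') (pole_ne_zero k)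
    simp only [chartMap] at h
    rw [div_eq_div_iff h1 h2] at h
    have h3 : (toC z - toC (u, v)) / (ρ * pole k) = (toC z' - toC (u, v)) / (ρ * pole k) := by
      linear_combination h / 2
    rw [div_left_inj' hρ] at h3
    exact toC_injective (sub_left_injective h3)

lemma chartMap_re_disc {u v ρ : ℚ} {k : Fin 4} {z : ℝ × ℝ} :
    (chartMap (.inr (u, v, ρ, k)) z).re = (1 - (‖toC z - toC (u, v)‖ / ‖(ρ : ℝ)‖) ^ 2) /
      Complex.normSq (1 - (toC z - toC (u, v)) / (ρ * pole k)) := by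
  have h : ‖(ρ : ℂ)‖ = ‖(ρ : ℝ)‖ := by rw [← Complex.ofReal_ratCast, Complex.norm_real]
  rw [chartMap, cayley_re, norm_div, norm_mul, norm_pole, mul_one, h]

lemma chartMap_re_nonneg {z : ℝ × ℝ} (hz : z ∈ chartDom i) : 0 ≤ (chartMap i z).re := by
  rcases i with ⟨t, b⟩ | ⟨u, v, ρ, k⟩
  · exact hz
  · rw [chartMap_re_disc]
    have h1 := hz.1
    refine div_nonneg ?_ (Complex.normSq_nonneg _)
    rw [sub_nonneg, Real.norm_of_nonneg h1.le]
    exact pow_le_one₀ (by positivity) ((div_le_one h1).2 hz.2.1)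

variable {i} {H : Set (ℝ × ℝ)}

/-- Three boundary points of a chart, separated by two rationals, joined inside the chart. -/
def TripleAt (H : Set (ℝ × ℝ)) (i : ChartIndex) (s t : ℝ) (a b c : ℝ × ℝ) : Prop :=
  (chartMap i a).re = 0 ∧ (chartMap i b).re = 0 ∧ (chartMap i c).re = 0 ∧
  JoinedIn (H ∩ chartDom i) a b ∧ JoinedIn (H ∩ chartDom i) a c ∧
  (chartMap i a).im < s ∧ s < (chartMap i b).im ∧ (chartMap i b).im < t ∧ t < (chartMap i c).im

lemma not_interleaved {a a' b c b' c' : ℝ × ℝ} (hn : ¬ JoinedIn (H ∩ chartDom i) a a')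
    (hb : JoinedIn (H ∩ chartDom i) a b) (hc : JoinedIn (H ∩ chartDom i) a c)
    (hb' : JoinedIn (H ∩ chartDom i) a' b') (hc' : JoinedIn (H ∩ chartDom i) a' c')
    (rb : (chartMap i b).re = 0) (rc : (chartMap i c).re = 0) (rb' : (chartMap i b').re = 0)
    (rc' : (chartMap i c').re = 0) (h1 : (chartMap i b).im < (chartMap i b').im)
    (h2 : (chartMap i b').im < (chartMap i c).im) (h3 : (chartMap i c).im < (chartMap i c').im) :
    False := by
  obtain ⟨z, hz, hz'⟩ := chart_cross (continuousOn_chartMap i) (injOn_chartMap i)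
    (fun z hz => chartMap_re_nonneg i hz) (fun z (hz : JoinedIn _ a z) => hz.target_mem.2)
    (fun z (hz : JoinedIn _ a' z) => hz.target_mem.2)
    (hb.to_component (hb.symm.trans hc)) (hb'.to_component (hb'.symm.trans hc'))
    rb rc rb' rc' h1 h2 h3
  exact hn (JoinedIn.trans hz (JoinedIn.symm hz'))

lemma im_ne {a a' b b' : ℝ × ℝ} (hn : ¬ JoinedIn (H ∩ chartDom i) a a')
    (hb : JoinedIn (H ∩ chartDom i) a b) (hb' : JoinedIn (H ∩ chartDom i) a' b')
    (rb : (chartMap i b).re = 0) (rb' : (chartMap i b').re = 0) :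
    (chartMap i b).im ≠ (chartMap i b').im := by
  intro h
  have : b = b' := injOn_chartMap i hb.target_mem.2 hb'.target_mem.2
    (Complex.ext (by rw [rb, rb']) h)
  exact hn (hb.trans (this ▸ hb'.symm))

/-- Two triples at the same place lie in the same path component. -/
lemma TripleAt.joinedIn {s t : ℝ} {a b c a' b' c' : ℝ × ℝ} (h : TripleAt H i s t a b c)
    (h' : TripleAt H i s t a' b' c') : JoinedIn (H ∩ chartDom i) a a' := by
  by_contra hn
  wlog hlt : (chartMap i a).im < (chartMap i a').im generalizing a b c a' b' c'
  · refine this h' h (fun hh => hn hh.symm) (lt_of_le_of_ne (not_lt.1 hlt) ?_)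
    obtain ⟨ra, rb, rc, hb, hc, h1, h2, h3, h4⟩ := h
    obtain ⟨ra', rb', rc', hb', hc', h1', h2', h3', h4'⟩ := h'
    exact (im_ne hn (JoinedIn.refl hb.source_mem) (JoinedIn.refl hb'.source_mem) ra ra').symm
  obtain ⟨ra, rb, rc, hb, hc, h1, h2, h3, h4⟩ := h
  obtain ⟨ra', rb', rc', hb', hc', h1', h2', h3', h4'⟩ := h'
  have ha : JoinedIn (H ∩ chartDom i) a a := JoinedIn.refl hb.source_mem
  have ha' : JoinedIn (H ∩ chartDom i) a' a' := JoinedIn.refl hb'.source_mem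
  have hn' : ¬ JoinedIn (H ∩ chartDom i) a' a := fun h => hn h.symm
  have e1 : (chartMap i b').im < (chartMap i b).im := by
    by_contra! hh
    exact not_interleaved hn ha hb ha' hb' ra rb ra' rb' hlt (by linarith)
      (lt_of_le_of_ne hh (im_ne hn hb hb' rb rb'))
  have e2 : (chartMap i c).im < (chartMap i c').im := by
    by_contra! hh
    exact not_interleaved hn' hb' hc' hb hc rb' rc' rb rc e1 (by linarith)
      (lt_of_le_of_ne hh (im_ne hn hc hc' rc rc').symm)
  exact not_interleaved hn ha hc ha' hc' ra rc ra' rc' hlt (by linarith) e2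

variable (H)
/-- The path component of `x` in `H` carries three boundary points of a chart that are joined
inside the chart. -/
def Tripled (x : ℝ × ℝ) : Prop :=
  ∃ i a b c, JoinedIn H x a ∧ JoinedIn (H ∩ chartDom i) a b ∧ JoinedIn (H ∩ chartDom i) a c ∧
    (chartMap i a).re = 0 ∧ (chartMap i b).re = 0 ∧ (chartMap i c).re = 0 ∧
    a ≠ b ∧ a ≠ c ∧ b ≠ c

variable {H}

lemma Tripled.congr {x y : ℝ × ℝ} (h : Tripled H x) (hxy : JoinedIn H x y) : Tripled H y := by
  obtain ⟨i, a, b, c, h1, h2⟩ := h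
  exact ⟨i, a, b, c, hxy.symm.trans h1, h2⟩

lemma Tripled.exists_tripleAt {x : ℝ × ℝ} (h : Tripled H x) :
    ∃ (i : ChartIndex) (s t : ℚ) (a b c : ℝ × ℝ), JoinedIn H x a ∧ TripleAt H i s t a b c := by
  obtain ⟨i, a, b, c, hxa, hab, hac, ra, rb, rc, nab, nac, nbc⟩ := h
  have key : ∀ a b c : ℝ × ℝ, JoinedIn H x a → JoinedIn (H ∩ chartDom i) a b →
      JoinedIn (H ∩ chartDom i) a c → (chartMap i a).re = 0 → (chartMap i b).re = 0 →
      (chartMap i c).re = 0 → (chartMap i a).im < (chartMap i b).im →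
      (chartMap i b).im < (chartMap i c).im → 
      ∃ (i : ChartIndex) (s t : ℚ) (a b c : ℝ × ℝ), JoinedIn H x a ∧ TripleAt H i s t a b c := by
    intro a b c hxa hab hac ra rb rc h1 h2
    obtain ⟨s, hs1, hs2⟩ := exists_rat_btwn h1
    obtain ⟨t, ht1, ht2⟩ := exists_rat_btwn h2
    exact ⟨i, s, t, a, b, c, hxa, ra, rb, rc, hab, hac, hs1, hs2, ht1, ht2⟩
  have ne : ∀ {u v}, JoinedIn (H ∩ chartDom i) a u → JoinedIn (H ∩ chartDom i) a v →
      (chartMap i u).re = 0 → (chartMap i v).re = 0 → u ≠ v →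
      (chartMap i u).im ≠ (chartMap i v).im := by
    intro u v hu hv ru rv huv h
    exact huv (injOn_chartMap i hu.target_mem.2 hv.target_mem.2 (Complex.ext (by rw [ru, rv]) h))
  have haa : JoinedIn (H ∩ chartDom i) a a := JoinedIn.refl hab.source_mem
  have hxb : JoinedIn H x b := hxa.trans (hab.mono inter_subset_left)
  have hxc : JoinedIn H x c := hxa.trans (hac.mono inter_subset_left)
  have hbc := hab.symm.trans hac
  have n1 := ne haa hab ra rb nab
  have n2 := ne haa hac ra rc nac
  have n3 := ne hab hac rb rc nbc
  rcases n1.lt_or_gt with g1 | g1 <;> rcases n2.lt_or_gt with g2 | g2 <;>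
    rcases n3.lt_or_gt with g3 | g3
  · exact key a b c hxa hab hac ra rb rc g1 g3
  · exact key a c b hxa hac hab ra rc rb g2 g3
  · linarith
  · exact key c a b hxc hac.symm hbc.symm rc ra rb g2 g1
  · exact key b a c hxb hab.symm hbc rb ra rc g1 g2
  · linarith
  · exact key b c a hxb hbc hab.symm rb rc ra g3 g2
  · exact key c b a hxc hbc.symm hac.symm rc rb ra g3 g1

/-- Only countably many path components are tripled. -/
lemma exists_countable_tripled (H : Set (ℝ × ℝ)) :
    ∃ T : Set (ℝ × ℝ), T.Countable ∧ ∀ x, Tripled H x → ∃ y ∈ T, JoinedIn H x y := by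
  classical
  let I := ChartIndex × ℚ × ℚ
  let pick : I → ℝ × ℝ := fun j =>
    if h : ∃ a b c, TripleAt H j.1 j.2.1 j.2.2 a b c then h.choose else 0
  refine ⟨range pick, countable_range _, fun x hx => ?_⟩
  obtain ⟨i, s, t, a, b, c, hxa, habc⟩ := hx.exists_tripleAt
  refine ⟨pick (i, s, t), mem_range_self _, ?_⟩
  have h : ∃ a b c, TripleAt H i s t a b c := ⟨a, b, c, habc⟩
  have hp : pick (i, s, t) = h.choose := dif_pos h
  obtain ⟨b', c', h'⟩ := h.choose_spec
  rw [hp]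
  exact hxa.trans ((habc.joinedIn h').mono inter_subset_left)

end chart

lemma exists_first_ge {f : ℝ → ℝ} {a b ρ : ℝ} (hab : a ≤ b) (hf : ContinuousOn f (Icc a b))
    (h0 : f a < ρ) (h1 : ρ ≤ f b) :
    ∃ s ∈ Ioc a b, f s = ρ ∧ ∀ t ∈ Ico a s, f t < ρ := by
  have hc : IsCompact (Icc a b ∩ f ⁻¹' Ici ρ) :=
    isCompact_Icc.of_isClosed_subset (hf.preimage_isClosed_of_isClosed isClosed_Icc isClosed_Ici)
      inter_subset_left
  obtain ⟨s, ⟨hs, hs'⟩, hmin⟩ := hc.exists_isLeast ⟨b, right_mem_Icc.2 hab, h1⟩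
  have hlt : ∀ t ∈ Ico a s, f t < ρ := by
    intro t ht
    by_contra! h
    exact absurd (hmin ⟨⟨ht.1, ht.2.le.trans hs.2⟩, h⟩) (not_le.2 ht.2)
  have has : a < s := lt_of_le_of_ne hs.1 (by rintro rfl; exact absurd h0 (not_lt.2 hs'))
  refine ⟨s, ⟨has, hs.2⟩, le_antisymm ?_ hs', hlt⟩
  by_contra! h
  obtain ⟨t, ht, hft⟩ := intermediate_value_Icc hs.1 (hf.mono (Icc_subset_Icc_right hs.2))
    (show ρ ∈ Icc (f a) (f s) from ⟨h0.le, h.le⟩)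
  rcases ht.2.eq_or_lt with rfl | h'
  · exact h.ne' hft
  · exact (hlt t ⟨ht.1, h'⟩).ne hft

lemma pole_injective : Function.Injective pole := by
  have h : (Complex.I : ℂ) ^ 3 = -Complex.I := by rw [pow_succ, Complex.I_sq]; ring
  intro a b hab
  fin_cases a <;> fin_cases b <;> first | rfl | (exfalso; revert hab; norm_num [pole, h,
      Complex.ext_iff])

/-- A triod whose three legs lie in `H` makes the component of its centre tripled. -/
lemma tripled_of_triod {H : Set (ℝ × ℝ)} {z : ℝ × ℝ} (l : Fin 3 → ℝ → ℝ × ℝ)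
    (hl : ∀ j, ContinuousOn (l j) (Icc 0 1)) (hH : ∀ j, ∀ s ∈ Icc (0:ℝ) 1, l j s ∈ H)
    (h0 : ∀ j, l j 0 = z) (hz : ∀ j, ∀ s ∈ Ioc (0:ℝ) 1, l j s ≠ z)
    (hd : ∀ i j, ∀ s ∈ Ioc (0:ℝ) 1, ∀ t ∈ Ioc (0:ℝ) 1, l i s = l j t → i = j) :
    Tripled H z := by
  have hd0 : ∀ j, 0 < ‖toC (l j 1) - toC z‖ := fun j =>
    norm_pos_iff.2 (sub_ne_zero.2 fun h => hz j 1 ⟨zero_lt_one, le_rfl⟩ (toC_injective h))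
  obtain ⟨D, hD0, hD⟩ : ∃ D, 0 < D ∧ ∀ j, D ≤ ‖toC (l j 1) - toC z‖ := by
    obtain ⟨j, hj⟩ := Finite.exists_min fun j => ‖toC (l j 1) - toC z‖
    exact ⟨_, hd0 j, hj⟩
  obtain ⟨ρ, hρ1, hρ2⟩ := exists_rat_btwn (show D / 4 < D / 2 by linarith)
  have hρ0 : (0 : ℝ) < ρ := by linarith
  obtain ⟨u, v, huv⟩ : ∃ u v : ℚ, ‖toC z - toC ((u : ℝ), (v : ℝ))‖ < D / 4 := by
    have hc : ContinuousAt (fun w => ‖toC z - toC w‖) z := by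
      have := continuous_toC
      fun_prop
    have hn : {w | ‖toC z - toC w‖ < D / 4} ∈ 𝓝 z :=
      hc.eventually_lt continuousAt_const (by simpa using hD0)
    have hdense : DenseRange (Prod.map ((↑) : ℚ → ℝ) ((↑) : ℚ → ℝ)) :=
      Rat.denseRange_cast.prodMap Rat.denseRange_cast
    obtain ⟨⟨u, v⟩, h⟩ := hdense.exists_mem_open isOpen_interior ⟨z, mem_interior_iff_mem_nhds.2 hn⟩
    have h' := interior_subset (s := {w | ‖toC z - toC w‖ < D / 4}) h
    exact ⟨u, v, h'⟩
  set c := toC ((u : ℝ), (v : ℝ)) with hcdef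
  have hfirst : ∀ j, ∃ s ∈ Ioc (0:ℝ) 1, ‖toC (l j s) - c‖ = ρ ∧
      ∀ t ∈ Ico 0 s, ‖toC (l j t) - c‖ < ρ := by
    intro j
    refine exists_first_ge zero_le_one ?_ (by rw [h0]; linarith) ?_
    · exact ((continuous_toC.comp_continuousOn (hl j)).sub continuousOn_const).norm
    · have h1 := norm_sub_le_norm_sub_add_norm_sub (toC (l j 1)) c (toC z)
      rw [norm_sub_rev c] at h1
      linarith [hD j]
  choose s hs hsρ hslt using hfirst
  obtain ⟨k, hk⟩ : ∃ k, ∀ j, toC (l j (s j)) - c ≠ ρ * pole k := by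
    by_contra! h
    choose f hf using h
    have : Function.Injective f := by
      intro k k' hkk
      have h1 := hf k
      rw [hkk, hf k'] at h1
      have hρ : (ρ : ℂ) ≠ 0 := by exact_mod_cast hρ0.ne'
      exact (pole_injective (mul_left_cancel₀ hρ h1)).symm
    simpa using Fintype.card_le_of_injective f this
  have hnorm : ‖(ρ : ℂ) * pole k‖ = ρ := by
    rw [norm_mul, norm_pole, mul_one, ← Complex.ofReal_ratCast, Complex.norm_real,
      Real.norm_of_nonneg hρ0.le]
  have hj : ∀ j, JoinedIn (H ∩ chartDom (.inr (u, v, ρ, k))) z (l j (s j)) := by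
    intro j
    have := joinedIn_of_continuousOn (f := l j) (a := 0) (b := s j)
      (F := H ∩ chartDom (.inr (u, v, ρ, k)))
      ((hl j).mono (Icc_subset_Icc_right (hs j).2)) (hs j).1.le ?_
    · rwa [h0] at this
    · intro t ht
      refine ⟨hH j t ⟨ht.1, ht.2.trans (hs j).2⟩, hρ0, ?_, ?_⟩
      · rcases ht.2.eq_or_lt with rfl | h
        · exact (hsρ j).le
        · exact (hslt j t ⟨ht.1, h⟩).le
      · rcases ht.2.eq_or_lt with rfl | h
        · exact hk j
        · intro h'
          have := hslt j t ⟨ht.1, h⟩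
          rw [h', hnorm] at this
          exact lt_irrefl _ this
  have hre : ∀ j, (chartMap (.inr (u, v, ρ, k)) (l j (s j))).re = 0 := by
    intro j
    rw [chartMap_re_disc, ← hcdef, hsρ j, Real.norm_of_nonneg hρ0.le, div_self hρ0.ne']
    simp
  have hne : ∀ i j, i ≠ j → l i (s i) ≠ l j (s j) := fun i j hij h =>
    hij (hd i j _ (hs i) _ (hs j) h)
  exact ⟨_, _, _, _, (hj 0).mono inter_subset_left, (hj 0).symm.trans (hj 1),
    (hj 0).symm.trans (hj 2), hre 0, hre 1, hre 2, hne 0 1 (by decide), hne 0 2 (by decide),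
    hne 1 2 (by decide)⟩

/-- If a curve lands on an interior point of an arc in `H`, the component is tripled. -/
lemma tripled_of_landing {H : Set (ℝ × ℝ)} {γ δ : ℝ → ℝ × ℝ} (hγ : ContinuousOn γ (Icc 0 1))
    (hδ : ContinuousOn δ (Icc 0 1)) (hinj : InjOn γ (Icc 0 1)) (hγH : ∀ t ∈ Icc (0:ℝ) 1, γ t ∈ H)
    (hδH : ∀ t ∈ Icc (0:ℝ) 1, δ t ∈ H) {t₀ : ℝ} (ht₀ : t₀ ∈ Ioo (0:ℝ) 1) (h1 : δ 1 = γ t₀)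
    (hdisj : ∀ s ∈ Ico (0:ℝ) 1, δ s ∉ γ '' Icc 0 1) : Tripled H (γ t₀) := by
  have hA : ∀ s ∈ Icc (0:ℝ) 1, t₀ + s * (1 - t₀) ∈ Icc (0:ℝ) 1 := fun s hs =>
    ⟨by nlinarith [hs.1, ht₀.1, ht₀.2], by nlinarith [hs.2, ht₀.2]⟩
  have hB : ∀ s ∈ Icc (0:ℝ) 1, t₀ - s * t₀ ∈ Icc (0:ℝ) 1 := fun s hs =>
    ⟨by nlinarith [hs.2, ht₀.1, ht₀.2], by nlinarith [hs.1, ht₀.2, ht₀.1]⟩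
  have hC : ∀ s ∈ Icc (0:ℝ) 1, 1 - s ∈ Icc (0:ℝ) 1 := fun s hs =>
    ⟨by linarith [hs.2], by linarith [hs.1]⟩
  have hC' : ∀ s ∈ Ioc (0:ℝ) 1, 1 - s ∈ Ico (0:ℝ) 1 := fun s hs =>
    ⟨by linarith [hs.2], by linarith [hs.1]⟩
  have ht : t₀ ∈ Icc (0:ℝ) 1 := Ioo_subset_Icc_self ht₀
  have hAB : ∀ s ∈ Ioc (0:ℝ) 1, ∀ t ∈ Ioc (0:ℝ) 1,
      γ (t₀ + s * (1 - t₀)) ≠ γ (t₀ - t * t₀) := by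
    intro s hs t ht' h
    have := hinj (hA s (Ioc_subset_Icc_self hs)) (hB t (Ioc_subset_Icc_self ht')) h
    nlinarith [mul_pos hs.1 (sub_pos.2 ht₀.2), mul_pos ht'.1 ht₀.1]
  refine tripled_of_triod ![fun s => γ (t₀ + s * (1 - t₀)), fun s => γ (t₀ - s * t₀),
    fun s => δ (1 - s)] ?_ ?_ ?_ ?_ ?_
  · intro j
    fin_cases j
    · exact hγ.comp (by fun_prop) hA
    · exact hγ.comp (by fun_prop) hB
    · exact hδ.comp (by fun_prop) hC
  · intro j s hs
    fin_cases j
    · exact hγH _ (hA s hs)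
    · exact hγH _ (hB s hs)
    · exact hδH _ (hC s hs)
  · intro j
    fin_cases j <;> simp [h1]
  · intro j s hs
    fin_cases j
    · intro h
      have := hinj (hA s (Ioc_subset_Icc_self hs)) ht h
      nlinarith [mul_pos hs.1 (sub_pos.2 ht₀.2)]
    · intro h
      have := hinj (hB s (Ioc_subset_Icc_self hs)) ht h
      nlinarith [mul_pos hs.1 ht₀.1]
    · intro h
      exact hdisj _ (hC' s hs) ⟨t₀, ht, h.symm⟩
  · intro i j s hs t ht' h
    fin_cases i <;> fin_cases j <;> first | rfl | exfalso
    · exact hAB s hs t ht' h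
    · exact hdisj _ (hC' t ht') ⟨_, hA s (Ioc_subset_Icc_self hs), h⟩
    · exact hAB t ht' s hs h.symm
    · exact hdisj _ (hC' t ht') ⟨_, hB s (Ioc_subset_Icc_self hs), h⟩
    · exact hdisj _ (hC' s hs) ⟨_, hA t (Ioc_subset_Icc_self ht'), h.symm⟩
    · exact hdisj _ (hC' s hs) ⟨_, hB t (Ioc_subset_Icc_self ht'), h.symm⟩

/-- A weight on sets of points of the plane, which is strictly monotone on nonempty closed sets. -/
noncomputable def wt (A : Set (ℝ × ℝ)) : ℝ :=
  ∑' i : ℕ, (1 / 2 : ℝ) ^ i * (1 - min 1 (infDist (TopologicalSpace.denseSeq (ℝ × ℝ) i) A))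

lemma wt_summable (A : Set (ℝ × ℝ)) : Summable fun i : ℕ =>
    (1 / 2 : ℝ) ^ i * (1 - min 1 (infDist (TopologicalSpace.denseSeq (ℝ × ℝ) i) A)) := by
  refine Summable.of_nonneg_of_le (fun i => ?_) (fun i => ?_)
    (summable_geometric_of_lt_one (by norm_num) (by norm_num : (1 / 2 : ℝ) < 1))
  · exact mul_nonneg (by positivity) (sub_nonneg.2 (min_le_left _ _))
  · exact mul_le_of_le_one_right (by positivity)
      (sub_le_self _ (le_min zero_le_one infDist_nonneg))

lemma wt_le_wt_add {A B : Set (ℝ × ℝ)} {ε : ℝ}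
    (h : ∀ z, infDist z A ≤ infDist z B + ε) (hε : 0 ≤ ε) : wt B ≤ wt A + 2 * ε := by
  have hs := (summable_geometric_of_lt_one (by norm_num) (by norm_num :
    (1 / 2 : ℝ) < 1)).mul_right ε
  have h2 : ∑' i : ℕ, (1 / 2 : ℝ) ^ i * ε = 2 * ε := by rw [tsum_mul_right, tsum_geometric_two]
  rw [wt, wt, ← h2, ← (wt_summable A).tsum_add hs]
  refine (wt_summable B).tsum_le_tsum (fun i => ?_) ((wt_summable A).add hs)
  rw [← mul_add]
  refine mul_le_mul_of_nonneg_left ?_ (by positivity)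
  have := h (TopologicalSpace.denseSeq (ℝ × ℝ) i)
  have h3 : min 1 (infDist (TopologicalSpace.denseSeq (ℝ × ℝ) i) A) ≤
      min 1 (infDist (TopologicalSpace.denseSeq (ℝ × ℝ) i) B) + ε := by
    rw [← min_add_add_right]
    exact min_le_min (by linarith) this
  linarith

lemma wt_mono {A B : Set (ℝ × ℝ)} (hA : A.Nonempty) (h : A ⊆ B) : wt A ≤ wt B := by
  have := wt_le_wt_add (A := B) (B := A) (ε := 0)
    (fun z => by rw [add_zero]; exact infDist_le_infDist_of_subset h hA) le_rfl
  linarith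

lemma wt_lt_wt {A B : Set (ℝ × ℝ)} (hA : A.Nonempty) (hAc : IsClosed A) (h : A ⊆ B) {x : ℝ × ℝ}
    (hx : x ∈ B) (hxA : x ∉ A) : wt A < wt B := by
  have h0 : 0 < infDist x A := (hAc.notMem_iff_infDist_pos hA).1 hxA
  set m := min 1 (infDist x A) with hm
  have hm0 : 0 < m := lt_min one_pos h0
  obtain ⟨i, hi⟩ := (TopologicalSpace.denseRange_denseSeq (ℝ × ℝ)).exists_dist_lt x (half_pos hm0)
  refine (wt_summable A).tsum_lt_tsum (i := i) (fun j => ?_) ?_ (wt_summable B)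
  · refine mul_le_mul_of_nonneg_left (sub_le_sub_left (min_le_min le_rfl ?_) _) (by positivity)
    exact infDist_le_infDist_of_subset h hA
  · refine mul_lt_mul_of_pos_left (sub_lt_sub_left ?_ _) (by positivity)
    have h1 : infDist (TopologicalSpace.denseSeq (ℝ × ℝ) i) B < m / 2 :=
      (infDist_le_dist_of_mem hx).trans_lt (by rwa [dist_comm])
    have h2 : infDist x A ≤ infDist (TopologicalSpace.denseSeq (ℝ × ℝ) i) A +
        dist x (TopologicalSpace.denseSeq (ℝ × ℝ) i) := infDist_le_infDist_add_dist
    have h3 : m ≤ infDist x A := min_le_right _ _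
    have h4 : m ≤ 1 := min_le_left _ _
    refine (min_le_right _ _).trans_lt (h1.trans (lt_min ?_ ?_)) <;> linarith

lemma wt_abs_image_le {ι : Type*} {s : Set ι} {f g : ι → ℝ × ℝ} {ε : ℝ} (hε : 0 ≤ ε)
    (h : ∀ i ∈ s, dist (f i) (g i) ≤ ε) : |wt (f '' s) - wt (g '' s)| ≤ 2 * ε := by
  rcases s.eq_empty_or_nonempty with rfl | hs
  · simpa using hε
  have key : ∀ f g : ι → ℝ × ℝ, (∀ i ∈ s, dist (f i) (g i) ≤ ε) →
      wt (g '' s) ≤ wt (f '' s) + 2 * ε := by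
    intro f g h
    refine wt_le_wt_add (fun z => ?_) hε
    rw [← sub_le_iff_le_add]
    refine (le_infDist (hs.image g)).2 ?_
    rintro _ ⟨i, hi, rfl⟩
    have h1 := infDist_le_dist_of_mem (x := z) (mem_image_of_mem f hi)
    have h2 := dist_triangle_right z (f i) (g i)
    linarith [h i hi]
  rw [abs_sub_le_iff]
  constructor
  · linarith [key g f fun i hi => by rw [dist_comm]; exact h i hi]
  · linarith [key f g h]

/-- A path is canonical when the weight of its initial segments grows linearly. -/
def Canon (f : C(unitInterval, ℝ × ℝ)) : Prop :=
  ∀ t : unitInterval, wt (f '' Iic t) - wt {f 0} = t * (wt (range f) - wt {f 0})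

/-- The canonically parametrised arcs. -/
def canonArcs : Set C(unitInterval, ℝ × ℝ) := {f | Function.Injective f ∧ Canon f}

lemma continuous_wt_image (s : Set unitInterval) :
    Continuous fun f : C(unitInterval, ℝ × ℝ) => wt (f '' s) := by
  rw [Metric.continuous_iff]
  intro g ε hε
  refine ⟨ε / 4, by positivity, fun f hf => ?_⟩
  have := wt_abs_image_le (s := s) (f := f) (g := g) (ε := ε / 4) (by positivity)
    fun i _ => (ContinuousMap.dist_apply_le_dist i).trans hf.le
  rw [Real.dist_eq]
  linarith

lemma isClosed_setOf_canon : IsClosed {f : C(unitInterval, ℝ × ℝ) | Canon f} := by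
  have h0 : Continuous fun f : C(unitInterval, ℝ × ℝ) => wt {f 0} := by
    simpa using continuous_wt_image {0}
  have h1 : Continuous fun f : C(unitInterval, ℝ × ℝ) => wt (range f) := by
    simpa using continuous_wt_image univ
  have : {f : C(unitInterval, ℝ × ℝ) | Canon f} = ⋂ t : unitInterval,
      {f : C(unitInterval, ℝ × ℝ) | wt (f '' Iic t) - wt {f 0} = t * (wt
          (range f) - wt {f 0})} := by
    ext f; simp [Canon]
  rw [this]
  exact isClosed_iInter fun t => isClosed_eq ((continuous_wt_image _).sub h0)
    (continuous_const.mul (h1.sub h0))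

lemma canonArcs_ext {f g : C(unitInterval, ℝ × ℝ)} (hf : f ∈ canonArcs) (hg : g ∈ canonArcs)
    (hr : range f = range g) (h0 : f 0 = g 0) : f = g := by
  obtain ⟨fi, fc⟩ := hf
  obtain ⟨gi, gc⟩ := hg
  have hmem : ∀ t, ∃ s, g s = f t := fun t => by
    have : f t ∈ range g := hr ▸ mem_range_self t
    exact this
  choose h hh using hmem
  have hge : IsClosedEmbedding g := g.continuous.isClosedEmbedding gi
  have hcont : Continuous h := by
    rw [hge.isInducing.continuous_iff]
    convert f.continuous
    ext1 t; exact hh t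
  have hinj : Function.Injective h := fun s t hst => fi (by rw [← hh s, ← hh t, hst])
  have hh0 : h 0 = 0 := gi (by rw [hh, h0])
  have hmono : StrictMono h := hcont.strictMono_of_inj_boundedOrder
    (by change h 0 ≤ _; rw [hh0]; exact bot_le) hinj
  have hsurj : Function.Surjective h := by
    intro s
    obtain ⟨t, ht⟩ : g s ∈ range f := hr ▸ mem_range_self s
    exact ⟨t, gi (by rw [hh, ht])⟩
  have hIic : ∀ t, f '' Iic t = g '' Iic (h t) := by
    intro t
    ext z
    constructor
    · rintro ⟨s, hs, rfl⟩
      exact ⟨h s, hmono.monotone hs, hh s⟩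
    · rintro ⟨s, hs, rfl⟩
      obtain ⟨s', rfl⟩ := hsurj s
      exact ⟨s', hmono.le_iff_le.1 hs, (hh s').symm⟩
  have hpos : 0 < wt (range f) - wt {f 0} := by
    refine sub_pos.2 (wt_lt_wt (singleton_nonempty _) isClosed_singleton
      (singleton_subset_iff.2 (mem_range_self _)) (mem_range_self 1) ?_)
    exact fun h => zero_ne_one (fi (mem_singleton_iff.1 h)).symm
  ext1 t
  have h1 := fc t
  have h2 := gc (h t)
  rw [← hIic, ← h0, ← hr, h1] at h2
  have h3 : t = h t := Subtype.ext (mul_right_cancel₀ hpos.ne' h2)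
  conv_rhs => rw [h3]
  exact (hh t).symm

/-- Closed sets of parameters which skip loops of `f`. -/
def LoopFree {X : Type*} [TopologicalSpace X] (f : C(𝕀, X)) (P : Set 𝕀) : Prop :=
  IsClosed P ∧ 0 ∈ P ∧ 1 ∈ P ∧ ∀ u ∈ P, ∀ v ∈ P, u < v → Disjoint (Ioo u v) P → f u = f v

section
variable {X : Type*} [MetricSpace X] (f : C(𝕀, X))

lemma loopFree_univ : LoopFree f univ :=
  ⟨isClosed_univ, trivial, trivial, fun u _ v _ huv h => by
    obtain ⟨w, hw⟩ := exists_between huv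
    exact absurd trivial (disjoint_left.1 h hw)⟩

lemma loopFree_sInter {c : Set (Set 𝕀)} (hc : IsChain (· ⊆ ·) c) (hne : c.Nonempty)
    (h : ∀ P ∈ c, LoopFree f P) : LoopFree f (⋂₀ c) := by
  refine ⟨isClosed_sInter fun P hP => (h P hP).1, fun P hP => (h P hP).2.1,
    fun P hP => (h P hP).2.2.1, fun u hu v hv huv hd => ?_⟩
  by_contra hfuv
  obtain ⟨U, V, hU, hV, hfu, hfv, hUV⟩ := t2_separation hfuv
  have hU' : f ⁻¹' U ∈ 𝓝[≥] u := mem_nhdsWithin_of_mem_nhds (f.continuous.continuousAt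
    (hU.mem_nhds hfu))
  have hV' : f ⁻¹' V ∈ 𝓝[≤] v := mem_nhdsWithin_of_mem_nhds (f.continuous.continuousAt
    (hV.mem_nhds hfv))
  obtain ⟨w, huw, hwv⟩ := exists_between huv
  obtain ⟨u₁, hu₁, hu₁'⟩ := (mem_nhdsGE_iff_exists_mem_Ioc_Ico_subset huw).1 hU'
  obtain ⟨v₁, hv₁, hv₁'⟩ := (mem_nhdsLE_iff_exists_mem_Ico_Ioc_subset hwv).1 hV'
  obtain ⟨u₂, hu₂, hu₂'⟩ := exists_between hu₁.1
  obtain ⟨v₂, hv₂', hv₂⟩ := exists_between hv₁.2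
  have : ∃ P ∈ c, Disjoint (Icc u₂ v₂) P := by
    by_contra! hcon
    have : Nonempty c := hne.to_subtype
    obtain ⟨x, hx⟩ := IsCompact.nonempty_iInter_of_directed_nonempty_isCompact_isClosed
      (fun P : c => Icc u₂ v₂ ∩ P.1) (fun P Q => by
        rcases hc.total P.2 Q.2 with h | h
        · exact ⟨P, subset_rfl, inter_subset_inter_right _ h⟩
        · exact ⟨Q, inter_subset_inter_right _ h, subset_rfl⟩)
      (fun P => not_disjoint_iff_nonempty_inter.1 (hcon P.1 P.2))
      (fun P => isCompact_Icc.inter_right (h P.1 P.2).1)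
      (fun P => isClosed_Icc.inter (h P.1 P.2).1)
    rw [mem_iInter] at hx
    have hx0 := (hx ⟨_, hne.some_mem⟩).1
    exact disjoint_left.1 hd ⟨hu₂.trans_le hx0.1, hx0.2.trans_lt hv₂⟩
      fun P hP => (hx ⟨P, hP⟩).2
  obtain ⟨P, hP, hdP⟩ := this
  obtain ⟨a, ⟨haP, ha⟩, hamax⟩ := ((h P hP).1.inter isClosed_Icc).isCompact.exists_isGreatest
    (⟨u, hu P hP, left_mem_Icc.2 hu₂.le⟩ : (P ∩ Icc u u₂).Nonempty)
  obtain ⟨b, ⟨hbP, hb⟩, hbmin⟩ := ((h P hP).1.inter isClosed_Icc).isCompact.exists_isLeast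
    (⟨v, hv P hP, right_mem_Icc.2 hv₂.le⟩ : (P ∩ Icc v₂ v).Nonempty)
  have haU : f a ∈ U := hu₁' ⟨ha.1, ha.2.trans_lt hu₂'⟩
  have hbV : f b ∈ V := hv₁' ⟨hv₂'.trans_le hb.1, hb.2⟩
  have huv₂ : u₂ < v₂ := hu₂'.trans_le (hu₁.2.trans (hv₁.1.trans hv₂'.le))
  have hab : a < b := ha.2.trans_lt (huv₂.trans_le hb.1)
  have := (h P hP).2.2.2 a haP b hbP hab (disjoint_left.2 fun x hx hxP => by
    rcases le_total x u₂ with h1 | h1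
    · exact absurd (hamax ⟨hxP, ha.1.trans hx.1.le, h1⟩) (not_le.2 hx.1)
    rcases le_total v₂ x with h2 | h2
    · exact absurd (hbmin ⟨hxP, h2, hx.2.le.trans hb.2⟩) (not_le.2 hx.2)
    exact disjoint_left.1 hdP ⟨h1, h2⟩ hxP)
  exact disjoint_left.1 hUV haU (this ▸ hbV)

/-- A loop-free set of parameters on which `f` is injective up to gaps. -/
lemma exists_minimal_loopFree : ∃ P, LoopFree f P ∧
    ∀ s ∈ P, ∀ t ∈ P, s < t → f s = f t → Disjoint (Ioo s t) P := by
  obtain ⟨P, hP⟩ := zorn_superset {P | LoopFree f P} (fun c hc hchain => by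
    rcases c.eq_empty_or_nonempty with rfl | hne
    · exact ⟨univ, loopFree_univ f, by simp⟩
    · exact ⟨⋂₀ c, loopFree_sInter f hchain hne hc, fun s hs => sInter_subset_of_mem hs⟩)
  refine ⟨P, hP.prop, fun s hs t ht hst hfst => ?_⟩
  have hP' : LoopFree f (P \ Ioo s t) := by
    refine ⟨hP.prop.1.sdiff isOpen_Ioo, ⟨hP.prop.2.1, fun h => not_lt_bot h.1⟩,
      ⟨hP.prop.2.2.1, fun h => not_top_lt h.2⟩, fun u hu v hv huv hd => ?_⟩
    by_cases h : Disjoint (Ioo u v) P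
    · exact hP.prop.2.2.2 u hu.1 v hv.1 huv h
    obtain ⟨x, hx, hxP⟩ := not_disjoint_iff.1 h
    have hxst : x ∈ Ioo s t := by
      by_contra hx'
      exact disjoint_left.1 hd hx ⟨hxP, hx'⟩
    have h1 : u ≤ s := by
      by_contra! hh
      exact hu.2 ⟨hh, hx.1.trans hxst.2⟩
    have h2 : t ≤ v := by
      by_contra! hh
      exact hv.2 ⟨hxst.1.trans hx.2, hh⟩
    have h3 : u = s := by
      by_contra hne
      exact disjoint_left.1 hd ⟨lt_of_le_of_ne h1 hne, hxst.1.trans hx.2⟩ ⟨hs, fun h =>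
        lt_irrefl _ h.1⟩
    have h4 : t = v := by
      by_contra hne
      exact disjoint_left.1 hd ⟨hx.1.trans hxst.2, lt_of_le_of_ne h2 hne⟩ ⟨ht, fun h =>
        lt_irrefl _ h.2⟩
    rw [h3, ← h4, hfst]
  have := hP.le_of_le hP' sdiff_subset
  exact disjoint_left.2 fun x hx hxP => (this hxP).2 hx

/-- Every path can be shortened, inside its range, to one with interval fibres. -/
lemma exists_interval_fibres : ∃ F : C(𝕀, X), F 0 = f 0 ∧ F 1 = f 1 ∧ range F ⊆ range f ∧
    ∀ a b c, a ≤ b → b ≤ c → F a = F c → F b = F a := by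
  obtain ⟨P, hP, hmin⟩ := exists_minimal_loopFree f
  have hex : ∀ t, ∃ r, IsGreatest (P ∩ Iic t) r := fun t =>
    (hP.1.inter isClosed_Iic).isCompact.exists_isGreatest ⟨0, hP.2.1, mem_Iic.2 bot_le⟩
  choose ρ hρ using hex
  have hρmono : ∀ {s t}, s ≤ t → ρ s ≤ ρ t := fun {s t} h =>
    (hρ t).2 ⟨(hρ s).1.1, (hρ s).1.2.trans h⟩
  have hρP : ∀ t ∈ P, ρ t = t := fun t ht => le_antisymm (hρ t).1.2 ((hρ t).2 ⟨ht,
    mem_Iic.2 le_rfl⟩)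
  have hosc : ∀ s t, s ≤ t → f (ρ s) = f (ρ t) ∨
      ∃ v ∈ Icc s t, ∃ v' ∈ Icc s t, f (ρ s) = f v ∧ f (ρ t) = f v' := by
    intro s t hst
    by_cases hne : (P ∩ Icc s t).Nonempty
    · obtain ⟨v, ⟨hvP, hv⟩, hvmin⟩ := (hP.1.inter isClosed_Icc).isCompact.exists_isLeast hne
      refine Or.inr ⟨v, hv, ρ t, ⟨?_, (hρ t).1.2⟩, ?_, rfl⟩
      · exact hv.1.trans ((hρ t).2 ⟨hvP, hv.2⟩)
      · have h1 : ρ s ≤ v := (hρ s).1.2.trans hv.1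
        rcases h1.eq_or_lt with h1 | h1
        · rw [h1]
        · refine hP.2.2.2 _ (hρ s).1.1 _ hvP h1 (disjoint_left.2 fun x hx hxP => ?_)
          rcases le_total x s with h2 | h2
          · exact absurd ((hρ s).2 ⟨hxP, h2⟩) (not_le.2 hx.1)
          · exact absurd (hvmin ⟨hxP, h2, hx.2.le.trans hv.2⟩) (not_le.2 hx.2)
    · left
      congr 1
      refine le_antisymm (hρmono hst) ((hρ s).2 ⟨(hρ t).1.1, ?_⟩)
      by_contra h
      exact hne ⟨ρ t, (hρ t).1.1, (not_le.1 h).le, (hρ t).1.2⟩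
  have hcont : Continuous fun t => f (ρ t) := by
    have huc : UniformContinuous f := CompactSpace.uniformContinuous_of_continuous f.continuous
    rw [Metric.continuous_iff]
    intro b ε hε
    obtain ⟨δ, hδ, h⟩ := Metric.uniformContinuous_iff.1 huc ε hε
    have key : ∀ s t : 𝕀, s ≤ t → dist s t < δ → dist (f (ρ s)) (f (ρ t)) < ε := by
      intro s t hst hd
      rcases hosc s t hst with h1 | ⟨v, hv, v', hv', h1, h2⟩
      · rw [h1, dist_self]; exact hε
      · rw [h1, h2]
        refine h (lt_of_le_of_lt ?_ hd)
        exact Real.dist_le_of_mem_Icc hv hv' |>.trans (by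
          rw [dist_comm, Subtype.dist_eq, Real.dist_eq]; exact le_abs_self _)
    refine ⟨δ, hδ, fun a ha => ?_⟩
    rcases le_total a b with hab | hab
    · exact key a b hab ha
    · rw [dist_comm] at ha ⊢
      exact key b a hab ha
  refine ⟨⟨fun t => f (ρ t), hcont⟩, by simp [hρP 0 hP.2.1], by simp [hρP 1 hP.2.2.1], ?_, ?_⟩
  · rintro _ ⟨t, rfl⟩
    exact mem_range_self _
  · intro a b c hab hbc h
    simp only [ContinuousMap.coe_mk] at h ⊢
    rcases (hρmono (hab.trans hbc)).eq_or_lt with h1 | h1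
    · rw [le_antisymm ((hρmono hbc).trans h1.ge) (hρmono hab)]
    · have hd := hmin _ (hρ a).1.1 _ (hρ c).1.1 h1 h
      rcases (hρmono hab).eq_or_lt with h2 | h2
      · rw [h2]
      rcases (hρmono hbc).eq_or_lt with h3 | h3
      · rw [h3, h]
      · exact absurd (hρ b).1.1 (disjoint_left.1 hd ⟨h2, h3⟩)

end

/-- A path with interval fibres can be reparametrised canonically. -/
lemma exists_canon_of_interval_fibres (F : C(𝕀, ℝ × ℝ)) (hne : F 0 ≠ F 1)
    (hF : ∀ a b c, a ≤ b → b ≤ c → F a = F c → F b = F a) :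
    ∃ g ∈ canonArcs, g 0 = F 0 ∧ g 1 = F 1 ∧ range g = range F := by
  set M : 𝕀 → ℝ := fun t => wt (F '' Iic t) with hM
  have himg : ∀ t : 𝕀, (F '' Iic t).Nonempty := fun t => ⟨_, t, mem_Iic.2 le_rfl, rfl⟩
  have hMmono : Monotone M := fun s t hst => wt_mono (himg s) (image_mono (Iic_subset_Iic.2 hst))
  have hMeq : ∀ s t, s ≤ t → (M s = M t ↔ F s = F t) := by
    intro s t hst
    constructor
    · intro h
      by_contra hst'
      have hnot : F t ∉ F '' Iic s := by
        rintro ⟨s', hs', h'⟩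
        have := hF s' s t hs' hst h'
        exact hst' (this.trans h')
      exact h.not_lt (wt_lt_wt (himg s) (isClosed_Iic.isCompact.image F.continuous).isClosed
        (image_mono (Iic_subset_Iic.2 hst)) ⟨t, mem_Iic.2 le_rfl, rfl⟩ hnot)
    · intro h
      simp only [hM]
      congr 1
      refine Subset.antisymm (image_mono (Iic_subset_Iic.2 hst)) ?_
      rintro _ ⟨x, hx, rfl⟩
      rcases le_total x s with hxs | hxs
      · exact ⟨x, hxs, rfl⟩
      · exact ⟨s, mem_Iic.2 le_rfl, (hF s x t hxs hx h).symm⟩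
  have hM0 : M 0 = wt {F 0} := by
    have : Iic (0 : 𝕀) = {0} := Iic_bot
    simp [hM, this]
  have hM1 : M 1 = wt (range F) := by
    have : Iic (1 : 𝕀) = univ := Iic_top
    simp [hM, this]
  have hpos : 0 < M 1 - M 0 := sub_pos.2 (lt_of_le_of_ne (hMmono bot_le) fun h =>
    hne ((hMeq 0 1 bot_le).1 h))
  have hMc : Continuous M := by
    rw [Metric.continuous_iff]
    intro b ε hε
    obtain ⟨δ, hδ, h⟩ := Metric.uniformContinuous_iff.1
      (CompactSpace.uniformContinuous_of_continuous F.continuous) (ε / 4) (by positivity)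
    have key : ∀ s t : 𝕀, s ≤ t → dist s t < δ → dist (M s) (M t) < ε := by
      intro s t hst hd
      have h1 : F '' Iic s = (fun x => F (min x s)) '' Iic t := by
        ext z
        constructor
        · rintro ⟨x, hx, rfl⟩
          exact ⟨x, (show x ≤ s from hx).trans hst, by simp [min_eq_left (show x ≤ s from hx)]⟩
        · rintro ⟨x, hx, rfl⟩
          exact ⟨min x s, mem_Iic.2 (min_le_right _ _), rfl⟩
      have h2 := wt_abs_image_le (s := Iic t) (f := fun x => F (min x s)) (g := F) (ε := ε / 4)
        (by positivity) (fun x hx => by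
          refine (h (lt_of_le_of_lt ?_ hd)).le
          have hx' : (x : ℝ) ≤ t := hx
          have hst' : (s : ℝ) ≤ t := hst
          rcases le_total x s with hxs | hxs
          · simp [min_eq_left hxs]
          · rw [min_eq_right hxs, Subtype.dist_eq, Subtype.dist_eq, Real.dist_eq, Real.dist_eq]
            have hxs' : (s : ℝ) ≤ x := hxs
            rw [abs_of_nonpos (by linarith), abs_of_nonpos (by linarith)]
            linarith)
      rw [Real.dist_eq]
      simp only [hM, h1]
      linarith
    refine ⟨δ, hδ, fun a ha => ?_⟩
    rcases le_total a b with hab | hab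
    · exact key a b hab ha
    · rw [dist_comm] at ha ⊢
      exact key b a hab ha
  have hN : ∀ t, (M t - M 0) / (M 1 - M 0) ∈ Icc (0:ℝ) 1 := fun t =>
    ⟨div_nonneg (sub_nonneg.2 (hMmono bot_le)) hpos.le, (div_le_one hpos).2
      (sub_le_sub_right (hMmono le_top) _)⟩
  let N : 𝕀 → 𝕀 := fun t => ⟨(M t - M 0) / (M 1 - M 0), hN t⟩
  have hNc : Continuous N := by fun_prop
  have hN0 : N 0 = 0 := Subtype.ext (by simp [N])
  have hN1 : N 1 = 1 := Subtype.ext (by simp [N, div_self hpos.ne'])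
  have hNmono : Monotone N := fun s t hst => by
    change (M s - M 0) / (M 1 - M 0) ≤ (M t - M 0) / (M 1 - M 0)
    exact div_le_div_of_nonneg_right (sub_le_sub_right (hMmono hst) _) hpos.le
  have hNeq : ∀ s t, N s = N t ↔ F s = F t := by
    have h1 : ∀ s t, N s = N t ↔ M s = M t := by
      intro s t
      rw [Subtype.ext_iff]
      simp only [N]
      rw [div_left_inj' hpos.ne', sub_left_inj]
    intro s t
    rw [h1]
    rcases le_total s t with h | h
    · exact hMeq s t h
    · rw [eq_comm, hMeq t s h, eq_comm]
  have hNsurj : Function.Surjective N := by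
    intro y
    have := intermediate_value_univ 0 1 hNc
    rw [hN0, hN1] at this
    exact this ⟨bot_le, le_top⟩
  have hq : IsQuotientMap N := hNc.isClosedMap.isQuotientMap hNc hNsurj
  let NN : C(𝕀, 𝕀) := ⟨N, hNc⟩
  have hq' : IsQuotientMap NN := hq
  have hfac : Function.FactorsThrough F NN := fun s t hst => (hNeq s t).1 hst
  let g := hq'.lift F hfac
  have hg : ∀ t, g (N t) = F t := fun t => congrArg (fun k => k t) (hq'.lift_comp F hfac)
  have hrange : range g = range F := by
    ext z
    constructor
    · rintro ⟨y, rfl⟩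
      obtain ⟨t, rfl⟩ := hNsurj y
      exact ⟨t, (hg t).symm⟩
    · rintro ⟨t, rfl⟩
      exact ⟨N t, hg t⟩
  have hg0 : g 0 = F 0 := (congrArg g hN0).symm.trans (hg 0)
  have hg1 : g 1 = F 1 := (congrArg g hN1).symm.trans (hg 1)
  refine ⟨g, ⟨?_, ?_⟩, hg0, hg1, hrange⟩
  · intro x y hxy
    obtain ⟨s, rfl⟩ := hNsurj x
    obtain ⟨t, rfl⟩ := hNsurj y
    rw [hg, hg] at hxy
    exact (hNeq s t).2 hxy
  · intro y
    obtain ⟨t, rfl⟩ := hNsurj y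
    have h1 : g '' Iic (N t) = F '' Iic t := by
      ext z
      constructor
      · rintro ⟨y, hy, rfl⟩
        obtain ⟨s, rfl⟩ := hNsurj y
        rw [hg]
        rcases le_total s t with h | h
        · exact ⟨s, h, rfl⟩
        · exact ⟨t, mem_Iic.2 le_rfl, ((hNeq s t).1 (le_antisymm hy (hNmono h))).symm⟩
      · rintro ⟨s, hs, rfl⟩
        exact ⟨N s, hNmono hs, hg s⟩
    rw [h1, hrange, hg0, ← hM0, ← hM1]
    change M t - M 0 = (M t - M 0) / (M 1 - M 0) * (M 1 - M 0)
    rw [div_mul_cancel₀ _ hpos.ne']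

/-- Every path between distinct points contains a canonical arc. -/
lemma JoinedIn.exists_canonArc {A : Set (ℝ × ℝ)} {x y : ℝ × ℝ} (h : JoinedIn A x y) (hne : x ≠ y) :
    ∃ g ∈ canonArcs, g 0 = x ∧ g 1 = y ∧ range g ⊆ A := by
  obtain ⟨γ, hγ⟩ := h
  obtain ⟨F, h0, h1, hr, hF⟩ := exists_interval_fibres γ.toContinuousMap
  simp only [Path.coe_toContinuousMap, Path.source, Path.target] at h0 h1 hr
  obtain ⟨g, hg, g0, g1, hgr⟩ := exists_canon_of_interval_fibres F (by rwa [h0, h1]) hF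
  exact ⟨g, hg, by rw [g0, h0], by rw [g1, h1], hgr ▸ hr.trans (range_subset_iff.2 hγ)⟩

/-- Every arc has a canonical parametrisation. -/
lemma exists_canonArc_of_injective (f : C(𝕀, ℝ × ℝ)) (hf : Function.Injective f) :
    ∃ g ∈ canonArcs, g 0 = f 0 ∧ g 1 = f 1 ∧ range g = range f :=
  exists_canon_of_interval_fibres f (fun h => zero_ne_one (hf h)) fun a b c hab hbc h => by
    rw [le_antisymm (hbc.trans (hf h).ge) hab]

/-- The open half plane on the side `σ` of the vertical line `x = c`. -/
def side (c σ : ℝ) : Set (ℝ × ℝ) := {z | 0 < σ * (z.1 - c)}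

lemma mem_side {c σ : ℝ} {z : ℝ × ℝ} : z ∈ side c σ ↔ 0 < σ * (z.1 - c) := Iff.rfl

lemma isOpen_side (c σ : ℝ) : IsOpen (side c σ) :=
  isOpen_lt continuous_const (by fun_prop)

lemma fst_ne_of_mem_side {c σ : ℝ} {z : ℝ × ℝ} (h : z ∈ side c σ) : z.1 ≠ c := by
  rintro rfl
  simp [mem_side] at h

/-- An arc crossing the vertical strip between the lines `x = c` and `x = d`. -/
structure IsCross (c d σ : ℝ) (f : C(𝕀, ℝ × ℝ)) : Prop where
  inj : Function.Injective f
  left : (f 0).1 = c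
  right : (f 1).1 = d
  mem_left : ∀ t, t ≠ 0 → t ≠ 1 → f t ∈ side c σ
  mem_right : ∀ t, t ≠ 0 → t ≠ 1 → f t ∈ side d (-σ)

section
variable {H : Set (ℝ × ℝ)} {f g : C(𝕀, ℝ × ℝ)} {c d σ : ℝ}

lemma joinedIn_arc {F : Set (ℝ × ℝ)} {s t : 𝕀} (h : ∀ x ∈ uIcc s t, f x ∈ F) :
    JoinedIn F (f s) (f t) := by
  have := joinedIn_of_continuousOn_uIcc (F := F) (a := s) (b := t)
    (f := fun x : ℝ => f (projIcc 0 1 zero_le_one x)) (by fun_prop) (fun x hx => h _ ?_)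
  · simpa using this
  · have hx' : x ∈ Icc (0:ℝ) 1 := by
      have := uIcc_subset_Icc s.2 t.2 hx
      exact this
    rw [projIcc_of_mem _ hx']
    rcases le_total s t with h' | h'
    · rw [uIcc_of_le h']; rw [uIcc_of_le (show (s:ℝ) ≤ t from h')] at hx; exact hx
    · rw [uIcc_of_ge h']; rw [uIcc_of_ge (show (t:ℝ) ≤ s from h')] at hx; exact hx

lemma JoinedIn.exists_first_mem {X : Type*} [TopologicalSpace X] {F C : Set X} {x y : X}
    (h : JoinedIn F x y) (hC : IsClosed C) (hx : x ∉ C) (hy : y ∈ C) :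
    ∃ δ : ℝ → X, Continuous δ ∧ (∀ t, δ t ∈ F) ∧ δ 0 = x ∧ δ 1 ∈ C ∧ ∀ t ∈ Ico (0:ℝ) 1,
        δ t ∉ C := by
  obtain ⟨δ, hδ, hF, rfl, rfl⟩ := h.exists_curve
  obtain ⟨s, ⟨hs, hsC⟩, hmin⟩ := (isCompact_Icc.inter_right (hC.preimage hδ)).exists_isLeast
    (⟨1, right_mem_Icc.2 zero_le_one, hy⟩ : (Icc (0:ℝ) 1 ∩ δ ⁻¹' C).Nonempty)
  have hs0 : 0 < s := lt_of_le_of_ne hs.1 (by rintro rfl; exact hx hsC)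
  refine ⟨fun t => δ (s * t), by fun_prop, fun t => hF _, by simp, by simpa using hsC, ?_⟩
  intro t ht hC'
  have := hmin ⟨⟨by have := ht.1; positivity, by nlinarith [ht.2, hs.2]⟩, hC'⟩
  nlinarith [ht.2]

/-- In a non-tripled component, an arc can only be left through its end points. -/
lemma mem_range_of_joinedIn (hf : Function.Injective f) (fH : ∀ t, f t ∈ H) {z w : ℝ × ℝ}
    (h : JoinedIn (H \ {f 0, f 1}) z w) (hw : w ∈ range f) (hnt : ¬ Tripled H z) : z ∈ range f := by
  by_contra hz
  obtain ⟨δ, hδ, hF, rfl, ⟨t₀, ht₀⟩, hmin⟩ :=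
    h.exists_first_mem (isCompact_range f.continuous).isClosed hz hw
  have h1 := (hF 1).2
  simp only [← ht₀, mem_insert_iff, mem_singleton_iff, not_or] at h1
  have h0 : t₀ ≠ 0 := fun h => h1.1 (by rw [h])
  have h1' : t₀ ≠ 1 := fun h => h1.2 (by rw [h])
  refine hnt ((tripled_of_landing (γ := fun x : ℝ => f (projIcc 0 1 zero_le_one x)) (δ := δ)
    (t₀ := t₀) (by fun_prop) hδ.continuousOn ?_ (fun t _ => fH _) (fun t _ => (hF t).1)
    ⟨unitInterval.pos_iff_ne_zero.2 h0, unitInterval.lt_one_iff_ne_one.2 h1'⟩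
    (by simp [ht₀]) ?_).congr ?_)
  · intro x hx y hy hxy
    have := hf hxy
    rw [projIcc_of_mem _ hx, projIcc_of_mem _ hy] at this
    exact congrArg Subtype.val this
  · rintro s hs ⟨x, -, hx⟩
    exact hmin s hs ⟨_, hx⟩
  · simp only [projIcc_val, ht₀]
    exact (joinedIn_of_continuousOn_uIcc hδ.continuousOn fun t _ => (hF t).1)

lemma range_subset_of_interior {C : Set (ℝ × ℝ)} (hC : IsClosed C)
    (h : ∀ t, t ≠ 0 → t ≠ 1 → f t ∈ C) : range f ⊆ C := by
  have hd : closure (Ioo (0:𝕀) 1) ⊆ f ⁻¹' C :=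
    closure_minimal (fun t ht => h t ht.1.ne' ht.2.ne) (hC.preimage f.continuous)
  rw [closure_Ioo zero_ne_one] at hd
  rintro _ ⟨t, rfl⟩
  exact hd t.2

lemma IsCross.symm (h : IsCross c d σ f) :
    IsCross d c (-σ) (f.comp ⟨unitInterval.symm, unitInterval.continuous_symm⟩) where
  inj := h.inj.comp unitInterval.symm_bijective.injective
  left := by simpa using h.right
  right := by simpa using h.left
  mem_left t h0 h1 := h.mem_right _ (by simpa using h1) (by simpa using h0)
  mem_right t h0 h1 := by
    rw [neg_neg]
    exact h.mem_left _ (by simpa using h1) (by simpa using h0)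

lemma range_comp_symm (f : C(𝕀, ℝ × ℝ)) :
    range (f.comp ⟨unitInterval.symm, unitInterval.continuous_symm⟩) = range f :=
  unitInterval.symm_bijective.surjective.range_comp f

lemma IsCross.eq_zero (h : IsCross c d σ f) (hcd : c ≠ d) {t : 𝕀} (ht : (f t).1 = c) : t = 0 := by
  by_contra h0
  by_cases h1 : t = 1
  · rw [h1, h.right] at ht
    exact hcd ht.symm
  · exact fst_ne_of_mem_side (h.mem_left t h0 h1) ht

lemma IsCross.eq_one (h : IsCross c d σ f) (hcd : c ≠ d) {t : 𝕀} (ht : (f t).1 = d) : t = 1 := by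
  by_contra h0
  by_cases h1 : t = 0
  · rw [h1, h.left] at ht
    exact hcd ht
  · exact fst_ne_of_mem_side (h.mem_right t h1 h0) ht

lemma joinedIn_of_mem_arc (fH : ∀ t, f t ∈ H) (s t : 𝕀) : JoinedIn H (f s) (f t) :=
  joinedIn_arc fun _ _ => fH _

lemma ne_of_mem_uIcc {s t x : 𝕀} (hs : s ≠ 0 ∧ s ≠ 1) (ht : t ≠ 0 ∧ t ≠ 1) (hx : x ∈ uIcc s t) :
    x ≠ 0 ∧ x ≠ 1 := by
  have h0 : ∀ u : 𝕀, u ≠ 0 ↔ 0 < u := fun u => unitInterval.pos_iff_ne_zero.symm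
  have h1 : ∀ u : 𝕀, u ≠ 1 ↔ u < 1 := fun u => unitInterval.lt_one_iff_ne_one.symm
  rw [h0, h1] at *
  exact ⟨(lt_min hs.1 ht.1).trans_le hx.1, hx.2.trans_lt (max_lt hs.2 ht.2)⟩

lemma IsCross.range_subset (hf : IsCross c d σ f) (hg : IsCross c d σ g) (fH : ∀ t, f t ∈ H)
    (gH : ∀ t, g t ∈ H) (hnt : ¬ Tripled H (f 0)) {s t : 𝕀} (hs : s ≠ 0 ∧ s ≠ 1)
    (hst : f s = g t) : range f ⊆ range g := by
  refine range_subset_of_interior (isCompact_range g.continuous).isClosed fun x h0 h1 => ?_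
  refine mem_range_of_joinedIn hg.inj gH (w := f s) (joinedIn_arc fun y hy => ⟨fH y, ?_⟩)
    ⟨t, hst.symm⟩ fun h => hnt (h.congr (joinedIn_of_mem_arc fH x 0))
  have hy' := ne_of_mem_uIcc ⟨h0, h1⟩ hs hy
  rintro (h | h)
  · exact fst_ne_of_mem_side (hf.mem_left y hy'.1 hy'.2) (by rw [h, hg.left])
  · exact fst_ne_of_mem_side (hf.mem_right y hy'.1 hy'.2) (by rw [mem_singleton_iff.1 h, hg.right])

/-- Two crossing arcs of a non-tripled component with a common interior point coincide. -/
lemma IsCross.range_eq (hf : IsCross c d σ f) (hg : IsCross c d σ g) (fH : ∀ t, f t ∈ H)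
    (gH : ∀ t, g t ∈ H) (hnt : ¬ Tripled H (f 0)) {s t : 𝕀} (hs : s ≠ 0 ∧ s ≠ 1)
    (hst : f s = g t) : range f = range g := by
  have ht : t ≠ 0 ∧ t ≠ 1 := by
    constructor
    · rintro rfl
      exact fst_ne_of_mem_side (hf.mem_left s hs.1 hs.2) (by rw [hst, hg.left])
    · rintro rfl
      exact fst_ne_of_mem_side (hf.mem_right s hs.1 hs.2) (by rw [hst, hg.right])
  refine (hf.range_subset hg fH gH hnt hs hst).antisymm (hg.range_subset hf gH fH ?_ ht hst.symm)
  intro h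
  exact hnt ((h.congr (joinedIn_of_mem_arc gH 0 t)).congr (hst ▸ joinedIn_of_mem_arc fH s 0))

end

section
variable {H : Set (ℝ × ℝ)} {f g h : C(𝕀, ℝ × ℝ)} {c d σ : ℝ}

lemma IsCross.exists_last (hf : IsCross c d σ f) {t : ℝ} (h0 : 0 < σ * (t - c))
    (h1 : σ * (t - c) < σ * (d - c)) :
    ∃ s : 𝕀, (s ≠ 0 ∧ s ≠ 1) ∧ (f s).1 = t ∧ ∀ x, s ≤ x → 0 ≤ σ * ((f x).1 - t) := by
  have hc : Continuous fun x : 𝕀 => σ * ((f x).1 - t) := by fun_prop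
  obtain ⟨s, hs, hmax⟩ := (isClosed_le hc continuous_const).isCompact.exists_isGreatest
    (⟨0, by simp only [mem_ofPred_eq, hf.left]; linarith⟩ :
      {x : 𝕀 | σ * ((f x).1 - t) ≤ 0}.Nonempty)
  have hs : σ * ((f s).1 - t) ≤ 0 := hs
  have hs1 : s ≠ 1 := by
    rintro rfl
    rw [hf.right] at hs
    linarith
  have hge : Icc s 1 ⊆ {x : 𝕀 | 0 ≤ σ * ((f x).1 - t)} := by
    rw [← closure_Ioc hs1]
    refine closure_minimal (fun x hx => ?_) (isClosed_le continuous_const hc)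
    by_contra hx'
    exact hx.1.not_ge (hmax (show σ * ((f x).1 - t) ≤ 0 from (not_le.1 hx').le))
  have hs0 : 0 ≤ σ * ((f s).1 - t) := hge ⟨le_rfl, s.2.2⟩
  have hσ : σ ≠ 0 := by rintro rfl; simp at h0
  have heq : (f s).1 = t := by
    have := (mul_eq_zero.1 (le_antisymm hs hs0)).resolve_left hσ
    linarith
  refine ⟨s, ⟨?_, hs1⟩, heq, fun x hx => hge ⟨hx, x.2.2⟩⟩
  rintro rfl
  rw [hf.left] at heq
  simp [heq] at h0

lemma JoinedIn.exists_margin {x y : ℝ × ℝ} (h : JoinedIn (H ∩ side c σ) x y) :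
    ∃ ε > 0, JoinedIn (H ∩ {z | ε ≤ σ * (z.1 - c)}) x y := by
  obtain ⟨δ, hδ, hF, rfl, rfl⟩ := h.exists_curve
  obtain ⟨s, -, hs⟩ := isCompact_Icc.exists_isMinOn (nonempty_Icc.2 (zero_le_one (α := ℝ)))
    (f := fun x => σ * ((δ x).1 - c)) (by fun_prop)
  refine ⟨σ * ((δ s).1 - c), (hF s).2, joinedIn_of_continuousOn_uIcc hδ.continuousOn ?_⟩
  intro t ht
  rw [uIcc_of_le zero_le_one] at ht
  exact ⟨(hF t).1, hs ht⟩

lemma exists_rat_level (hσ : σ ≠ 0) (c : ℝ) {m : ℝ} (hm : 0 < m) :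
    ∃ t : ℚ, 0 < σ * (t - c) ∧ σ * (t - c) < m := by
  have h1 : IsOpen {x : ℝ | 0 < σ * (x - c)} := isOpen_lt continuous_const (by fun_prop)
  have h2 : IsOpen {x : ℝ | σ * (x - c) < m} := isOpen_lt (by fun_prop) continuous_const
  have h3 : σ * (c + m / (2 * σ) - c) = m / 2 := by field_simp; ring
  obtain ⟨t, ht⟩ := (Rat.denseRange_cast (𝕜 := ℝ)).exists_mem_open (h1.inter h2)
    ⟨c + m / (2 * σ), (half_pos hm).trans_eq h3.symm, h3.trans_lt (half_lt_self hm)⟩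
  exact ⟨t, ht⟩

/-- In a non-tripled component at most two crossing arcs end in the same component of the
open half plane. -/
lemma range_eq_of_joinedIn_side {b : Bool} (hcd : 0 < boolSign b * (d - c))
    (hf : IsCross c d (boolSign b) f) (hg : IsCross c d (boolSign b) g)
    (hh : IsCross c d (boolSign b) h)
    (fH : ∀ t, f t ∈ H) (gH : ∀ t, g t ∈ H) (hH : ∀ t, h t ∈ H)
    (hfg : JoinedIn (H ∩ side c (boolSign b)) (f 1) (g 1))
    (hfh : JoinedIn (H ∩ side c (boolSign b)) (f 1) (h 1)) (hnt : ¬ Tripled H (f 0)) :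
    range f = range g ∨ range f = range h ∨ range g = range h := by
  obtain ⟨ε, hε, j1⟩ := hfg.exists_margin
  obtain ⟨ε', hε', j2⟩ := hfh.exists_margin
  obtain ⟨t, ht0, ht⟩ := exists_rat_level (boolSign_ne_zero b) c
    (lt_min (lt_min hε hε') hcd)
  rw [lt_min_iff, lt_min_iff] at ht
  have key : ∀ {k : C(𝕀, ℝ × ℝ)}, IsCross c d (boolSign b) k → (∀ t, k t ∈ H) →
      ∃ s : 𝕀, (s ≠ 0 ∧ s ≠ 1) ∧ (k s).1 = t ∧
        JoinedIn (H ∩ chartDom (.inl (t, b))) (k s) (k 1) := by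
    intro k hk kH
    obtain ⟨s, hs, h1, h2⟩ := hk.exists_last ht0 ht.2
    refine ⟨s, hs, h1, joinedIn_arc fun x hx => ⟨kH x, h2 x ?_⟩⟩
    rw [uIcc_of_le (show s ≤ 1 from s.2.2)] at hx
    exact hx.1
  obtain ⟨s, hs, f1, f2⟩ := key hf fH
  obtain ⟨s', hs', g1, g2⟩ := key hg gH
  obtain ⟨s'', hs'', h1, h2⟩ := key hh hH
  have j1' : JoinedIn (H ∩ chartDom (.inl (t, b))) (f 1) (g 1) :=
    j1.mono (inter_subset_inter_right _ fun z hz => by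
      have hz : ε ≤ boolSign b * (z.1 - c) := hz
      show 0 ≤ boolSign b * (z.1 - t)
      linarith)
  have j2' : JoinedIn (H ∩ chartDom (.inl (t, b))) (f 1) (h 1) :=
    j2.mono (inter_subset_inter_right _ fun z hz => by
      have hz : ε' ≤ boolSign b * (z.1 - c) := hz
      show 0 ≤ boolSign b * (z.1 - t)
      linarith)
  have hre : ∀ {z : ℝ × ℝ}, z.1 = t → (chartMap (.inl (t, b)) z).re = 0 := by
    intro z hz
    simp [chartMap, halfMap, hz]
  by_contra! hne
  refine hnt ⟨.inl (t, b), f s, g s', h s'', joinedIn_of_mem_arc fH 0 s,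
    f2.trans (j1'.trans g2.symm), f2.trans (j2'.trans h2.symm), hre f1, hre g1, hre h1, ?_, ?_, ?_⟩
  · intro he
    exact hne.1 (hf.range_eq hg fH gH hnt hs he)
  · intro he
    exact hne.2.1 (hf.range_eq hh fH hH hnt hs he)
  · intro he
    refine hne.2.2 (hg.range_eq hh gH hH (fun h' => hnt (h'.congr ?_)) hs' he)
    exact ((joinedIn_of_mem_arc gH 0 1).trans (hfg.mono inter_subset_left).symm).trans
      (joinedIn_of_mem_arc fH 1 0)

end

section
variable {H : Set (ℝ × ℝ)} {f g h : C(𝕀, ℝ × ℝ)} {c d σ : ℝ}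

/-- The reversal of a path. -/
def revPath (f : C(𝕀, ℝ × ℝ)) : C(𝕀, ℝ × ℝ) :=
  f.comp ⟨unitInterval.symm, unitInterval.continuous_symm⟩

@[simp] lemma revPath_zero (f : C(𝕀, ℝ × ℝ)) : revPath f 0 = f 1 := by simp [revPath]

@[simp] lemma revPath_one (f : C(𝕀, ℝ × ℝ)) : revPath f 1 = f 0 := by simp [revPath]

lemma revPath_apply (f : C(𝕀, ℝ × ℝ)) (t : 𝕀) : revPath f t = f (unitInterval.symm t) := rfl

@[simp] lemma range_revPath (f : C(𝕀, ℝ × ℝ)) : range (revPath f) = range f := range_comp_symm f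

lemma revPath_injective (hf : Function.Injective f) : Function.Injective (revPath f) :=
  hf.comp unitInterval.symm_bijective.injective

lemma mem_side_of_range_subset {t : 𝕀} (hh : Function.Injective h)
    (hr : range h ⊆ side c σ ∪ {h 0, h 1}) (h0 : t ≠ 0) (h1 : t ≠ 1) : h t ∈ side c σ := by
  rcases hr (mem_range_self t) with hs | hs | hs
  · exact hs
  · exact absurd (hh hs) h0
  · exact absurd (hh hs) h1

lemma IsCross.mem_side_or (hf : IsCross c d σ f) (hcd : 0 < σ * (d - c)) (t : 𝕀) :
    f t ∈ side c σ ∨ t = 0 := by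
  by_cases h0 : t = 0
  · exact .inr h0
  by_cases h1 : t = 1
  · left
    rw [h1, mem_side, hf.right]
    exact hcd
  · exact .inl (hf.mem_left t h0 h1)

lemma range_subset_of_starts {Z : Set (ℝ × ℝ)} (hf : Function.Injective f)
    (hh : Function.Injective h) (fH : ∀ t, f t ∈ H) (hH : ∀ t, h t ∈ H) (h0 : h 0 = f 0)
    (h1 : h 1 ∉ range f) (hr : range h ⊆ range f ∪ Z) (hZ : IsClosed Z) (hZ0 : f 0 ∉ Z)
    (hnt : ¬ Tripled H (f 0)) : range f ⊆ range h := by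
  rintro _ ⟨s, rfl⟩
  by_contra hs
  have hs0 : s ≠ 0 := by
    rintro rfl
    exact hs ⟨0, h0⟩
  have hK : IsClosed (Z ∪ f '' Icc s 1) :=
    hZ.union (isCompact_Icc.image f.continuous).isClosed
  have h0K : h 0 ∉ Z ∪ f '' Icc s 1 := by
    rw [h0]
    rintro (h | ⟨x, hx, hxe⟩)
    · exact hZ0 h
    · rw [hf hxe] at hx
      exact hs0 (le_antisymm hx.1 s.2.1)
  have hev : ∀ᶠ t in 𝓝[>] (0 : 𝕀), h t ∉ Z ∪ f '' Icc s 1 :=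
    (h.continuous.continuousAt.eventually (hK.isOpen_compl.mem_nhds h0K)).filter_mono
      nhdsWithin_le_nhds
  have : (𝓝[>] (0 : 𝕀)).NeBot := nhdsGT_neBot_of_exists_gt ⟨1, zero_lt_one⟩
  obtain ⟨t, ht, ht0⟩ := (hev.and self_mem_nhdsWithin).exists
  rw [mem_union, not_or] at ht
  obtain ⟨s₁, hs₁⟩ := (hr (mem_range_self t)).resolve_right ht.1
  have hlt : s₁ < s := by
    by_contra hle
    exact ht.2 ⟨s₁, ⟨not_lt.1 hle, s₁.2.2⟩, hs₁⟩
  have hs₁0 : 0 < s₁ := by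
    rw [unitInterval.pos_iff_ne_zero]
    rintro rfl
    rw [← h0] at hs₁
    exact ht0.ne (hh hs₁)
  refine hs (mem_range_of_joinedIn hh hH (w := f s₁) (joinedIn_arc fun y hy => ⟨fH y, ?_⟩)
    ⟨t, hs₁.symm⟩ fun h' => hnt (h'.congr (joinedIn_of_mem_arc fH s 0)))
  rw [uIcc_of_ge hlt.le] at hy
  rintro (hy' | hy')
  · rw [h0] at hy'
    exact (hs₁0.trans_le hy.1).ne' (hf hy')
  · exact h1 ⟨y, hy'⟩

/-- Two crossing arcs ending in the same component of the open half plane are the ends of an arc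
in that half plane. -/
lemma exists_arc_of_joinedIn_side (hcd : 0 < σ * (d - c))
    (hf : IsCross c d σ f) (hg : IsCross c d σ g) (fH : ∀ t, f t ∈ H) (gH : ∀ t, g t ∈ H)
    (hfg : JoinedIn (H ∩ side c σ) (f 1) (g 1)) (hne : f 0 ≠ g 0) (hnt : ¬ Tripled H (f 0)) :
    ∃ h : C(𝕀, ℝ × ℝ), Function.Injective h ∧ (∀ t, h t ∈ H) ∧ h 0 = f 0 ∧ h 1 = g 0 ∧
      (∀ t, t ≠ 0 → t ≠ 1 → h t ∈ side c σ) ∧ range f ⊆ range h ∧ range g ⊆ range h := by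
  have hne' : c ≠ d := by rintro rfl; simp at hcd
  have hj : JoinedIn H (f 0) (g 0) := ((joinedIn_of_mem_arc fH 0 1).trans
    (hfg.mono inter_subset_left)).trans (joinedIn_of_mem_arc gH 1 0)
  obtain ⟨δ, hδ, hF, e0, e1⟩ := hfg.exists_curve
  set Z := δ '' Icc 0 1 with hZdef
  have hZ : IsClosed Z := (isCompact_Icc.image hδ).isClosed
  have hZs : Z ⊆ H ∩ side c σ := by
    rintro _ ⟨t, -, rfl⟩
    exact hF t
  have jZ : JoinedIn Z (f 1) (g 1) := by
    rw [← e0, ← e1]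
    refine joinedIn_of_continuousOn_uIcc hδ.continuousOn fun t ht => ⟨t, ?_, rfl⟩
    rwa [uIcc_of_le zero_le_one] at ht
  have jA : JoinedIn (range f ∪ (Z ∪ range g)) (f 0) (g 0) :=
    ((joinedIn_of_mem_arc (fun t => .inl (mem_range_self t)) 0 1).trans
      (jZ.mono (subset_union_left.trans subset_union_right))).trans
      (joinedIn_of_mem_arc (fun t => .inr (.inr (mem_range_self t))) 1 0)
  obtain ⟨h, hh, h0, h1, hr⟩ := jA.exists_canonArc hne
  have hH : ∀ t, h t ∈ H := by
    intro t
    rcases hr (mem_range_self t) with ⟨x, hx⟩ | hx | ⟨x, hx⟩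
    · exact hx ▸ fH x
    · exact (hZs hx).1
    · exact hx ▸ gH x
  have fg : f 0 ∉ range g := by
    rintro ⟨x, hx⟩
    have : x = 0 := hg.eq_zero hne' (by rw [hx, hf.left])
    rw [this] at hx
    exact hne hx.symm
  have gf : g 0 ∉ range f := by
    rintro ⟨x, hx⟩
    have : x = 0 := hf.eq_zero hne' (by rw [hx, hg.left])
    rw [this] at hx
    exact hne hx
  have hZc : ∀ {z : ℝ × ℝ}, z.1 = c → z ∉ Z := fun hz hzZ => fst_ne_of_mem_side (hZs hzZ).2 hz
  refine ⟨h, hh.1, hH, h0, h1, fun t => mem_side_of_range_subset hh.1 ?_, ?_, ?_⟩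
  · refine hr.trans ?_
    rintro z (⟨x, rfl⟩ | hx | ⟨x, rfl⟩)
    · rcases hf.mem_side_or hcd x with hx | rfl
      · exact .inl hx
      · exact .inr (.inl h0.symm)
    · exact .inl (hZs hx).2
    · rcases hg.mem_side_or hcd x with hx | rfl
      · exact .inl hx
      · exact .inr (.inr h1.symm)
  · refine range_subset_of_starts hf.inj hh.1 fH hH h0 (h1 ▸ gf) hr
      (hZ.union (isCompact_range g.continuous).isClosed) ?_ hnt
    rintro (h | h)
    · exact hZc hf.left h
    · exact fg h
  · rw [← range_revPath h]
    refine range_subset_of_starts hg.inj (revPath_injective hh.1) gH (fun t => hH _)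
      (by simpa using h1) (by simpa [h0] using fg)
      (Z := Z ∪ range f) ?_ (hZ.union (isCompact_range f.continuous).isClosed) ?_
      fun h' => hnt (h'.congr hj.symm)
    · rw [range_revPath]
      refine hr.trans ?_
      rintro z (hz | hz | hz)
      exacts [.inr (.inr hz), .inr (.inl hz), .inl hz]
    · rintro (h | h)
      · exact hZc hg.left h
      · exact gf h

end

section
variable {H : Set (ℝ × ℝ)} {f g h : C(𝕀, ℝ × ℝ)} {c d σ : ℝ}

lemma not_mem_side_iff {z : ℝ × ℝ} : z ∉ side c σ ↔ σ * (z.1 - c) ≤ 0 := by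
  rw [mem_side, not_lt]

lemma JoinedIn.exists_to_line (hσ : σ ≠ 0) {G : Set (ℝ × ℝ)} {z x : ℝ × ℝ} (h : JoinedIn G z x)
    (hz : z ∈ side c σ) (hx : x ∉ side c σ) :
    ∃ u : ℝ × ℝ, u.1 = c ∧ JoinedIn G z u ∧ JoinedIn ((G ∩ side c σ) ∪ {u}) z u := by
  obtain ⟨δ, hδ, hF, rfl, h1, hmin⟩ := h.exists_first_mem (C := (side c σ)ᶜ)
    (isOpen_side c σ).isClosed_compl (fun h' => h' hz) hx
  have hge : 0 ≤ σ * ((δ 1).1 - c) := by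
    have hcl : Icc (0:ℝ) 1 ⊆ {t | 0 ≤ σ * ((δ t).1 - c)} := by
      rw [← closure_Ico zero_ne_one]
      exact closure_minimal (fun t ht => (show 0 < σ * ((δ t).1 - c) from not_not.1 (hmin t ht)).le)
        (isClosed_le continuous_const (by fun_prop))
    exact hcl (right_mem_Icc.2 zero_le_one)
  have heq : (δ 1).1 = c := by
    have := (mul_eq_zero.1 (le_antisymm (not_mem_side_iff.1 h1) hge)).resolve_left hσ
    linarith
  refine ⟨δ 1, heq, joinedIn_of_continuousOn_uIcc hδ.continuousOn fun t _ => hF t,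
    joinedIn_of_continuousOn_uIcc hδ.continuousOn fun t ht => ?_⟩
  rw [uIcc_of_le zero_le_one] at ht
  rcases eq_or_lt_of_le ht.2 with rfl | hlt
  · exact .inr rfl
  · exact .inl ⟨hF t, not_not.1 (hmin t ⟨ht.1, hlt⟩)⟩

lemma exists_isCross {p q : ℝ} (hpq : p < q) {z x y : ℝ × ℝ}
    (hx : JoinedIn (H ∩ side q (-1)) z x) (hxp : x.1 = p)
    (hy : JoinedIn (H ∩ side p 1) z y) (hyq : y.1 = q) :
    ∃ f : C(𝕀, ℝ × ℝ), IsCross p q 1 f ∧ (∀ t, f t ∈ H) ∧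
      JoinedIn (H ∩ side q (-1)) z (f 0) ∧ JoinedIn (H ∩ side p 1) z (f 1) := by
  obtain ⟨u, hu, ju, ju'⟩ := hx.exists_to_line one_ne_zero (c := p) hy.source_mem.2
    (by simp [mem_side, hxp])
  obtain ⟨v, hv, jv, jv'⟩ := hy.exists_to_line (σ := -1) (by norm_num) (c := q) hx.source_mem.2
    (by simp [mem_side, hyq])
  have hj : JoinedIn (H ∩ (side p 1 ∩ side q (-1) ∪ {u, v})) u v := by
    refine (ju'.symm.mono ?_).trans (jv'.mono ?_)
    · rintro w (⟨⟨h1, h2⟩, h3⟩ | rfl)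
      · exact ⟨h1, .inl ⟨h3, h2⟩⟩
      · exact ⟨ju.target_mem.1, .inr (.inl rfl)⟩
    · rintro w (⟨⟨h1, h2⟩, h3⟩ | rfl)
      · exact ⟨h1, .inl ⟨h2, h3⟩⟩
      · exact ⟨jv.target_mem.1, .inr (.inr rfl)⟩
  have huv : u ≠ v := by
    rintro rfl
    exact hpq.ne (hu.symm.trans hv)
  obtain ⟨f, hf, rfl, rfl, hr⟩ := hj.exists_canonArc huv
  have hinter : ∀ t, t ≠ 0 → t ≠ 1 → f t ∈ side p 1 ∩ side q (-1) := by
    intro t h0 h1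
    rcases (hr (mem_range_self t)).2 with h | h | h
    · exact h
    · exact absurd (hf.1 h) h0
    · exact absurd (hf.1 h) h1
  exact ⟨f, ⟨hf.1, hu, hv, fun t h0 h1 => (hinter t h0 h1).1, fun t h0 h1 => (hinter t h0 h1).2⟩,
    fun t => (hr (mem_range_self t)).1, ju, jv⟩

/-- Two crossing arcs whose end points are joined to the right of the left line or
to the left of the right line. -/
def Linked (H : Set (ℝ × ℝ)) (p q : ℝ) (f g : C(𝕀, ℝ × ℝ)) : Prop :=
  (IsCross p q 1 g ∧ ∀ t, g t ∈ H) ∧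
    (JoinedIn (H ∩ side p 1) (f 1) (g 1) ∨ JoinedIn (H ∩ side q (-1)) (f 0) (g 0))

lemma linked_chain {p q : ℝ} (hpq : p < q) (hf : IsCross p q 1 f) (hg : IsCross p q 1 g)
    (fH : ∀ t, f t ∈ H) (gH : ∀ t, g t ∈ H) (hfg : JoinedIn H (f 0) (g 0)) :
    Relation.ReflTransGen (Linked H p q) f g := by
  obtain ⟨γ, hγ, hF, e0, e1⟩ := hfg.exists_curve
  have hline : ∀ {z : ℝ × ℝ}, z.1 = p → z ∈ side q (-1) := fun hz => by
    rw [mem_side, hz]; linarith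
  obtain ⟨t, t0, tm, ⟨N, tN⟩, htc⟩ := exists_monotone_Icc_subset_open_cover_unitInterval
    (c := fun b : Bool => {x : 𝕀 | γ x ∈ if b then side p 1 else side q (-1)})
    (fun b => by
      have : Continuous fun x : 𝕀 => γ x := by fun_prop
      cases b
      · exact (isOpen_side q (-1)).preimage this
      · exact (isOpen_side p 1).preimage this)
    (fun x _ => by
      rw [mem_iUnion]
      rcases lt_or_ge (γ x).1 q with h | h
      · exact ⟨false, show 0 < -1 * ((γ x).1 - q) by linarith⟩
      · exact ⟨true, show 0 < 1 * ((γ x).1 - p) by linarith⟩)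
  have hseg : ∀ n {F : Set (ℝ × ℝ)}, (∀ x ∈ Icc (t n) (t (n + 1)), γ x ∈ F) →
      ∀ x ∈ Icc (t n) (t (n + 1)), JoinedIn (H ∩ F) (γ (t n)) (γ x) := by
    intro n F hFs x hx
    refine joinedIn_of_continuousOn_uIcc hγ.continuousOn fun y hy => ⟨hF y, ?_⟩
    rw [uIcc_of_le (show (t n : ℝ) ≤ x from hx.1)] at hy
    exact hFs ⟨y, (t n).2.1.trans hy.1, hy.2.trans x.2.2⟩ ⟨hy.1, hy.2.trans hx.2⟩
  have hinv : ∀ n, ∃ k, Relation.ReflTransGen (Linked H p q) f k ∧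
      (IsCross p q 1 k ∧ ∀ t, k t ∈ H) ∧ (JoinedIn (H ∩ side p 1) (k 1) (γ (t n)) ∨
        JoinedIn (H ∩ side q (-1)) (k 0) (γ (t n))) := by
    intro n
    induction n with
    | zero =>
      refine ⟨f, .refl, ⟨hf, fH⟩, .inr ?_⟩
      rw [t0, Icc.coe_zero, e0]
      exact JoinedIn.refl ⟨fH 0, hline hf.left⟩
    | succ n ih =>
      obtain ⟨k, hk, hkc, hj⟩ := ih
      have hr : t (n + 1) ∈ Icc (t n) (t (n + 1)) := ⟨tm n.le_succ, le_rfl⟩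
      obtain ⟨b, hb⟩ := htc n
      cases b with
      | true =>
        have hb : ∀ x ∈ Icc (t n) (t (n + 1)), γ x ∈ side p 1 := hb
        rcases hj with hj | hj
        · exact ⟨k, hk, hkc, .inl (hj.trans (hseg n hb _ hr))⟩
        by_cases hall : ∀ x ∈ Icc (t n) (t (n + 1)), γ x ∈ side q (-1)
        · exact ⟨k, hk, hkc, .inr (hj.trans (hseg n hall _ hr))⟩
        push Not at hall
        obtain ⟨x, hx, hxq⟩ := hall
        obtain ⟨u, hu, ju, -⟩ := (hseg n hb x hx).exists_to_line (by norm_num) hj.target_mem.2 hxq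
        obtain ⟨k', hk', kH', j1, j2⟩ := exists_isCross hpq hj.symm hkc.1.left ju hu
        exact ⟨k', hk.tail ⟨⟨hk', kH'⟩, .inr (hj.trans j1)⟩, ⟨hk', kH'⟩,
          .inl (j2.symm.trans (hseg n hb _ hr))⟩
      | false =>
        have hb : ∀ x ∈ Icc (t n) (t (n + 1)), γ x ∈ side q (-1) := hb
        rcases hj.symm with hj | hj
        · exact ⟨k, hk, hkc, .inr (hj.trans (hseg n hb _ hr))⟩
        by_cases hall : ∀ x ∈ Icc (t n) (t (n + 1)), γ x ∈ side p 1
        · exact ⟨k, hk, hkc, .inl (hj.trans (hseg n hall _ hr))⟩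
        push Not at hall
        obtain ⟨x, hx, hxq⟩ := hall
        obtain ⟨u, hu, ju, -⟩ := (hseg n hb x hx).exists_to_line (by norm_num) hj.target_mem.2 hxq
        obtain ⟨k', hk', kH', j1, j2⟩ := exists_isCross hpq ju hu hj.symm hkc.1.right
        exact ⟨k', hk.tail ⟨⟨hk', kH'⟩, .inl (hj.trans j2)⟩, ⟨hk', kH'⟩,
          .inr (j1.symm.trans (hseg n hb _ hr))⟩
  obtain ⟨k, hk, hkc, hj⟩ := hinv N
  rw [tN N le_rfl, Icc.coe_one, e1] at hj
  refine hk.tail ⟨⟨hg, gH⟩, .inr (hj.resolve_left fun hj => ?_)⟩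
  exact fst_ne_of_mem_side hj.target_mem.2 hg.left

end

section
variable {K : Set ℝ} {φ : ℝ → ℝ × ℝ}

/-- The points to which `φ` converges at the upper end of `K`. -/
def landTop (K : Set ℝ) (φ : ℝ → ℝ × ℝ) : Set (ℝ × ℝ) :=
  {l | ∀ U ∈ 𝓝 l, ∃ b ∈ K, ∀ x ∈ K, b ≤ x → φ x ∈ U}

/-- The points to which `φ` converges at one of the ends of `K`. -/
def land (K : Set ℝ) (φ : ℝ → ℝ × ℝ) : Set (ℝ × ℝ) :=
  landTop K φ ∪ landTop (Neg.neg ⁻¹' K) (φ ∘ Neg.neg)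

lemma landTop_subsingleton : (landTop K φ).Subsingleton := by
  intro x hx y hy
  by_contra hne
  obtain ⟨U, V, hU, hV, hd⟩ := t2_separation_nhds hne
  obtain ⟨b, hb, h1⟩ := hx U hU
  obtain ⟨b', hb', h2⟩ := hy V hV
  obtain ⟨m, hm, m1, m2⟩ : ∃ m ∈ K, b ≤ m ∧ b' ≤ m := by
    rcases le_total b b' with h | h
    exacts [⟨b', hb', h, le_rfl⟩, ⟨b, hb, le_rfl, h⟩]
  exact hd.le_bot ⟨h1 m hm m1, h2 m hm m2⟩

lemma land_finite : (land K φ).Finite :=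
  landTop_subsingleton.finite.union landTop_subsingleton.finite

lemma exists_eq_of_not_land (hK : K.OrdConnected) (hφ : ContinuousOn φ K) (hi : InjOn φ K)
    {γ : ℝ → ℝ × ℝ} {h : ℝ → ℝ} (hh : ContinuousOn h (Ico 0 1)) (hγ : Continuous γ)
    (hK' : ∀ s, h s ∈ K) (he : ∀ s, φ (h s) = γ s) {v : ℝ} (hv : v ∈ K) (h1 : h 1 < v)
    (h0 : v < h 0) (hl : γ 1 ∉ landTop K φ) : ∃ s ∈ Ico (0:ℝ) 1, h s = v := by
  by_contra! hne
  have hgt : ∀ s ∈ Ico (0:ℝ) 1, v < h s := by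
    intro s hs
    by_contra hle
    obtain ⟨y, hy, hyv⟩ := (isPreconnected_Ico.image h hh).Icc_subset ⟨s, hs, rfl⟩
      ⟨0, left_mem_Ico.2 zero_lt_one, rfl⟩ ⟨not_lt.1 hle, h0.le⟩
    exact hne y hy hyv
  refine hl fun U hU => ?_
  obtain ⟨s₀, hs₀, hs₀U⟩ : ∃ s₀ ∈ Ico (0:ℝ) 1, ∀ s ∈ Ico s₀ 1, γ s ∈ U := by
    obtain ⟨l, hl, hl'⟩ := (mem_nhdsLE_iff_exists_Ioc_subset' (zero_lt_one (α := ℝ))).1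
      (nhdsWithin_le_nhds (hγ.continuousAt.preimage_mem_nhds hU))
    have hl1 : l < 1 := hl
    refine ⟨max 0 ((l + 1) / 2), ⟨le_max_left _ _, max_lt zero_lt_one (by linarith)⟩,
      fun s hs => hl' ⟨?_, hs.2.le⟩⟩
    have := (le_max_right 0 ((l + 1) / 2)).trans hs.1
    linarith
  refine ⟨h s₀, hK' s₀, fun x hx hle => ?_⟩
  have hsub : Ico s₀ 1 ⊆ Ico 0 1 := Ico_subset_Ico_left hs₀.1
  by_contra hxU
  have hne' : ∀ s ∈ Ico s₀ 1, h s ≠ x := by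
    rintro s hs rfl
    rw [he] at hxU
    exact hxU (hs₀U s hs)
  have hlt : ∀ s ∈ Ico s₀ 1, h s < x := by
    intro s hs
    by_contra hge
    obtain ⟨y, hy, hyv⟩ := (isPreconnected_Ico.image h (hh.mono hsub)).Icc_subset
      ⟨s₀, left_mem_Ico.2 hs₀.2, rfl⟩ ⟨s, hs, rfl⟩ ⟨hle, not_lt.1 hge⟩
    exact hne' y hy hyv
  have hcl : IsClosed (φ '' Icc v x) :=
    (isCompact_Icc.image_of_continuousOn (hφ.mono (hK.out hv hx))).isClosed
  have hmem : Icc s₀ 1 ⊆ γ ⁻¹' (φ '' Icc v x) := by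
    rw [← closure_Ico hs₀.2.ne]
    exact closure_minimal (fun s hs => ⟨h s, ⟨(hgt s (hsub hs)).le, (hlt s hs).le⟩, he s⟩)
      (hcl.preimage hγ)
  obtain ⟨y, hy, hye⟩ := hmem (right_mem_Icc.2 hs₀.2.le)
  rw [← he, hi.eq_iff (hK.out hv hx hy) (hK' 1)] at hye
  exact h1.not_ge (hye ▸ hy.1)

end

section
variable {K : Set ℝ} {φ : ℝ → ℝ × ℝ} {γ : C(𝕀, ℝ × ℝ)} {h : 𝕀 → ℝ}

/-- The points near which `h` takes values in a compact subinterval of `K`. -/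
def locBdd (K : Set ℝ) (h : 𝕀 → ℝ) : Set 𝕀 :=
  {t | ∃ u ∈ K, ∃ v ∈ K, ∀ᶠ s in 𝓝 t, h s ∈ Icc u v}

lemma isOpen_locBdd : IsOpen (locBdd K h) := by
  rw [isOpen_iff_mem_nhds]
  rintro t ⟨u, hu, v, hv, hev⟩
  filter_upwards [hev.eventually_nhds] with s hs using ⟨u, hu, v, hv, hs⟩

lemma continuousAt_of_mem_locBdd (hK : K.OrdConnected) (hφ : ContinuousOn φ K) (hi : InjOn φ K)
    (he : ∀ s, φ (h s) = γ s) {t : 𝕀} (ht : t ∈ locBdd K h) : ContinuousAt h t := by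
  obtain ⟨u, hu, v, hv, hev⟩ := ht
  have huv : u ≤ v := hev.self_of_nhds.1.trans hev.self_of_nhds.2
  have hemb : IsClosedEmbedding (fun x : Icc u v => φ x) :=
    Continuous.isClosedEmbedding
      (continuousOn_iff_continuous_domRestrict.1 (hφ.mono (hK.out hu hv)))
      fun x y hxy => Subtype.ext (hi (hK.out hu hv x.2) (hK.out hu hv y.2) hxy)
  have h1 : ContinuousAt (fun s => projIcc u v huv (h s)) t := by
    rw [hemb.isInducing.continuousAt_iff]
    refine (γ.continuous.continuousAt (x := t)).congr ?_
    filter_upwards [hev] with s hs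
    simp [projIcc_of_mem huv hs, he]
  refine (continuous_subtype_val.continuousAt.comp h1).congr ?_
  filter_upwards [hev] with s hs
  simp [projIcc_of_mem huv hs]

lemma exists_upper_bound (hK : K.OrdConnected) (hφ : ContinuousOn φ K) (hi : InjOn φ K)
    (hγ : Function.Injective γ) (hK' : ∀ s, h s ∈ K) (he : ∀ s, φ (h s) = γ s) {t₀ : 𝕀}
    (ht₀ : t₀ ∉ locBdd K h) {ε : ℝ} (hε : 0 < ε) {v : ℝ} (hv : v ∈ K)
    (hb : ∀ t, dist t t₀ < ε → t ∉ locBdd K h → h t ≤ v)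
    (hl : ∀ t, dist t t₀ < ε → γ t ∉ landTop K φ) : ∃ v' ∈ K, ∀ᶠ s in 𝓝 t₀, h s ≤ v' := by
  by_cases hgr : ∀ x ∈ K, x ≤ v
  · exact ⟨v, hv, .of_forall fun s => hgr _ (hK' s)⟩
  push Not at hgr
  obtain ⟨v', hv', hlt⟩ := hgr
  refine ⟨v', hv', ?_⟩
  have hne : ∀ᶠ s in 𝓝 t₀, h s ≠ v' := by
    by_cases hex : ∃ t, h t = v'
    · obtain ⟨t, ht⟩ := hex
      have : t₀ ≠ t := by
        rintro rfl
        have := hb t₀ (by simpa using hε) ht₀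
        linarith
      filter_upwards [isOpen_ne.mem_nhds this] with s hs hs'
      refine hs (hγ ?_)
      rw [← he, ← he, hs', ht]
    · push Not at hex
      exact .of_forall hex
  obtain ⟨η, hη, hη'⟩ := Metric.eventually_nhds_iff.1 hne
  refine Metric.eventually_nhds_iff.2 ⟨min ε η, lt_min hε hη, fun s hs => ?_⟩
  by_contra hgt
  rw [not_le] at hgt
  set ρ : ℝ → 𝕀 := fun y => projIcc 0 1 zero_le_one (s + (t₀ - s) * y) with hρ
  have hρc : Continuous ρ := by fun_prop
  have hmem : ∀ y ∈ Icc (0:ℝ) 1, (s : ℝ) + (t₀ - s) * y ∈ Icc (0:ℝ) 1 := fun y hy => by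
    obtain ⟨a, b⟩ := s.2
    obtain ⟨c, d⟩ := t₀.2
    constructor <;> nlinarith [hy.1, hy.2]
  have hdist : ∀ y ∈ Icc (0:ℝ) 1, dist (ρ y) t₀ < min ε η := fun y hy => by
    refine lt_of_le_of_lt ?_ hs
    rw [Subtype.dist_eq, Subtype.dist_eq, hρ]
    simp only [projIcc_of_mem _ (hmem y hy), Real.dist_eq]
    rw [show (s:ℝ) + (t₀ - s) * y - t₀ = (s - t₀) * (1 - y) by ring, abs_mul]
    refine mul_le_of_le_one_right (abs_nonneg _) ?_
    rw [abs_of_nonneg] <;> linarith [hy.1, hy.2]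
  have ρ0 : ρ 0 = s := by simp [hρ]
  have ρ1 : ρ 1 = t₀ := by simp [hρ]
  obtain ⟨y₀, ⟨hy₀, hy₀b⟩, hmin⟩ := (isCompact_Icc.inter_right
    ((isOpen_locBdd (K := K) (h := h)).isClosed_compl.preimage hρc)).exists_isLeast
    ⟨1, right_mem_Icc.2 (zero_le_one (α := ℝ)), by simpa [ρ1] using ht₀⟩
  have hs' : s ∈ locBdd K h := by
    by_contra hs'
    have := hb s (hs.trans_le (min_le_left _ _)) hs'
    linarith
  have hy₀0 : 0 < y₀ := lt_of_le_of_ne hy₀.1 (by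
    rintro rfl
    rw [mem_preimage, ρ0] at hy₀b
    exact hy₀b hs')
  have hmul : ∀ y ∈ Icc (0:ℝ) 1, y₀ * y ∈ Icc (0:ℝ) 1 := fun y hy =>
    ⟨mul_nonneg hy₀.1 hy.1, mul_le_one₀ hy₀.2 hy.1 hy.2⟩
  have hc : ContinuousOn (fun y => h (ρ (y₀ * y))) (Ico 0 1) := by
    intro y hy
    have hm : ρ (y₀ * y) ∈ locBdd K h := by
      by_contra hm
      have := hmin ⟨hmul y (Ico_subset_Icc_self hy), hm⟩
      nlinarith [hy.2]
    exact ((continuousAt_of_mem_locBdd hK hφ hi he hm).comp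
      (f := fun y => ρ (y₀ * y)) (by fun_prop)).continuousWithinAt
  obtain ⟨y, hy, hye⟩ := exists_eq_of_not_land hK hφ hi (γ := fun y => γ (ρ (y₀ * y))) (v := v')
    hc (by fun_prop) (fun _ => hK' _) (fun _ => he _) hv'
    (by
      rw [mul_one]
      exact (hb _ ((hdist _ hy₀).trans_le (min_le_left _ _)) hy₀b).trans_lt hlt)
    (by simpa [ρ0] using hgt)
    (by
      rw [mul_one]
      exact hl _ ((hdist _ hy₀).trans_le (min_le_left _ _)))
  exact hη' ((hdist _ (hmul y (Ico_subset_Icc_self hy))).trans_le (min_le_right _ _)) hye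

lemma neg_mem_Icc_iff' {x u v : ℝ} : -x ∈ Icc u v ↔ x ∈ Icc (-v) (-u) := by
  constructor <;> rintro ⟨a, b⟩ <;> constructor <;> linarith

lemma locBdd_neg : locBdd (Neg.neg ⁻¹' K) (fun t => - h t) = locBdd K h := by
  ext t
  constructor
  · rintro ⟨u, hu, v, hv, hev⟩
    exact ⟨-v, hv, -u, hu, hev.mono fun s hs => neg_mem_Icc_iff'.1 hs⟩
  · rintro ⟨u, hu, v, hv, hev⟩
    exact ⟨-v, by simpa using hv, -u, by simpa using hu, hev.mono fun s hs =>
      neg_mem_Icc_iff'.2 (by simpa using hs)⟩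

lemma exists_countable_bounding (hK : K.OrdConnected) :
    ∃ Q ⊆ K, Q.Countable ∧ ∀ k ∈ K, ∃ v ∈ Q, k ≤ v := by
  refine ⟨K ∩ (range ((↑) : ℚ → ℝ) ∪ {x | ∀ y ∈ K, y ≤ x}), inter_subset_left, ?_, ?_⟩
  · rw [inter_union_distrib_left]
    refine ((countable_range _).mono inter_subset_right).union (Set.Subsingleton.countable ?_)
    rintro x ⟨hx, hx'⟩ y ⟨hy, hy'⟩
    exact le_antisymm (hy' x hx) (hx' y hy)
  · intro k hk
    by_cases hg : ∀ y ∈ K, y ≤ k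
    · exact ⟨k, ⟨hk, .inr hg⟩, le_rfl⟩
    push Not at hg
    obtain ⟨y, hy, hky⟩ := hg
    obtain ⟨r, h1, h2⟩ := exists_rat_btwn hky
    exact ⟨r, ⟨hK.out hk hy ⟨h1.le, h2.le⟩, .inl ⟨r, rfl⟩⟩, h1.le⟩

lemma ordConnected_neg (hK : K.OrdConnected) : (Neg.neg ⁻¹' K).OrdConnected := by
  refine ⟨fun x hx y hy z hz => hK.out hy hx ?_⟩
  exact ⟨neg_le_neg hz.2, neg_le_neg hz.1⟩

/-- The parameter of an arc in `φ '' K` is locally bounded away from the landing points. -/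
lemma mem_locBdd (hK : K.OrdConnected) (hφ : ContinuousOn φ K) (hi : InjOn φ K)
    (hγ : Function.Injective γ) (hK' : ∀ s, h s ∈ K) (he : ∀ s, φ (h s) = γ s) {t : 𝕀}
    (ht : γ t ∉ land K φ) : t ∈ locBdd K h := by
  by_contra hb
  set B : Set 𝕀 := (locBdd K h)ᶜ ∩ (γ ⁻¹' land K φ)ᶜ
  have hL : IsClosed (γ ⁻¹' land K φ) := land_finite.isClosed.preimage γ.continuous
  have hB : IsLocallyClosed B :=
    isOpen_locBdd.isClosed_compl.isLocallyClosed.inter hL.isOpen_compl.isLocallyClosed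
  have : LocallyCompactSpace B := hB.locallyCompactSpace
  have : Nonempty B := ⟨⟨t, hb, ht⟩⟩
  obtain ⟨Q, hQK, hQ, hQ'⟩ := exists_countable_bounding hK
  obtain ⟨P, hPK, hP, hP'⟩ := exists_countable_bounding (ordConnected_neg hK)
  have : Countable (P ×ˢ Q : Set (ℝ × ℝ)) := (hP.prod hQ).to_subtype
  obtain ⟨⟨⟨u, v⟩, hu, hv⟩, ⟨⟨t₀, ht₀⟩, htI⟩⟩ := nonempty_interior_of_iUnion_of_closed
    (X := B) (ι := (P ×ˢ Q : Set (ℝ × ℝ))) (f := fun i => {b : B | h b ∈ Icc (-i.1.1) i.1.2})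
    (by
      rintro ⟨⟨u, v⟩, hu, hv⟩
      have hsub : Icc (-u) v ⊆ K := hK.out (hPK hu) (hQK hv)
      have : {b : B | h b ∈ Icc (-u) v} = {b : B | γ b ∈ φ '' Icc (-u) v} := by
        ext b
        refine ⟨fun hb => ⟨_, hb, he _⟩, ?_⟩
        rintro ⟨y, hy, hye⟩
        rw [← he] at hye
        rw [mem_ofPred_eq, ← hi (hsub hy) (hK' _) hye]
        exact hy
      simp only [this]
      exact ((isCompact_Icc.image_of_continuousOn (hφ.mono hsub)).isClosed.preimage
        γ.continuous).preimage continuous_subtype_val)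
    (by
      refine eq_univ_of_forall fun b => mem_iUnion.2 ?_
      obtain ⟨v, hv, hv'⟩ := hQ' _ (hK' b)
      obtain ⟨u, hu, hu'⟩ := hP' (- h b) (by simpa using hK' b)
      exact ⟨⟨(u, v), hu, hv⟩, by linarith, hv'⟩)
  replace hu : -u ∈ K := hPK hu
  replace hv : v ∈ K := hQK hv
  obtain ⟨ε₁, hε₁, h1⟩ := Metric.mem_nhds_iff.1 (mem_interior_iff_mem_nhds.1 htI)
  obtain ⟨ε₂, hε₂, h2⟩ := Metric.mem_nhds_iff.1 (hL.isOpen_compl.mem_nhds ht₀.2)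
  have hε : 0 < min ε₁ ε₂ := lt_min hε₁ hε₂
  have hl : ∀ s, dist s t₀ < min ε₁ ε₂ → γ s ∉ land K φ := fun s hs =>
    h2 (hs.trans_le (min_le_right _ _))
  have hbd : ∀ s, dist s t₀ < min ε₁ ε₂ → s ∉ locBdd K h → h s ∈ Icc (-u) v := fun s hs hsb =>
    h1 (show (⟨s, hsb, hl s hs⟩ : B) ∈ ball _ ε₁ from hs.trans_le (min_le_left _ _))
  obtain ⟨v', hv', e1⟩ := exists_upper_bound hK hφ hi hγ hK' he ht₀.1 hε hv
    (fun s hs hsb => (hbd s hs hsb).2) (fun s hs hs' => hl s hs (.inl hs'))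
  obtain ⟨u', hu', e2⟩ := exists_upper_bound (K := Neg.neg ⁻¹' K) (φ := φ ∘ Neg.neg)
    (h := fun t => - h t) (v := u)
    (ordConnected_neg hK) (hφ.comp continuous_neg.continuousOn fun x hx => hx)
    (fun x hx y hy hxy => neg_injective (hi hx hy hxy)) hγ (fun s => by simpa using hK' s)
    (fun s => by simpa using he s) (by rw [locBdd_neg]; exact ht₀.1) hε hu
    (fun s hs hsb => by
      rw [locBdd_neg] at hsb
      have := (hbd s hs hsb).1
      linarith) (fun s hs hs' => hl s hs (.inr hs'))
  refine ht₀.1 ⟨-u', hu', v', hv', ?_⟩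
  filter_upwards [e1, e2] with s h1 h2
  exact ⟨by linarith, h1⟩

end

lemma exists_finite_separation {F : Set 𝕀} (hF : F.Finite) :
    ∃ S : Set 𝕀, S.Finite ∧ S ⊆ Fᶜ ∧ ∀ t ∉ F, ∃ s ∈ S, Disjoint (uIcc s t) F := by
  classical
  have hex : ∀ A : Set 𝕀, ∃ s : 𝕀, (∃ t ∉ F, F ∩ Iio t = A) → s ∉ F ∧ F ∩ Iio s = A := by
    intro A
    by_cases h : ∃ t ∉ F, F ∩ Iio t = A
    · obtain ⟨t, ht⟩ := h
      exact ⟨t, fun _ => ht⟩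
    · exact ⟨0, fun h' => absurd h' h⟩
  choose c hc using hex
  refine ⟨c '' ((fun t => F ∩ Iio t) '' Fᶜ), ?_, ?_, ?_⟩
  · refine (hF.finite_subsets.subset ?_).image c
    rintro _ ⟨t, -, rfl⟩
    exact inter_subset_left
  · rintro _ ⟨_, ⟨t, ht, rfl⟩, rfl⟩
    exact (hc _ ⟨t, ht, rfl⟩).1
  · intro t ht
    refine ⟨_, ⟨_, ⟨t, ht, rfl⟩, rfl⟩, ?_⟩
    obtain ⟨h1, h2⟩ := hc _ ⟨t, ht, rfl⟩
    simp only at h1 h2 ⊢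
    set s := c (F ∩ Iio t)
    rw [Set.disjoint_left]
    intro x hx hxF
    rcases le_total s t with hst | hst
    · rw [uIcc_of_le hst] at hx
      have : x ∈ F ∩ Iio t := ⟨hxF, lt_of_le_of_ne hx.2 (by rintro rfl; exact ht hxF)⟩
      rw [← h2] at this
      exact this.2.not_ge hx.1
    · rw [uIcc_of_ge hst] at hx
      have : x ∈ F ∩ Iio s := ⟨hxF, lt_of_le_of_ne hx.2 (by rintro rfl; exact h1 hxF)⟩
      rw [h2] at this
      exact this.2.not_ge hx.1

/-- There are only countably many arcs with end points and finitely many interior points on `Z`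
in an injective continuous image of an interval. -/
lemma countable_arcs {K : Set ℝ} {φ : ℝ → ℝ × ℝ} (hK : K.OrdConnected) (hφ : ContinuousOn φ K)
    (hi : InjOn φ K) (Z : Set (ℝ × ℝ)) :
    {J : Set (ℝ × ℝ) | ∃ γ : C(𝕀, ℝ × ℝ), Function.Injective γ ∧ range γ = J ∧ J ⊆ φ '' K ∧
      γ 0 ∈ Z ∧ γ 1 ∈ Z ∧ (γ ⁻¹' Z).Finite}.Countable := by
  set M : Set ℝ := {x | x ∈ K ∧ φ x ∉ Z ∪ land K φ}
  refine (countable_range fun S : Finset ℚ =>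
    closure (φ '' {x | ∃ r ∈ S, uIcc (r : ℝ) x ⊆ M})).mono ?_
  rintro J ⟨γ, hγ, rfl, hJ, h0, h1, hfin⟩
  set h : 𝕀 → ℝ := fun t => Function.invFunOn φ K (γ t)
  have hK' : ∀ t, h t ∈ K := fun t => Function.invFunOn_mem (hJ (mem_range_self t))
  have he : ∀ t, φ (h t) = γ t := fun t => Function.invFunOn_eq (hJ (mem_range_self t))
  have hinj : Function.Injective h := fun s t hst => hγ (by rw [← he, ← he, hst])
  set F : Set 𝕀 := γ ⁻¹' (Z ∪ land K φ) with hFdef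
  have hF : F.Finite := by
    rw [hFdef, preimage_union]
    exact hfin.union (land_finite.preimage hγ.injOn)
  have hcont : ∀ t ∉ F, ContinuousAt h t := fun t ht => continuousAt_of_mem_locBdd hK hφ hi he
    (mem_locBdd hK hφ hi hγ hK' he fun hl => ht (.inr hl))
  have hDM : h '' Fᶜ ⊆ M := by
    rintro _ ⟨t, ht, rfl⟩
    exact ⟨hK' t, by rw [he]; exact ht⟩
  have hopen : IsOpen (h '' Fᶜ) := by
    rw [isOpen_iff_mem_nhds]
    rintro _ ⟨t, ht, rfl⟩
    have ht0 : 0 < t := unitInterval.pos_iff_ne_zero.2 (by rintro rfl; exact ht (.inl h0))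
    have ht1 : t < 1 := unitInterval.lt_one_iff_ne_one.2 (by rintro rfl; exact ht (.inl h1))
    obtain ⟨l, u, ⟨hl, hu⟩, hlu⟩ := (mem_nhds_iff_exists_Ioo_subset' ⟨0, ht0⟩ ⟨1, ht1⟩).1
      (hF.isClosed.isOpen_compl.mem_nhds ht)
    obtain ⟨a, hla, hat⟩ := exists_between hl
    obtain ⟨b, htb, hbu⟩ := exists_between hu
    have hab : Icc a b ⊆ Fᶜ := fun x hx => hlu ⟨hla.trans_le hx.1, hx.2.trans_lt hbu⟩
    have hc : ContinuousOn h (Icc a b) := fun x hx => (hcont x (hab hx)).continuousWithinAt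
    have hle : a ≤ b := (hat.trans htb).le
    have ma : a ∈ Icc a b := left_mem_Icc.2 hle
    have mb : b ∈ Icc a b := right_mem_Icc.2 hle
    have mt : t ∈ Icc a b := ⟨hat.le, htb.le⟩
    rcases hc.strictMonoOn_of_injOn_Icc' hle hinj.injOn with hm | hm
    · exact mem_of_superset (Icc_mem_nhds (hm ma mt hat) (hm mt mb htb))
        ((intermediate_value_Icc hle hc).trans (image_mono hab))
    · exact mem_of_superset (Icc_mem_nhds (hm mt mb htb) (hm ma mt hat))
        ((intermediate_value_Icc' hle hc).trans (image_mono hab))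
  have hclosed : closure (h '' Fᶜ) ∩ M ⊆ h '' Fᶜ := by
    rintro m ⟨hm, hmM⟩
    have hcl : φ m ∈ closure (φ '' (h '' Fᶜ)) :=
      ((hφ m hmM.1).mono (hDM.trans fun x hx => hx.1)).mem_closure_image hm
    have hsub : closure (φ '' (h '' Fᶜ)) ⊆ range γ :=
      closure_minimal (by rintro _ ⟨_, ⟨t, -, rfl⟩, rfl⟩; exact ⟨t, (he t).symm⟩)
        (isCompact_range γ.continuous).isClosed
    obtain ⟨t, ht⟩ := hsub hcl
    refine ⟨t, fun htF => hmM.2 (ht ▸ htF), hi (hK' t) hmM.1 ?_⟩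
    rw [he, ht]
  have hclopen : ∀ x y, x ∈ h '' Fᶜ → uIcc x y ⊆ M → y ∈ h '' Fᶜ := by
    intro x y hx hxy
    exact isPreconnected_uIcc.subset_of_closure_inter_subset hopen ⟨x, left_mem_uIcc, hx⟩
      (fun z hz => hclosed ⟨hz.1, hxy hz.2⟩) right_mem_uIcc
  obtain ⟨S, hS, hSF, hSt⟩ := exists_finite_separation hF
  have hr : ∀ s ∈ S, ∃ r : ℚ, uIcc (r : ℝ) (h s) ⊆ h '' Fᶜ := by
    intro s hs
    obtain ⟨ε, hε, hb⟩ := Metric.isOpen_iff.1 hopen _ (mem_image_of_mem h (hSF hs))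
    obtain ⟨r, h1, h2⟩ := exists_rat_btwn (show h s < h s + ε by linarith)
    refine ⟨r, fun x hx => hb ?_⟩
    rw [uIcc_of_ge h1.le] at hx
    rw [Metric.mem_ball, Real.dist_eq, abs_of_nonneg (by linarith [hx.1])]
    linarith [hx.2]
  choose! r hr using hr
  refine ⟨hS.toFinset.image r, ?_⟩
  have hset : {x | ∃ r' ∈ hS.toFinset.image r, uIcc (r' : ℝ) x ⊆ M} = h '' Fᶜ := by
    ext x
    constructor
    · rintro ⟨r', hr', hx⟩
      obtain ⟨s, hs, rfl⟩ := Finset.mem_image.1 hr'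
      exact hclopen _ _ (hr s (hS.mem_toFinset.1 hs) left_mem_uIcc) hx
    · rintro ⟨t, ht, rfl⟩
      obtain ⟨s, hs, hd⟩ := hSt t ht
      refine ⟨r s, Finset.mem_image_of_mem _ (hS.mem_toFinset.2 hs),
        (uIcc_subset_uIcc_union_uIcc (b := h s)).trans (union_subset ((hr s hs).trans hDM) ?_)⟩
      have hsub : uIcc s t ⊆ Fᶜ := disjoint_left.1 hd
      have hpc : IsPreconnected (h '' uIcc s t) := isPreconnected_uIcc.image h
        fun x hx => (hcont x (hsub hx)).continuousWithinAt
      exact (hpc.ordConnected.uIcc_subset (mem_image_of_mem h left_mem_uIcc)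
        (mem_image_of_mem h right_mem_uIcc)).trans ((image_mono hsub).trans hDM)
  simp only [hset, ← image_comp]
  rw [show φ ∘ h = γ from funext he]
  refine (closure_minimal (image_subset_range _ _) (isCompact_range γ.continuous).isClosed).antisymm
    ?_
  have hd : Dense Fᶜ := by
    rw [compl_eq_univ_sdiff]
    exact dense_univ.sdiff_finite hF
  rintro _ ⟨t, rfl⟩
  exact image_closure_subset_closure_image γ.continuous ⟨t, hd t, rfl⟩

lemma measurableSet_forall {X : Type*} [MeasurableSpace X] {ι : Sort*} [Countable ι]
    {P : ι → X → Prop} (h : ∀ i, MeasurableSet {x | P i x}) : MeasurableSet {x | ∀ i, P i x} := by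
  rw [ofPred_forall]
  exact MeasurableSet.iInter h

lemma measurableSet_exists {X : Type*} [MeasurableSpace X] {ι : Sort*} [Countable ι]
    {P : ι → X → Prop} (h : ∀ i, MeasurableSet {x | P i x}) : MeasurableSet {x | ∃ i, P i x} := by
  rw [ofPred_exists]
  exact MeasurableSet.iUnion h

/-- A family `L k x`, `k : ℤ`, that enumerates each of its orbits along a line, up to the choice of
an origin and of a direction. -/
structure LineAction {X : Type} [MeasurableSpace X] (L : ℤ → X → X) : Prop where
  measurable : ∀ k, Measurable (L k)
  zero : ∀ x, L 0 x = x
  law : ∀ m x, ∃ e : ℤ, (e = 1 ∨ e = -1) ∧ ∀ k, L k (L m x) = L (m + e * k) x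

namespace LineAction
variable {X : Type}

section Defs
variable (L : ℤ → X → X) (B : ℕ → Set X)

/-- A decreasing sequence of complete sections: each orbit chooses between `B n` and its
complement, preferring `B n`. -/
def sect : ℕ → Set X
  | 0 => univ
  | n + 1 => {x | x ∈ sect n ∧ (x ∈ B n ↔ ∃ k, L k x ∈ sect n ∩ B n)}

/-- The points of the `n`-th section that are extremal in it along their orbit. -/
def extremal (n : ℕ) : Set X :=
  {y | y ∈ sect L B n ∧ ((∀ j > 0, L j y ∉ sect L B n) ∨ ∀ j < 0, L j y ∉ sect L B n)}

/-- A set that meets every orbit in a finite set. -/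
def kernel : Set X :=
  {y | (∀ n, y ∈ sect L B n) ∨
    ∃ n, y ∈ extremal L B n ∧ ∀ m < n, ∀ k, L k y ∉ extremal L B m}

/-- The union of the orbits that meet `kernel`. -/
def smoothPart : Set X := {x | ∃ k, L k x ∈ kernel L B}

/-- The points at distance at most `n` from `kernel` along their orbit. -/
def nearKernel (n : ℕ) : Set X := {x | ∃ k : ℤ, |k| ≤ n ∧ L k x ∈ kernel L B}

/-- `y` is reached from `x` without crossing the `n`-th section. -/
def SameGap (n : ℕ) (x y : X) : Prop := ∃ k, y = L k x ∧ ∀ j ∈ uIcc 0 k, L j x ∉ sect L B n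

/-- The finite approximations of the orbit relation. -/
def approx (n : ℕ) (x y : X) : Prop :=
  x = y ∨ (x ∈ smoothPart L B ∧ (∃ k, y = L k x) ∧ x ∈ nearKernel L B n ∧ y ∈ nearKernel L B n) ∨
    (x ∉ smoothPart L B ∧ SameGap L B n x y)

end Defs

variable [MeasurableSpace X] {L : ℤ → X → X} {B : ℕ → Set X}

lemma exists_back (hL : LineAction L) (m : ℤ) (x : X) : ∃ k, L k (L m x) = x := by
  obtain ⟨e, he, h⟩ := hL.law m x
  refine ⟨-(e * m), ?_⟩
  rw [h]
  have : m + e * -(e * m) = 0 := by rcases he with rfl | rfl <;> ring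
  rw [this, hL.zero]

lemma exists_comp (hL : LineAction L) (k m : ℤ) (x : X) : ∃ i, L k (L m x) = L i x := by
  obtain ⟨e, -, h⟩ := hL.law m x
  exact ⟨_, h k⟩

lemma exists_comp' (hL : LineAction L) (k m : ℤ) (x : X) : ∃ i, L k x = L i (L m x) := by
  obtain ⟨j, hj⟩ := hL.exists_back m x
  obtain ⟨i, hi⟩ := hL.exists_comp k j (L m x)
  rw [hj] at hi
  exact ⟨i, hi⟩

lemma exists_mem_iff (hL : LineAction L) (A : Set X) (m : ℤ) (x : X) :
    (∃ k, L k (L m x) ∈ A) ↔ ∃ k, L k x ∈ A := by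
  constructor
  · rintro ⟨k, hk⟩
    obtain ⟨i, hi⟩ := hL.exists_comp k m x
    exact ⟨i, hi ▸ hk⟩
  · rintro ⟨k, hk⟩
    obtain ⟨i, hi⟩ := hL.exists_comp' k m x
    exact ⟨i, hi ▸ hk⟩

omit [MeasurableSpace X] in
lemma sect_antitone : Antitone (sect L B) :=
  antitone_nat_of_succ_le fun _ _ hx => hx.1

lemma exists_mem_sect (hL : LineAction L) (n : ℕ) (x : X) : ∃ k, L k x ∈ sect L B n := by
  induction n with
  | zero => exact ⟨0, mem_univ _⟩
  | succ n ih =>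
    obtain ⟨k, hk⟩ := ih
    by_cases h : ∃ i, L i x ∈ sect L B n ∩ B n
    · obtain ⟨i, hi⟩ := h
      exact ⟨i, hi.1, iff_of_true hi.2 ((hL.exists_mem_iff _ i x).2 ⟨i, hi⟩)⟩
    · refine ⟨k, hk, iff_of_false (fun hB => h ⟨k, hk, hB⟩) ?_⟩
      rwa [hL.exists_mem_iff]

lemma eq_of_forall_mem_sect (hL : LineAction L) (hB : ∀ x y, (∀ n, x ∈ B n ↔ y ∈ B n) → x = y)
    {m : ℤ} {x : X} (hx : ∀ n, x ∈ sect L B n) (hy : ∀ n, L m x ∈ sect L B n) : L m x = x := by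
  refine hB _ _ fun n => ?_
  rw [(hx (n + 1)).2, (hy (n + 1)).2, hL.exists_mem_iff]

lemma exists_extremal (hL : LineAction L) (s : ℤ) (hs : s = 1 ∨ s = -1) {n : ℕ} {x : X}
    (h : ∀ a > 0, L (s * a) x ∉ sect L B n) : ∃ k, L k x ∈ extremal L B n := by
  obtain ⟨i, hi⟩ := hL.exists_mem_sect (B := B) n x
  have hsi : ∀ j, s * (s * j) = j := fun j => by rcases hs with rfl | rfl <;> ring
  obtain ⟨b, hb, hmax⟩ := Int.exists_greatest_of_bdd (P := fun a => L (s * a) x ∈ sect L B n)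
    ⟨0, fun a ha => by by_contra h'; exact h a (by omega) ha⟩ ⟨s * i, by rwa [hsi]⟩
  refine ⟨s * b, hb, ?_⟩
  obtain ⟨e, he, hlaw⟩ := hL.law (s * b) x
  have key : ∀ j, 0 < s * e * j → L j (L (s * b) x) ∉ sect L B n := by
    intro j hj hj'
    rw [hlaw, show s * b + e * j = s * (b + s * e * j) by
      rw [mul_add, mul_assoc s e j, hsi]] at hj'
    have := hmax _ hj'
    omega
  rcases hs with rfl | rfl <;> rcases he with rfl | rfl
  · exact Or.inl fun j hj => key j (by linarith)
  · exact Or.inr fun j hj => key j (by linarith)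
  · exact Or.inr fun j hj => key j (by linarith)
  · exact Or.inl fun j hj => key j (by linarith)

lemma exists_mem_kernel (hL : LineAction L) {n : ℕ} {x : X} (h : ∃ k, L k x ∈ extremal L B n) :
    x ∈ smoothPart L B := by
  classical
  have h' : ∃ n, ∃ k, L k x ∈ extremal L B n := ⟨n, h⟩
  obtain ⟨k, hk⟩ := Nat.find_spec h'
  refine ⟨k, Or.inr ⟨_, hk, fun m hm i hi => Nat.find_min h' hm ?_⟩⟩
  exact (hL.exists_mem_iff _ k x).1 ⟨i, hi⟩

lemma exists_mem_sect_of_notMem (hL : LineAction L) (s : ℤ) (hs : s = 1 ∨ s = -1) {x : X}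
    (hx : x ∉ smoothPart L B) (n : ℕ) : ∃ a > 0, L (s * a) x ∈ sect L B n := by
  by_contra! h
  exact hx (hL.exists_mem_kernel (hL.exists_extremal s hs h))

lemma finite_extremal (hL : LineAction L) (n : ℕ) (x : X) :
    {y | (∃ k, y = L k x) ∧ y ∈ extremal L B n}.Finite := by
  have h : ∀ s : ℤ, {y | ∃ k, y = L k x ∧ y ∈ sect L B n ∧
      ∀ a, 0 < s * a → L (k + a) x ∉ sect L B n}.Subsingleton ∨ s = 0 := by
    intro s
    by_cases hs : s = 0
    · exact Or.inr hs
    left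
    rintro _ ⟨k, rfl, hk, hk'⟩ _ ⟨i, rfl, hi, hi'⟩
    rcases lt_trichotomy (s * (i - k)) 0 with h | h | h
    · refine absurd hk (by simpa using hi' (k - i) (by linarith [mul_sub s k i, mul_sub s i k]))
    · rcases mul_eq_zero.1 h with h | h
      · exact absurd h hs
      · rw [sub_eq_zero.1 h]
    · exact absurd hi (by simpa using hk' (i - k) h)
  have h1 := ((h 1).resolve_right (by norm_num)).finite
  have h2 := ((h (-1)).resolve_right (by norm_num)).finite
  refine (h1.union h2).subset ?_
  rintro _ ⟨⟨k, rfl⟩, hk, hk'⟩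
  obtain ⟨e, he, hlaw⟩ := hL.law k x
  have hlaw' : ∀ a, L (k + a) x = L (e * a) (L k x) := by
    intro a
    rw [hlaw]
    congr 1
    rcases he with rfl | rfl <;> ring
  rcases he with rfl | rfl <;> rcases hk' with hk' | hk'
  · exact Or.inl ⟨k, rfl, hk, fun a ha => by rw [hlaw']; exact hk' _ (by linarith)⟩
  · exact Or.inr ⟨k, rfl, hk, fun a ha => by rw [hlaw']; exact hk' _ (by linarith)⟩
  · exact Or.inr ⟨k, rfl, hk, fun a ha => by rw [hlaw']; exact hk' _ (by linarith)⟩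
  · exact Or.inl ⟨k, rfl, hk, fun a ha => by rw [hlaw']; exact hk' _ (by linarith)⟩

lemma finite_kernel (hL : LineAction L) (hB : ∀ x y, (∀ n, x ∈ B n ↔ y ∈ B n) → x = y) (x : X) :
    {y | (∃ k, y = L k x) ∧ y ∈ kernel L B}.Finite := by
  have h1 : {y | (∃ k, y = L k x) ∧ ∀ n, y ∈ sect L B n}.Finite := by
    refine Set.Subsingleton.finite ?_
    rintro _ ⟨⟨k, rfl⟩, hk⟩ _ ⟨⟨i, rfl⟩, hi⟩
    obtain ⟨j, hj⟩ := hL.exists_comp' i k x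
    rw [hj] at hi ⊢
    exact (hL.eq_of_forall_mem_sect hB hk hi).symm
  by_cases h : ∃ n k, L k x ∈ extremal L B n
  · classical
    refine (h1.union (hL.finite_extremal (B := B) (Nat.find h) x)).subset ?_
    rintro _ ⟨⟨k, rfl⟩, hk | ⟨n, hn, hmin⟩⟩
    · exact Or.inl ⟨⟨k, rfl⟩, hk⟩
    · refine Or.inr ⟨⟨k, rfl⟩, ?_⟩
      have : Nat.find h = n := by
        rw [Nat.find_eq_iff]
        exact ⟨⟨k, hn⟩, fun m hm hm' => by
          obtain ⟨i, hi⟩ := (hL.exists_mem_iff _ k x).2 hm'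
          exact hmin m hm i hi⟩
      rwa [this]
  · refine h1.subset ?_
    rintro _ ⟨⟨k, rfl⟩, hk | ⟨n, hn, hmin⟩⟩
    · exact ⟨⟨k, rfl⟩, hk⟩
    · exact absurd ⟨n, k, hn⟩ h

lemma mem_smoothPart_iff (hL : LineAction L) (m : ℤ) (x : X) :
    L m x ∈ smoothPart L B ↔ x ∈ smoothPart L B := hL.exists_mem_iff _ m x

lemma sameGap_symm (hL : LineAction L) {n : ℕ} {x y : X} (h : SameGap L B n x y) :
    SameGap L B n y x := by
  obtain ⟨k, rfl, hk⟩ := h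
  obtain ⟨e, he, hlaw⟩ := hL.law k x
  refine ⟨-(e * k), ?_, fun j hj => ?_⟩
  · rw [hlaw, show k + e * -(e * k) = 0 by rcases he with rfl | rfl <;> ring, hL.zero]
  · rw [hlaw]
    apply hk
    rw [mem_uIcc] at hj ⊢
    rcases he with rfl | rfl <;> omega

lemma sameGap_trans (hL : LineAction L) {n : ℕ} {x y z : X} (h : SameGap L B n x y)
    (h' : SameGap L B n y z) : SameGap L B n x z := by
  obtain ⟨k, rfl, hk⟩ := h
  obtain ⟨m, rfl, hm⟩ := h'
  obtain ⟨e, he, hlaw⟩ := hL.law k x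
  refine ⟨_, hlaw m, fun j hj => ?_⟩
  by_cases hjk : j ∈ uIcc 0 k
  · exact hk j hjk
  · have := hm (e * (j - k)) (by
      rw [mem_uIcc] at hj hjk ⊢
      rcases he with rfl | rfl <;> omega)
    rwa [hlaw, show k + e * (e * (j - k)) = j by rcases he with rfl | rfl <;> ring] at this

lemma approx_equivalence (hL : LineAction L) (n : ℕ) : Equivalence (approx L B n) where
  refl _ := Or.inl rfl
  symm := by
    rintro x y (rfl | ⟨hx, ⟨k, rfl⟩, h1, h2⟩ | ⟨hx, h⟩)
    · exact Or.inl rfl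
    · obtain ⟨i, hi⟩ := hL.exists_back k x
      exact Or.inr (Or.inl ⟨(hL.mem_smoothPart_iff _ _).2 hx, ⟨i, hi.symm⟩, h2, h1⟩)
    · refine Or.inr (Or.inr ⟨?_, hL.sameGap_symm h⟩)
      obtain ⟨k, rfl, -⟩ := h
      rwa [hL.mem_smoothPart_iff]
  trans := by
    rintro x y z (rfl | ⟨hx, ⟨k, rfl⟩, h1, h2⟩ | ⟨hx, h⟩) h'
    · exact h'
    · rcases h' with rfl | ⟨hy, ⟨i, rfl⟩, h3, h4⟩ | ⟨hy, h'⟩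
      · exact Or.inr (Or.inl ⟨hx, ⟨k, rfl⟩, h1, h2⟩)
      · exact Or.inr (Or.inl ⟨hx, hL.exists_comp _ _ _, h1, h4⟩)
      · exact absurd ((hL.mem_smoothPart_iff _ _).2 hx) hy
    · rcases h' with rfl | ⟨hy, ⟨i, rfl⟩, h3, h4⟩ | ⟨hy, h'⟩
      · exact Or.inr (Or.inr ⟨hx, h⟩)
      · obtain ⟨k, rfl, -⟩ := h
        exact absurd ((hL.mem_smoothPart_iff _ _).1 hy) hx
      · exact Or.inr (Or.inr ⟨hx, hL.sameGap_trans h h'⟩)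

lemma finite_approx (hL : LineAction L) (hB : ∀ x y, (∀ n, x ∈ B n ↔ y ∈ B n) → x = y)
    (n : ℕ) (x : X) : {y | approx L B n x y}.Finite := by
  by_cases hx : x ∈ smoothPart L B
  · have h1 := (hL.finite_kernel hB x).image2 (fun y (k : ℤ) => L k y)
      (finite_Icc (-(n : ℤ)) n)
    refine ((finite_singleton x).union h1).subset ?_
    rintro y (rfl | ⟨-, ⟨k, rfl⟩, -, i, hi, hiy⟩ | ⟨hx', -⟩)
    · exact Or.inl rfl
    · right
      obtain ⟨e, he, hlaw⟩ := hL.law i (L k x)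
      refine ⟨_, ⟨hL.exists_comp _ _ _, hiy⟩, -(e * i), ?_, ?_⟩
      · rw [abs_le] at hi
        rw [mem_Icc]
        rcases he with rfl | rfl <;> omega
      · change L (-(e * i)) (L i (L k x)) = L k x
        rw [hlaw, show i + e * -(e * i) = 0 by rcases he with rfl | rfl <;> ring, hL.zero]
    · exact absurd hx hx'
  · obtain ⟨a, ha, ha'⟩ := hL.exists_mem_sect_of_notMem 1 (Or.inl rfl) hx n
    obtain ⟨b, hb, hb'⟩ := hL.exists_mem_sect_of_notMem (-1) (Or.inr rfl) hx n
    refine ((finite_singleton x).union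
      ((finite_Icc (-b) a).image fun k : ℤ => L k x)).subset ?_
    rintro y (rfl | ⟨hx', -⟩ | ⟨-, k, rfl, hk⟩)
    · exact Or.inl rfl
    · exact absurd hx' hx
    · refine Or.inr ⟨k, ?_, rfl⟩
      rw [mem_Icc]
      constructor
      · by_contra h
        exact hk (-b) (by rw [mem_uIcc]; omega) (by simpa using hb')
      · by_contra h
        exact hk a (by rw [mem_uIcc]; omega) (by simpa using ha')

omit [MeasurableSpace X] in
lemma approx_mono {n : ℕ} {x y : X} (h : approx L B n x y) : approx L B (n + 1) x y := by
  rcases h with rfl | ⟨hx, hk, ⟨i, hi, hi'⟩, ⟨j, hj, hj'⟩⟩ | ⟨hx, k, rfl, hk⟩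
  · exact Or.inl rfl
  · refine Or.inr (Or.inl ⟨hx, hk, ⟨i, hi.trans ?_, hi'⟩, ⟨j, hj.trans ?_, hj'⟩⟩) <;> simp
  · exact Or.inr (Or.inr ⟨hx, k, rfl, fun j hj h => hk j hj (sect_antitone n.le_succ h)⟩)

lemma exists_approx_iff (hL : LineAction L) (x y : X) :
    (∃ k, y = L k x) ↔ ∃ n, approx L B n x y := by
  constructor
  · rintro ⟨k, rfl⟩
    by_cases hx : x ∈ smoothPart L B
    · obtain ⟨i, hi⟩ := id hx
      obtain ⟨j, hj⟩ := (hL.mem_smoothPart_iff k x).2 hx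
      exact ⟨i.natAbs ⊔ j.natAbs, Or.inr (Or.inl ⟨hx, ⟨k, rfl⟩, ⟨i,
        by rw [Int.abs_eq_natAbs]; omega, hi⟩,
        ⟨j, by rw [Int.abs_eq_natAbs]; omega, hj⟩⟩)⟩
    · have : ∀ j ∈ uIcc 0 k, ∀ᶠ n in atTop, L j x ∉ sect L B n := by
        intro j _
        obtain ⟨n, hn⟩ : ∃ n, L j x ∉ sect L B n := by
          by_contra! h
          exact hx ⟨j, Or.inl h⟩
        filter_upwards [eventually_ge_atTop n] with m hm h
        exact hn (sect_antitone hm h)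
      obtain ⟨n, hn⟩ := ((eventually_all_finite (finite_uIcc 0 k)).2 this).exists
      exact ⟨n, Or.inr (Or.inr ⟨hx, k, rfl, hn⟩)⟩
  · rintro ⟨n, rfl | ⟨-, hk, -⟩ | ⟨-, k, rfl, -⟩⟩
    · exact ⟨0, (hL.zero _).symm⟩
    · exact hk
    · exact ⟨k, rfl⟩

section Measurability
variable (hL : LineAction L) (hBm : ∀ n, MeasurableSet (B n))
include hL hBm

lemma measurableSet_sect (n : ℕ) : MeasurableSet (sect L B n) := by
  induction n with
  | zero => exact MeasurableSet.univ
  | succ n ih =>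
    have h1 : MeasurableSet {x | ∃ k, L k x ∈ sect L B n ∩ B n} := by
      simp only [ofPred_exists]
      exact MeasurableSet.iUnion fun k => hL.measurable k (ih.inter (hBm n))
    exact ih.inter ((hBm n).iff h1)

lemma measurableSet_extremal (n : ℕ) : MeasurableSet (extremal L B n) := by
  have h := hL.measurableSet_sect hBm n
  have h' : ∀ j, MeasurableSet {y | L j y ∉ sect L B n} := fun j => hL.measurable j h.compl
  refine h.inter (MeasurableSet.union ?_ ?_)
  · exact measurableSet_forall fun j => measurableSet_forall fun _ => h' j
  · exact measurableSet_forall fun j => measurableSet_forall fun _ => h' j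

lemma measurableSet_kernel : MeasurableSet (kernel L B) := by
  have h := hL.measurableSet_extremal hBm
  refine MeasurableSet.union (measurableSet_forall fun n => hL.measurableSet_sect hBm n)
    (measurableSet_exists fun n => (h n).inter (measurableSet_forall fun m =>
      measurableSet_forall fun _ => measurableSet_forall fun k => hL.measurable k (h m).compl))

lemma measurableSet_approx (hB : ∀ x y, (∀ n, x ∈ B n ↔ y ∈ B n) → x = y) (n : ℕ) :
    MeasurableSet {p : X × X | approx L B n p.1 p.2} := by
  have hK := hL.measurableSet_kernel hBm
  have hS : MeasurableSet (smoothPart L B) := measurableSet_exists fun k => hL.measurable k hK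
  have hN : MeasurableSet (nearKernel L B n) :=
    measurableSet_exists fun k => (MeasurableSet.const _).inter (hL.measurable k hK)
  have hG : ∀ k, MeasurableSet {p : X × X | p.2 = L k p.1} := by
    intro k
    have : {p : X × X | p.2 = L k p.1} = {p : X × X | ∀ n, p.2 ∈ B n ↔ L k p.1 ∈ B n} := by
      ext p
      exact ⟨fun h n => by rw [show p.2 = L k p.1 from h], fun h => hB _ _ h⟩
    rw [this]
    exact measurableSet_forall fun n => (measurable_snd (hBm n)).iff
      (((hL.measurable k).comp measurable_fst) (hBm n))
  have hD : MeasurableSet {p : X × X | p.1 = p.2} := by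
    convert hG 0 using 3 with p
    rw [hL.zero, eq_comm]
  refine hD.union (MeasurableSet.union ?_ ?_)
  · exact (measurable_fst hS).inter ((measurableSet_exists hG).inter
      ((measurable_fst hN).inter (measurable_snd hN)))
  · refine (measurable_fst hS).compl.inter (measurableSet_exists fun k => (hG k).inter
      (measurableSet_forall fun j => measurableSet_forall fun _ => ?_))
    exact ((hL.measurable j).comp measurable_fst) (hL.measurableSet_sect hBm n).compl

end Measurability

/-- The orbit relation of a line action is hyperfinite. -/
theorem isHyperfinite [MeasurableSpace.CountablySeparated X] (hL : LineAction L) :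
    IsHyperfinite fun x y => ∃ k, y = L k x := by
  obtain ⟨B, hBm, hB⟩ := exists_seq_separating X MeasurableSet.empty univ
  have hB' : ∀ x y, (∀ n, x ∈ B n ↔ y ∈ B n) → x = y := fun x y h =>
    hB x (mem_univ _) y (mem_univ _) h
  exact ⟨approx L B, fun n => ⟨⟨hL.approx_equivalence n, hL.measurableSet_approx hBm hB' n⟩,
    hL.finite_approx hB' n⟩, fun n x y => approx_mono, hL.exists_approx_iff⟩

end LineAction

section
variable {X : Type}

lemma mul_zpow_of_involutions {a b : Equiv.Perm X} (ha : a * a = 1) (hb : b * b = 1) (k : ℤ) :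
    (b * a) ^ k * a = a * (b * a) ^ (-k) := by
  have h : a * (b * a) * a⁻¹ = (b * a)⁻¹ := by
    rw [mul_inv_rev, inv_eq_of_mul_eq_one_left hb, mul_assoc, mul_assoc, mul_inv_cancel, mul_one,
      inv_eq_of_mul_eq_one_left ha]
  have h' := congrArg (· ^ (-k)) h
  simp only [conj_zpow, inv_zpow', neg_neg] at h'
  rw [← h', inv_mul_cancel_right]

variable [MeasurableSpace X]

lemma measurable_perm_zpow {T : Equiv.Perm X} (hT : Measurable T)
    (hT' : Measurable (T⁻¹ : Equiv.Perm X)) (k : ℤ) : Measurable (T ^ k : Equiv.Perm X) := by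
  have key : ∀ {S : Equiv.Perm X}, Measurable S → ∀ n : ℕ, Measurable (S ^ n : Equiv.Perm X) := by
    intro S hS n
    induction n with
    | zero => exact measurable_id
    | succ n ih => rw [pow_succ]; exact ih.comp hS
  obtain ⟨n, rfl | rfl⟩ := k.eq_nat_or_neg
  · rw [zpow_natCast]; exact key hT n
  · rw [zpow_neg, zpow_natCast, ← inv_pow]; exact key hT' n

/-- The walk along the orbit of a point under two involutions. -/
def dihedralWalk (a b : Equiv.Perm X) (k : ℤ) : X → X :=
  if Even k then ((b * a) ^ (k / 2) : Equiv.Perm X) else (a * (b * a) ^ (k / 2) : Equiv.Perm X)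

lemma lineAction_dihedralWalk {a b : Equiv.Perm X} (ha : a * a = 1) (hb : b * b = 1)
    (hma : Measurable a) (hmb : Measurable b) : LineAction (dihedralWalk a b) where
  measurable k := by
    have h1 : Measurable (b * a : Equiv.Perm X) := hmb.comp hma
    have h2 : Measurable ((b * a)⁻¹ : Equiv.Perm X) := by
      rw [mul_inv_rev, inv_eq_of_mul_eq_one_left hb, inv_eq_of_mul_eq_one_left ha]
      exact hma.comp hmb
    have h3 := measurable_perm_zpow h1 h2 (k / 2)
    unfold dihedralWalk
    split_ifs
    · exact h3
    · exact hma.comp h3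
  zero x := by simp [dihedralWalk]
  law m x := by
    by_cases hm : Even m
    · refine ⟨1, Or.inl rfl, fun k => ?_⟩
      obtain ⟨i, rfl⟩ := hm
      have h : (i + i + 1 * k) / 2 = k / 2 + (i + i) / 2 := by omega
      by_cases hk : Even k
      · have : Even (i + i + 1 * k) := by simp [hk, Int.even_add]
        simp only [dihedralWalk, Even.add_self, if_true, hk, this, h, zpow_add,
          Equiv.Perm.mul_apply]
      · have : ¬ Even (i + i + 1 * k) := by simpa [Int.even_add] using hk
        simp only [dihedralWalk, Even.add_self, if_true, hk, this, h, zpow_add,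
          Equiv.Perm.mul_apply, if_false]
    · refine ⟨-1, Or.inr rfl, fun k => ?_⟩
      obtain ⟨i, rfl⟩ := Int.not_even_iff_odd.1 hm
      by_cases hk : Even k
      · have h' : ¬ Even (2 * i + 1 + -1 * k) := by
          simp [Int.even_add, hk]
        have h : (2 * i + 1 + -1 * k) / 2 = -(k / 2) + (2 * i + 1) / 2 := by
          obtain ⟨j, rfl⟩ := hk; omega
        simp only [dihedralWalk, hm, hk, h', if_true, if_false, ← Equiv.Perm.mul_apply, h, zpow_add]
        rw [← mul_assoc, ← mul_assoc, mul_zpow_of_involutions ha hb]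
      · have h' : Even (2 * i + 1 + -1 * k) := by
          simp [Int.even_add, hk]
        have h : (2 * i + 1 + -1 * k) / 2 = -(k / 2) + (2 * i + 1) / 2 := by
          obtain ⟨j, rfl⟩ := Int.not_even_iff_odd.1 hk; omega
        simp only [dihedralWalk, hm, hk, h', if_true, if_false, ← Equiv.Perm.mul_apply, h, zpow_add]
        rw [mul_assoc, ← mul_assoc _ a, mul_zpow_of_involutions ha hb, ← mul_assoc, ← mul_assoc,
          ha, one_mul]

/-- The equivalence relation generated by two measurable involutions is hyperfinite. -/
theorem isHyperfinite_of_involutive [MeasurableSpace.CountablySeparated X] {r l : X → X}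
    (hr : Function.Involutive r) (hl : Function.Involutive l) (hmr : Measurable r)
    (hml : Measurable l) :
    IsHyperfinite (Relation.ReflTransGen fun x y => y = r x ∨ y = l x) := by
  set a : Equiv.Perm X := hr.toPerm with ha_def
  set b : Equiv.Perm X := hl.toPerm with hb_def
  have ha : a * a = 1 := by ext x; exact hr x
  have hb : b * b = 1 := by ext x; exact hl x
  have hL := lineAction_dihedralWalk ha hb hmr hml
  convert hL.isHyperfinite using 3 with x y
  constructor
  · intro h
    induction h with
    | refl => exact ⟨0, (hL.zero x).symm⟩
    | tail _ h ih =>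
      obtain ⟨k, rfl⟩ := ih
      rcases h with rfl | rfl
      · obtain ⟨i, hi⟩ := hL.exists_comp 1 k x
        exact ⟨i, by rw [← hi]; simp [dihedralWalk, a]⟩
      · obtain ⟨i, hi⟩ := hL.exists_comp (-1) k x
        refine ⟨i, ?_⟩
        rw [← hi]
        have h1 : ((-1 : ℤ) / 2) = -1 := by norm_num
        have h2 : a * (b * a)⁻¹ = b := by
          rw [mul_inv_rev, mul_inv_cancel_left, inv_eq_of_mul_eq_one_left hb]
        change b _ = _
        simp [dihedralWalk, h1, -mul_inv_rev, h2]
  · rintro ⟨k, rfl⟩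
    have hA : ∀ x, Relation.ReflTransGen (fun x y => y = r x ∨ y = l x) x (a x) := fun x =>
      .single (Or.inl rfl)
    have hB : ∀ x, Relation.ReflTransGen (fun x y => y = r x ∨ y = l x) x (b x) := fun x =>
      .single (Or.inr rfl)
    have hT : ∀ k : ℤ, ∀ x, Relation.ReflTransGen (fun x y => y = r x ∨ y = l x) x
        (((b * a) ^ k : Equiv.Perm X) x) := by
      intro k
      induction k with
      | zero => exact fun x => .refl
      | succ k ih => 
        intro x
        rw [zpow_add_one, Equiv.Perm.mul_apply]
        exact ((hA x).trans (hB _)).trans (ih _)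
      | pred k ih =>
        intro x
        rw [zpow_sub_one, Equiv.Perm.mul_apply, mul_inv_rev, inv_eq_of_mul_eq_one_left hb,
          inv_eq_of_mul_eq_one_left ha]
        exact ((hB x).trans (hA _)).trans (ih _)
    unfold dihedralWalk
    split_ifs
    · exact hT _ x
    · exact (hT _ x).trans (hA _)
end

noncomputable instance : MeasurableSpace C(unitInterval, ℝ × ℝ) := borel _

instance : BorelSpace C(unitInterval, ℝ × ℝ) := ⟨rfl⟩

section Curves
open TopologicalSpace

lemma measurable_eval (t : 𝕀) : Measurable fun f : C(𝕀, ℝ × ℝ) => f t :=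
  (continuous_eval_const t).measurable

lemma polishSpace_curves {Y : Type*} [TopologicalSpace Y] [PolishSpace Y] :
    PolishSpace C(𝕀, Y) := by
  let := upgradeIsCompletelyMetrizable Y
  infer_instance

/-- The curves that stay in a Polish subspace form a Borel set. -/
lemma measurableSet_curves_mem {H : Set (ℝ × ℝ)} (hH : PolishSpace H) :
    MeasurableSet {f : C(𝕀, ℝ × ℝ) | ∀ t, f t ∈ H} := by
  have := polishSpace_curves (Y := H)
  let i : C(𝕀, H) → C(𝕀, ℝ × ℝ) := fun f => ContinuousMap.comp ⟨Subtype.val, by fun_prop⟩ f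
  have hi : Continuous i := ContinuousMap.continuous_postcomp _
  have hinj : Function.Injective i := by
    intro f g h
    ext1 t
    exact Subtype.ext (DFunLike.congr_fun h t)
  convert MeasureTheory.measurableSet_range_of_continuous_injective hi hinj using 1
  ext f
  constructor
  · intro hf
    exact ⟨⟨fun t => ⟨f t, hf t⟩, by fun_prop⟩, rfl⟩
  · rintro ⟨g, rfl⟩ t
    exact (g t).2

lemma measurableSet_curves_mapsTo {D : Set 𝕀} (hD : IsOpen D) {U : Set (ℝ × ℝ)} (hU : IsOpen U) :
    MeasurableSet {f : C(𝕀, ℝ × ℝ) | ∀ t ∈ D, f t ∈ U} := by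
  obtain ⟨F, hF, -, hFD, -⟩ := hD.exists_iUnion_isClosed
  have : {f : C(𝕀, ℝ × ℝ) | ∀ t ∈ D, f t ∈ U} = {f : C(𝕀, ℝ × ℝ) | ∀ n, MapsTo f (F n) U} := by
    ext f
    rw [← hFD]
    constructor
    · exact fun h n t ht => h t (mem_iUnion.2 ⟨n, ht⟩)
    · intro h t ht
      obtain ⟨n, hn⟩ := mem_iUnion.1 ht
      exact h n hn
  rw [this]
  exact measurableSet_forall fun n =>
    (ContinuousMap.isOpen_setOfPred_mapsTo (hF n).isCompact hU).measurableSet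

lemma measurableSet_curves_injective :
    MeasurableSet {f : C(𝕀, ℝ × ℝ) | Function.Injective f} := by
  have key : ∀ f : C(𝕀, ℝ × ℝ), Function.Injective f ↔ ∀ n : ℕ, ∃ m : ℕ,
      ∀ i j, 1 / (n + 1 : ℝ) < dist (denseSeq 𝕀 i) (denseSeq 𝕀 j) →
        1 / (m + 1 : ℝ) < dist (f (denseSeq 𝕀 i)) (f (denseSeq 𝕀 j)) := by
    intro f
    constructor
    · intro hf n
      have hK : IsCompact {p : 𝕀 × 𝕀 | 1 / (n + 1 : ℝ) ≤ dist p.1 p.2} :=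
        (isClosed_le continuous_const continuous_dist).isCompact
      have hc : Continuous fun p : 𝕀 × 𝕀 => dist (f p.1) (f p.2) := by fun_prop
      rcases Set.eq_empty_or_nonempty {p : 𝕀 × 𝕀 | 1 / (n + 1 : ℝ) ≤ dist p.1 p.2} with he | hne
      · refine ⟨0, fun i j h => ?_⟩
        have : (denseSeq 𝕀 i, denseSeq 𝕀 j) ∈ {p : 𝕀 × 𝕀 | 1 / (n + 1 : ℝ) ≤ dist p.1 p.2} := h.le
        rw [he] at this
        exact this.elim
      · obtain ⟨p, hp, hmin⟩ := hK.exists_isMinOn hne hc.continuousOn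
        have hp' : 1 / (n + 1 : ℝ) ≤ dist p.1 p.2 := hp
        have h0 : 0 < dist (f p.1) (f p.2) := by
          rw [dist_pos]
          intro h
          have h1 : (0 : ℝ) < 1 / (n + 1 : ℝ) := by positivity
          rw [hf h, dist_self] at hp'
          linarith
        obtain ⟨m, hm⟩ := exists_nat_one_div_lt h0
        exact ⟨m, fun i j h => hm.trans_le (hmin (show (denseSeq 𝕀 i, denseSeq 𝕀 j) ∈ _ from h.le))⟩
    · intro h s t hst
      by_contra hne
      obtain ⟨n, hn⟩ := exists_nat_one_div_lt (dist_pos.2 hne)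
      obtain ⟨m, hm⟩ := h n
      have hU : IsOpen {p : 𝕀 × 𝕀 | 1 / (n + 1 : ℝ) < dist p.1 p.2 ∧
          dist (f p.1) (f p.2) < 1 / (m + 1 : ℝ)} :=
        (isOpen_lt continuous_const continuous_dist).inter
          (isOpen_lt (by fun_prop :
            Continuous fun p : 𝕀 × 𝕀 => dist (f p.1) (f p.2)) continuous_const)
      have hd := (denseRange_denseSeq 𝕀).prodMap (denseRange_denseSeq 𝕀)
      obtain ⟨⟨i, j⟩, hij, hij'⟩ := hd.exists_mem_open hU ⟨(s, t), hn, by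
        simp only [hst, dist_self]; positivity⟩
      exact (hm i j hij).not_gt hij'
  simp only [key]
  refine measurableSet_forall fun n => measurableSet_exists fun m => measurableSet_forall fun i =>
    measurableSet_forall fun j => measurableSet_forall fun _ => ?_
  exact measurableSet_lt measurable_const ((measurable_eval _).dist (measurable_eval _))

lemma measurableSet_canonArcs : MeasurableSet canonArcs :=
  measurableSet_curves_injective.inter isClosed_setOf_canon.measurableSet

lemma measurableSet_isCross (c d σ : ℝ) : MeasurableSet {f : C(𝕀, ℝ × ℝ) | IsCross c d σ f} := by
  have hD : IsOpen {t : 𝕀 | t ≠ 0 ∧ t ≠ 1} := isOpen_ne.inter isOpen_ne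
  have h : {f : C(𝕀, ℝ × ℝ) | IsCross c d σ f} = {f : C(𝕀, ℝ × ℝ) | Function.Injective f} ∩
      ({f | (f 0).1 = c} ∩ ({f | (f 1).1 = d} ∩
      ({f | ∀ t ∈ {t : 𝕀 | t ≠ 0 ∧ t ≠ 1}, f t ∈ side c σ} ∩
        {f | ∀ t ∈ {t : 𝕀 | t ≠ 0 ∧ t ≠ 1}, f t ∈ side d (-σ)}))) := by
    ext f
    exact ⟨fun h => ⟨h.inj, h.left, h.right, fun t ht => h.mem_left t ht.1 ht.2,
      fun t ht => h.mem_right t ht.1 ht.2⟩, fun ⟨h1, h2, h3, h4, h5⟩ => ⟨h1, h2, h3,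
      fun t h h' => h4 t ⟨h, h'⟩, fun t h h' => h5 t ⟨h, h'⟩⟩⟩
  rw [h]
  refine measurableSet_curves_injective.inter (MeasurableSet.inter ?_ (MeasurableSet.inter ?_
    ((measurableSet_curves_mapsTo hD (isOpen_side _ _)).inter
      (measurableSet_curves_mapsTo hD (isOpen_side _ _)))))
  · exact measurableSet_eq_fun (measurable_eval 0).fst measurable_const
  · exact measurableSet_eq_fun (measurable_eval 1).fst measurable_const

/-- The range of a curve. -/
def trace (f : C(𝕀, ℝ × ℝ)) : NonemptyCompacts (ℝ × ℝ) :=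
  (⊤ : NonemptyCompacts 𝕀).map f f.continuous

@[simp] lemma coe_trace (f : C(𝕀, ℝ × ℝ)) : (trace f : Set (ℝ × ℝ)) = range f := by
  simp [trace]

lemma measurable_trace : Measurable trace := by
  have : Continuous trace := by
    unfold trace
    exact Continuous.nonemptyCompacts_map' continuous_const (by
      change Continuous fun p : C(𝕀, ℝ × ℝ) × 𝕀 => p.1 p.2
      fun_prop)
  exact this.measurable

lemma measurableSet_subset : MeasurableSet
    {p : NonemptyCompacts (ℝ × ℝ) × NonemptyCompacts (ℝ × ℝ) | (p.1 : Set (ℝ × ℝ)) ⊆ p.2} := by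
  have h : {p : NonemptyCompacts (ℝ × ℝ) × NonemptyCompacts (ℝ × ℝ) |
      (p.1 : Set (ℝ × ℝ)) ⊆ p.2} =
      {p | ∀ z, infDist z (p.2 : Set (ℝ × ℝ)) ≤ infDist z (p.1 : Set (ℝ × ℝ))} := by
    ext p
    constructor
    · exact fun h z => infDist_le_infDist_of_subset h p.1.nonempty
    · intro h z hz
      rw [p.2.isCompact.isClosed.mem_iff_infDist_zero p.2.nonempty]
      have := h z
      rw [infDist_zero_of_mem hz] at this
      exact le_antisymm this infDist_nonneg
  rw [h, ofPred_forall]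
  refine (isClosed_iInter fun z => isClosed_le ?_ ?_).measurableSet
  · exact (lipschitz_infDist_set z).continuous.comp continuous_snd
  · exact (lipschitz_infDist_set z).continuous.comp continuous_fst

end Curves

section Extension
open TopologicalSpace

variable {X : Type*} [MeasurableSpace X]

/-- The trace on `S` of a measurable set contains every subset of `S` that is convex with respect
to a measurable function that is injective on `S`. -/
lemma exists_measurableSet_inter_eq {S T : Set X} {u : X → ℝ} (hu : Measurable u)
    (hS : InjOn u S) (hTS : T ⊆ S)
    (hT : ∀ x ∈ T, ∀ y ∈ S, ∀ z ∈ T, u x < u y → u y < u z → y ∈ T) :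
    ∃ M, MeasurableSet M ∧ ∀ x ∈ S, x ∈ M ↔ x ∈ T := by
  let I : Set ℝ := {r | ∃ x ∈ T, ∃ z ∈ T, u x ≤ r ∧ r ≤ u z}
  have hI : I.OrdConnected := by
    refine ⟨?_⟩
    rintro r ⟨x, hx, -, -, hxr, -⟩ s ⟨-, -, z, hz, -, hsz⟩ t ht
    exact ⟨x, hx, z, hz, hxr.trans ht.1, ht.2.trans hsz⟩
  refine ⟨u ⁻¹' I, hu hI.measurableSet, fun y hy => ⟨?_, fun h => ⟨y, h, y, h, le_rfl, le_rfl⟩⟩⟩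
  rintro ⟨x, hx, z, hz, hxy, hyz⟩
  rcases hxy.eq_or_lt with h | h
  · rwa [← hS (hTS hx) hy h]
  rcases hyz.eq_or_lt with h' | h'
  · rwa [hS hy (hTS hz) h']
  exact hT x hx y hy z hz h h'

lemma measurable_infDist_range (z : ℝ × ℝ) :
    Measurable fun f : C(𝕀, ℝ × ℝ) => infDist z (range f) := by
  have h := (lipschitz_infDist_set z).continuous.measurable.comp measurable_trace
  simpa only [Function.comp_def, coe_trace] using h

/-- The distances to a dense sequence of points, and the initial point, of a curve. -/
noncomputable def curveCode (f : canonArcs) : (ℕ → ℝ) × (ℝ × ℝ) :=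
  (fun i => infDist (denseSeq (ℝ × ℝ) i) (range f.1), f.1 0)

lemma measurableEmbedding_curveCode : MeasurableEmbedding curveCode := by
  have := polishSpace_curves (Y := ℝ × ℝ)
  have : StandardBorelSpace canonArcs := measurableSet_canonArcs.standardBorel
  refine Measurable.measurableEmbedding ?_ ?_
  · refine Measurable.prodMk (measurable_pi_lambda _ fun i => ?_) ?_
    · exact (measurable_infDist_range _).comp measurable_subtype_coe
    · exact (measurable_eval 0).comp measurable_subtype_coe
  · intro f g h
    have h1 : ∀ z, infDist z (range f.1) = infDist z (range g.1) := by
      refine congrFun (Continuous.ext_on (denseRange_denseSeq (ℝ × ℝ)) (continuous_infDist_pt _)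
        (continuous_infDist_pt _) ?_)
      rintro _ ⟨i, rfl⟩
      exact congrFun (congrArg Prod.fst h) i
    have h2 : range f.1 = range g.1 := by
      ext z
      rw [(isCompact_range f.1.continuous).isClosed.mem_iff_infDist_zero (range_nonempty _), h1,
        (isCompact_range g.1.continuous).isClosed.mem_iff_infDist_zero (range_nonempty _)]
    exact Subtype.ext (canonArcs_ext f.2 g.2 h2 (congrArg Prod.snd h))

/-- A family of canonical arcs whose hitting sets of convex sets are convex with respect to a
measurable function extends to a measurable family. -/
theorem exists_measurable_extension {S : Set X} {f : X → C(𝕀, ℝ × ℝ)} {u : X → ℝ} {g : X → ℝ × ℝ}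
    (hu : Measurable u) (hS : InjOn u S) (hg : Measurable g) (hf : ∀ x ∈ S, f x ∈ canonArcs)
    (h0 : ∀ x ∈ S, f x 0 = g x)
    (hconv : ∀ κ : Set (ℝ × ℝ), Convex ℝ κ → ∀ x ∈ S, ∀ y ∈ S, ∀ z ∈ S, u x < u y → u y < u z →
      (range (f x) ∩ κ).Nonempty → (range (f z) ∩ κ).Nonempty → (range (f y) ∩ κ).Nonempty) :
    ∃ F : X → C(𝕀, ℝ × ℝ), Measurable F ∧ EqOn F f S := by
  have := polishSpace_curves (Y := ℝ × ℝ)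
  let f' : S → canonArcs := fun x => ⟨f x, hf x x.2⟩
  have hf' : Measurable f' := by
    rw [← measurableEmbedding_curveCode.measurable_comp_iff]
    refine Measurable.prodMk (measurable_pi_lambda _ fun i => ?_) ?_
    · refine measurable_of_Iio fun r => ?_
      obtain ⟨M, hM, hMS⟩ := exists_measurableSet_inter_eq
        (T := {x | x ∈ S ∧ (range (f x) ∩ ball (denseSeq (ℝ × ℝ) i) r).Nonempty}) hu hS
        (fun x hx => hx.1) (fun x hx y hy z hz h h' => ⟨hy, hconv _ (convex_ball _ _) x hx.1 y hy
          z hz.1 h h' hx.2 hz.2⟩)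
      refine ⟨M, hM, ?_⟩
      ext x
      refine (hMS x x.2).trans ?_
      change _ ↔ infDist _ (range (f x)) < r
      rw [infDist_lt_iff (range_nonempty _)]
      constructor
      · rintro ⟨-, y, hy, hy'⟩
        exact ⟨y, hy, by rwa [dist_comm]⟩
      · rintro ⟨y, hy, hy'⟩
        exact ⟨x.2, y, hy, by rwa [mem_ball, dist_comm]⟩
    · convert hg.comp measurable_subtype_coe using 1
      funext x
      exact h0 x x.2
  obtain ⟨F, hF, hFf⟩ := (measurable_subtype_coe.comp hf').exists_eq_measurable_comp
    (f := (Subtype.val : S → X))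
  exact ⟨F, hF, fun x hx => (congrFun hFf ⟨x, hx⟩).symm⟩

end Extension

section Hits
variable {c d σ : ℝ} {f₁ f₂ f₃ : C(𝕀, ℝ × ℝ)} {κ : Set (ℝ × ℝ)}

lemma joinedIn_range (f : C(𝕀, ℝ × ℝ)) (s t : 𝕀) : JoinedIn (range f) (f s) (f t) :=
  joinedIn_arc fun x _ => mem_range_self x

lemma JoinedIn.of_hits (hκ : Convex ℝ κ) (h₁ : (range f₁ ∩ κ).Nonempty)
    (h₃ : (range f₃ ∩ κ).Nonempty) {Z : Set (ℝ × ℝ)} (hZ : Convex ℝ Z) (h₁Z : range f₁ ⊆ Z)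
    (h₃Z : range f₃ ⊆ Z) :
    JoinedIn ((range f₁ ∪ range f₃ ∪ κ) ∩ Z) (f₁ 0) (f₃ 0) := by
  obtain ⟨_, ⟨s, rfl⟩, hs⟩ := h₁
  obtain ⟨_, ⟨t, rfl⟩, ht⟩ := h₃
  refine (((joinedIn_range f₁ 0 s).mono ?_).trans (JoinedIn.of_segment_subset ?_)).trans
    ((joinedIn_range f₃ t 0).mono ?_)
  · exact fun z hz => ⟨Or.inl (Or.inl hz), h₁Z hz⟩
  · exact fun z hz => ⟨Or.inr (hκ.segment_subset hs ht hz),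
      hZ.segment_subset (h₁Z ⟨s, rfl⟩) (h₃Z ⟨t, rfl⟩) hz⟩
  · exact fun z hz => ⟨Or.inl (Or.inr hz), h₃Z hz⟩

lemma convex_closedSide (c σ : ℝ) : Convex ℝ {z : ℝ × ℝ | 0 ≤ σ * (z.1 - c)} := by
  intro x hx y hy a b ha hb hab
  rw [mem_ofPred_eq] at *
  have : σ * ((a • x + b • y).1 - c) = a * (σ * (x.1 - c)) + b * (σ * (y.1 - c)) := by
    simp only [Prod.fst_add, Prod.smul_fst, smul_eq_mul]
    linear_combination σ * c * hab
  rw [this]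
  positivity

lemma hit_of_union (hκ : (range f₁ ∩ κ).Nonempty → (range f₃ ∩ κ).Nonempty →
      (((range f₁ ∪ range f₃ ∪ κ)) ∩ range f₂).Nonempty)
    (h₁₂ : Disjoint (range f₁) (range f₂)) (h₂₃ : Disjoint (range f₂) (range f₃))
    (h₁ : (range f₁ ∩ κ).Nonempty) (h₃ : (range f₃ ∩ κ).Nonempty) : (range f₂ ∩ κ).Nonempty := by
  obtain ⟨z, (hz | hz) | hz, hz₂⟩ := hκ h₁ h₃
  · exact absurd hz₂ (h₁₂.notMem_of_mem_left hz)
  · exact absurd hz (h₂₃.notMem_of_mem_left hz₂)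
  · exact ⟨z, hz₂, hz⟩

lemma IsCross.subset_closedSide (hcd : 0 < σ * (d - c)) (h : IsCross c d σ f₁) :
    range f₁ ⊆ {z | 0 ≤ σ * (z.1 - c)} ∩ {z | 0 ≤ -σ * (z.1 - d)} := by
  rintro _ ⟨t, rfl⟩
  rw [mem_inter_iff, mem_ofPred_eq, mem_ofPred_eq]
  by_cases h0 : t = 0
  · subst h0
    rw [h.left]
    constructor <;> linarith
  by_cases h1 : t = 1
  · subst h1
    rw [h.right]
    constructor <;> linarith
  exact ⟨(h.mem_left t h0 h1).le, (h.mem_right t h0 h1).le⟩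

/-- Between two disjoint crossings that meet a convex set, every crossing meets it. -/
lemma hit_of_crossings (hcd : 0 < σ * (d - c)) (hf₁ : IsCross c d σ f₁) (hf₂ : IsCross c d σ f₂)
    (hf₃ : IsCross c d σ f₃) (h₁₂ : Disjoint (range f₁) (range f₂))
    (h₂₃ : Disjoint (range f₂) (range f₃)) (hκ : Convex ℝ κ) (h₁ : (range f₁ ∩ κ).Nonempty)
    (h₃ : (range f₃ ∩ κ).Nonempty) (hlt : (f₁ 0).2 < (f₂ 0).2) (hlt' : (f₂ 0).2 < (f₃ 0).2) :
    (range f₂ ∩ κ).Nonempty := by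
  refine hit_of_union (fun h₁ h₃ => ?_) h₁₂ h₂₃ h₁ h₃
  have hσ : σ ≠ 0 := by rintro rfl; simp at hcd
  have hJ := JoinedIn.of_hits hκ h₁ h₃
    ((convex_closedSide c σ).inter (convex_closedSide d (-σ))) (hf₁.subset_closedSide hcd)
    (hf₃.subset_closedSide hcd)
  obtain ⟨z, hz, hz'⟩ := strip_cross hσ (fun z hz => hz.2.1)
    (fun z hz => by have := hz.2.2; rw [mem_ofPred_eq] at *; linarith)
    (fun z hz => (hf₂.subset_closedSide hcd hz).1) hJ (joinedIn_range f₂ 0 1) hf₁.left hf₃.left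
    hf₂.left hf₂.right hlt hlt'
  exact ⟨z, hz.1, hz'⟩

/-- Between two disjoint arcs in a half plane with both endpoints on its boundary line that meet a
convex set, every nested arc of this kind meets it. -/
lemma hit_of_loops (hσ : σ ≠ 0) (hf₁ : range f₁ ⊆ {z | 0 ≤ σ * (z.1 - c)})
    (hf₂ : range f₂ ⊆ {z | 0 ≤ σ * (z.1 - c)}) (hf₃ : range f₃ ⊆ {z | 0 ≤ σ * (z.1 - c)})
    (h10 : (f₁ 0).1 = c) (h20 : (f₂ 0).1 = c) (h30 : (f₃ 0).1 = c) (h21 : (f₂ 1).1 = c)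
    (h₁₂ : Disjoint (range f₁) (range f₂))
    (h₂₃ : Disjoint (range f₂) (range f₃)) (hκ : Convex ℝ κ) (h₁ : (range f₁ ∩ κ).Nonempty)
    (h₃ : (range f₃ ∩ κ).Nonempty) (hlt : (f₁ 0).2 < (f₂ 0).2) (hlt' : (f₂ 0).2 < (f₃ 0).2)
    (hs : (f₃ 0).2 < (f₂ 1).2 ∨ (f₂ 1).2 < (f₁ 0).2) :
    (range f₂ ∩ κ).Nonempty := by
  refine hit_of_union (fun h₁ h₃ => ?_) h₁₂ h₂₃ h₁ h₃
  have hJ := JoinedIn.of_hits hκ h₁ h₃ (convex_closedSide c σ) hf₁ hf₃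
  rcases hs with hs | hs
  · obtain ⟨z, hz, hz'⟩ := half_cross hσ (fun z hz => hz.2) hf₂ hJ (joinedIn_range f₂ 0 1) h10 h30
      h20 h21 hlt hlt' hs
    exact ⟨z, hz.1, hz'⟩
  · obtain ⟨z, hz, hz'⟩ := half_cross hσ hf₂ (fun z hz => hz.2) (joinedIn_range f₂ 1 0) hJ h21 h20
      h10 h30 hs hlt hlt'
    exact ⟨z, hz'.1, hz⟩

/-- Disjoint arcs in a half plane with endpoints on its boundary line are nested. -/
lemma loops_antitone (hσ : σ ≠ 0) (hf₁ : range f₁ ⊆ {z | 0 ≤ σ * (z.1 - c)})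
    (hf₂ : range f₂ ⊆ {z | 0 ≤ σ * (z.1 - c)})
    (h10 : (f₁ 0).1 = c) (h20 : (f₂ 0).1 = c) (h11 : (f₁ 1).1 = c) (h21 : (f₂ 1).1 = c)
    (h₁₂ : Disjoint (range f₁) (range f₂)) (hlt : (f₁ 0).2 < (f₂ 0).2)
    (hs : (f₂ 0).2 < (f₁ 1).2 ∨ (f₂ 1).2 < (f₁ 0).2) : (f₂ 1).2 < (f₁ 1).2 := by
  by_contra! hle
  rcases hle.eq_or_lt with h | h
  · have : f₁ 1 = f₂ 1 := Prod.ext (h11.trans h21.symm) h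
    exact h₁₂.notMem_of_mem_left (mem_range_self 1) (this ▸ mem_range_self 1)
  rcases hs with hs | hs
  · obtain ⟨z, hz, hz'⟩ := half_cross hσ hf₁ hf₂ (joinedIn_range f₁ 0 1) (joinedIn_range f₂ 0 1)
      h10 h11 h20 h21 hlt hs h
    exact h₁₂.notMem_of_mem_left hz hz'
  · obtain ⟨z, hz, hz'⟩ := half_cross hσ hf₁ hf₂ (joinedIn_range f₁ 1 0) (joinedIn_range f₂ 1 0)
      h11 h10 h21 h20 h hs hlt
    exact h₁₂.notMem_of_mem_left hz hz'

end Hits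

section Foot
open TopologicalSpace
variable {c d σ : ℝ} {f g : C(𝕀, ℝ × ℝ)} {H : Set (ℝ × ℝ)}

/-- A point of `I` on the line `x = c`. -/
noncomputable def foot (c : ℝ) (I : NonemptyCompacts (ℝ × ℝ)) : ℝ × ℝ :=
  Classical.epsilon fun z => z ∈ (I : Set (ℝ × ℝ)) ∧ z.1 = c

lemma foot_eq {I : NonemptyCompacts (ℝ × ℝ)} {z : ℝ × ℝ} (hz : z ∈ (I : Set (ℝ × ℝ)))
    (hc : z.1 = c) (h : ∀ w ∈ (I : Set (ℝ × ℝ)), w.1 = c → w = z) : foot c I = z := by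
  have := Classical.epsilon_spec (p := fun z => z ∈ (I : Set (ℝ × ℝ)) ∧ z.1 = c) ⟨z, hz, hc⟩
  exact h _ this.1 this.2

lemma IsCross.foot_left (hf : IsCross c d σ f) (hcd : c ≠ d) : foot c (trace f) = f 0 := by
  refine foot_eq (by simp) hf.left fun w hw hwc => ?_
  rw [coe_trace] at hw
  obtain ⟨t, rfl⟩ := hw
  rw [hf.eq_zero hcd hwc]

lemma IsCross.foot_right (hf : IsCross c d σ f) (hcd : c ≠ d) : foot d (trace f) = f 1 := by
  refine foot_eq (by simp) hf.right fun w hw hwc => ?_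
  rw [coe_trace] at hw
  obtain ⟨t, rfl⟩ := hw
  rw [hf.eq_one hcd hwc]

lemma measurable_foot {𝒥 : Set (NonemptyCompacts (ℝ × ℝ))}
    (h : ∀ I ∈ 𝒥, ∃ z ∈ (I : Set (ℝ × ℝ)), z.1 = c ∧ ∀ w ∈ (I : Set (ℝ × ℝ)), w.1 = c → w = z) :
    Measurable fun I : 𝒥 => foot c I.1 := by
  refine measurable_of_isClosed fun C hC => ?_
  have : (fun I : 𝒥 => foot c I.1) ⁻¹' C = Subtype.val ⁻¹'
      {I : NonemptyCompacts (ℝ × ℝ) | ((I : Set (ℝ × ℝ)) ∩ (C ∩ {z | z.1 = c})).Nonempty} := by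
    ext I
    obtain ⟨z, hz, hzc, hu⟩ := h I.1 I.2
    rw [mem_preimage, foot_eq hz hzc hu]
    constructor
    · exact fun hC => ⟨z, hz, hC, hzc⟩
    · rintro ⟨w, hw, hwC, hwc⟩
      rwa [← hu w hw hwc]
  rw [this]
  exact measurable_subtype_coe (NonemptyCompacts.isClosed_inter_nonempty_of_isClosed
    (hC.inter (isClosed_eq continuous_fst continuous_const))).measurableSet

lemma exists_interior_eq (hinj : Function.Injective g) (h0 : g 0 = f 0) (h1 : g 1 = f 1)
    (hr : range g = range f) {t : 𝕀} (ht0 : t ≠ 0) (ht1 : t ≠ 1) :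
    ∃ s, s ≠ 0 ∧ s ≠ 1 ∧ g t = f s := by
  obtain ⟨s, hs⟩ : g t ∈ range f := hr ▸ mem_range_self t
  refine ⟨s, ?_, ?_, hs.symm⟩
  · rintro rfl
    exact ht0 (hinj (hs.symm.trans h0.symm))
  · rintro rfl
    exact ht1 (hinj (hs.symm.trans h1.symm))

lemma IsCross.of_range_eq (hf : IsCross c d σ f) (hinj : Function.Injective g) (h0 : g 0 = f 0)
    (h1 : g 1 = f 1) (hr : range g = range f) : IsCross c d σ g where
  inj := hinj
  left := h0 ▸ hf.left
  right := h1 ▸ hf.right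
  mem_left t ht0 ht1 := by
    obtain ⟨s, hs0, hs1, hs⟩ := exists_interior_eq hinj h0 h1 hr ht0 ht1
    exact hs ▸ hf.mem_left s hs0 hs1
  mem_right t ht0 ht1 := by
    obtain ⟨s, hs0, hs1, hs⟩ := exists_interior_eq hinj h0 h1 hr ht0 ht1
    exact hs ▸ hf.mem_right s hs0 hs1

lemma IsCross.exists_canonArc (hf : IsCross c d σ f) (fH : ∀ t, f t ∈ H) :
    ∃ g ∈ canonArcs, IsCross c d σ g ∧ (∀ t, g t ∈ H) ∧ trace g = trace f ∧ g 0 = f 0 ∧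
      g 1 = f 1 := by
  obtain ⟨g, hg, h0, h1, hr⟩ := exists_canonArc_of_injective f hf.inj
  refine ⟨g, hg, hf.of_range_eq hg.1 h0 h1 hr, fun t => ?_, ?_, h0, h1⟩
  · obtain ⟨s, hs⟩ : g t ∈ range f := hr ▸ mem_range_self t
    exact hs ▸ fH s
  · ext1
    simpa using hr

lemma disjoint_range_of_not_joinedIn (fH : ∀ t, f t ∈ H) (gH : ∀ t, g t ∈ H)
    (h : ¬ JoinedIn H (f 0) (g 0)) : Disjoint (range f) (range g) := by
  rw [Set.disjoint_left]
  rintro _ ⟨s, rfl⟩ ⟨t, ht⟩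
  refine h ((joinedIn_of_mem_arc fH 0 s).trans ?_)
  rw [← ht]
  exact joinedIn_of_mem_arc gH t 0

lemma measurable_revPath : Measurable (revPath) :=
  (ContinuousMap.continuous_precomp _).measurable

end Foot

section Partner
open TopologicalSpace
variable {c d σ : ℝ} {H : Set (ℝ × ℝ)} {𝒥 : Set (NonemptyCompacts (ℝ × ℝ))}

/-- `g` is a crossing, other than `I`, whose second end point is joined to that of `I` off the
line `x = c`, and that does not start where `I` starts without ending where `I` ends. -/
def IsPartner (H : Set (ℝ × ℝ)) (c d σ : ℝ) (I : NonemptyCompacts (ℝ × ℝ))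
    (g : C(𝕀, ℝ × ℝ)) : Prop :=
  IsCross c d σ g ∧ (∀ t, g t ∈ H) ∧ trace g ≠ I ∧
    JoinedIn (H ∩ side c σ) (foot d I) (g 1) ∧ (foot c I ≠ g 0 ∨ foot d I = g 1)

lemma IsPartner.congr {I : NonemptyCompacts (ℝ × ℝ)} {g g' : C(𝕀, ℝ × ℝ)}
    (h : IsPartner H c d σ I g) (hg : IsCross c d σ g') (gH : ∀ t, g' t ∈ H)
    (ht : trace g' = trace g) (h0 : g' 0 = g 0) (h1 : g' 1 = g 1) : IsPartner H c d σ I g' :=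
  ⟨hg, gH, ht ▸ h.2.2.1, h1 ▸ h.2.2.2.1, h0 ▸ h1 ▸ h.2.2.2.2⟩

lemma one_mem_side (hcd : 0 < σ * (d - c)) {z : ℝ × ℝ} (hz : z.1 = d) : z ∈ side c σ := by
  rw [mem_side, hz]
  exact hcd

variable (hcd : 0 < σ * (d - c))
  (h𝒥 : ∀ I ∈ 𝒥, ∃ f, IsCross c d σ f ∧ (∀ t, f t ∈ H) ∧ trace f = I)
include hcd h𝒥

lemma measurable_foot_left : Measurable fun I : 𝒥 => foot c I.1 := by
  refine measurable_foot fun I hI => ?_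
  obtain ⟨f, hf, -, rfl⟩ := h𝒥 I hI
  refine ⟨f 0, by simp, hf.left, fun w hw hwc => ?_⟩
  rw [coe_trace] at hw
  obtain ⟨t, rfl⟩ := hw
  rw [hf.eq_zero (by rintro rfl; simp at hcd) hwc]

lemma measurable_foot_right : Measurable fun I : 𝒥 => foot d I.1 := by
  refine measurable_foot fun I hI => ?_
  obtain ⟨f, hf, -, rfl⟩ := h𝒥 I hI
  refine ⟨f 1, by simp, hf.right, fun w hw hwc => ?_⟩
  rw [coe_trace] at hw
  obtain ⟨t, rfl⟩ := hw
  rw [hf.eq_one (by rintro rfl; simp at hcd) hwc]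

lemma foot_left_fst (I : 𝒥) : (foot c I.1).1 = c := by
  obtain ⟨f, hf, -, hI⟩ := h𝒥 I I.2
  rw [← hI, hf.foot_left (by rintro rfl; simp at hcd), hf.left]

lemma foot_right_fst (I : 𝒥) : (foot d I.1).1 = d := by
  obtain ⟨f, hf, -, hI⟩ := h𝒥 I I.2
  rw [← hI, hf.foot_right (by rintro rfl; simp at hcd), hf.right]

lemma joinedIn_foot (I : 𝒥) : JoinedIn H (foot c I.1) (foot d I.1) := by
  obtain ⟨f, hf, fH, hI⟩ := h𝒥 I I.2
  have hcd' : c ≠ d := by rintro rfl; simp at hcd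
  rw [← hI, hf.foot_left hcd', hf.foot_right hcd']
  exact joinedIn_of_mem_arc fH 0 1

lemma foot_left_mem (I : 𝒥) : foot c I.1 ∈ H := (joinedIn_foot hcd h𝒥 I).source_mem

lemma foot_right_mem (I : 𝒥) : foot d I.1 ∈ H := (joinedIn_foot hcd h𝒥 I).target_mem

lemma injOn_foot_left {S : Set 𝒥}
    (hsep : ∀ x ∈ S, ∀ y ∈ S, JoinedIn H (foot c x.1) (foot c y.1) → x = y) :
    InjOn (fun x : 𝒥 => (foot c x.1).2) S := by
  intro x hx y hy h
  have : foot c x.1 = foot c y.1 :=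
    Prod.ext ((foot_left_fst hcd h𝒥 x).trans (foot_left_fst hcd h𝒥 y).symm) h
  exact hsep x hx y hy (this ▸ JoinedIn.refl (foot_left_mem hcd h𝒥 x))

/-- Partners that end where the arc ends can be chosen in a measurable way. -/
lemma exists_measurable_partner_of_eq (hH : PolishSpace H) {S : Set 𝒥}
    (hsep : ∀ x ∈ S, ∀ y ∈ S, JoinedIn H (foot c x.1) (foot c y.1) → x = y)
    (hS : ∀ x ∈ S, ∃ g, IsPartner H c d σ x.1 g ∧ foot d x.1 = g 1) :
    ∃ (D : Set 𝒥) (F : 𝒥 → C(𝕀, ℝ × ℝ)), MeasurableSet D ∧ Measurable F ∧ S ⊆ D ∧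
      ∀ x ∈ D, IsPartner H c d σ x.1 (F x) := by
  have hsep' : ∀ x ∈ S, ∀ y ∈ S, JoinedIn H (foot d x.1) (foot d y.1) → x = y :=
    fun x hx y hy h => hsep x hx y hy (((joinedIn_foot hcd h𝒥 x).trans h).trans
      (joinedIn_foot hcd h𝒥 y).symm)
  have hdc : 0 < -σ * (c - d) := by linarith
  have h𝒥' : ∀ I ∈ 𝒥, ∃ f, IsCross d c (-σ) f ∧ (∀ t, f t ∈ H) ∧ trace f = I := by
    intro I hI
    obtain ⟨f, hf, fH, rfl⟩ := h𝒥 I hI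
    refine ⟨revPath f, hf.symm, fun t => fH _, ?_⟩
    ext1
    simp
  have hex : ∀ x : 𝒥, ∃ g, x ∈ S → g ∈ canonArcs ∧ IsCross d c (-σ) g ∧ (∀ t, g t ∈ H) ∧
      trace g ≠ x.1 ∧ g 0 = foot d x.1 := by
    intro x
    by_cases hx : x ∈ S
    · obtain ⟨g, hg, hgd⟩ := hS x hx
      obtain ⟨k, hk, hk1, hkH, hkt, hk0, -⟩ := hg.1.symm.exists_canonArc (H := H)
        (fun t => hg.2.1 _)
      refine ⟨k, fun _ => ⟨hk, hk1, hkH, ?_, ?_⟩⟩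
      · rw [hkt]
        convert hg.2.2.1 using 1
        ext1
        rw [coe_trace, coe_trace]
        exact range_revPath g
      · rw [hk0, hgd]
        simp
    · exact ⟨ContinuousMap.const _ 0, fun h => absurd h hx⟩
  choose g hg using hex
  obtain ⟨G, hG, hGg⟩ := exists_measurable_extension (S := S) (f := g)
    (u := fun x => (foot d x.1).2) (g := fun x => foot d x.1)
    (measurable_foot_right hcd h𝒥).snd (injOn_foot_left hdc h𝒥' hsep')
    (measurable_foot_right hcd h𝒥) (fun x hx => (hg x hx).1) (fun x hx => (hg x hx).2.2.2.2) (by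
      intro κ hκ x hx y hy z hz hxy hyz h1 h3
      have hd : ∀ a ∈ S, ∀ b ∈ S, (foot d a.1).2 < (foot d b.1).2 →
          Disjoint (range (g a)) (range (g b)) := by
        intro a ha b hb hab
        refine disjoint_range_of_not_joinedIn (hg a ha).2.2.1 (hg b hb).2.2.1 fun h => ?_
        rw [(hg a ha).2.2.2.2, (hg b hb).2.2.2.2] at h
        rw [hsep' a ha b hb h] at hab
        exact hab.false
      refine hit_of_crossings hdc (hg x hx).2.1 (hg y hy).2.1 (hg z hz).2.1 (hd x hx y hy hxy)
        (hd y hy z hz hyz) hκ h1 h3 ?_ ?_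
      · rwa [(hg x hx).2.2.2.2, (hg y hy).2.2.2.2]
      · rwa [(hg y hy).2.2.2.2, (hg z hz).2.2.2.2])
  refine ⟨{x | IsCross d c (-σ) (G x) ∧ (∀ t, G x t ∈ H) ∧ trace (G x) ≠ x.1 ∧
    G x 0 = foot d x.1}, fun x => revPath (G x), ?_, measurable_revPath.comp hG, ?_, ?_⟩
  · exact (hG (measurableSet_isCross _ _ _)).inter ((hG (measurableSet_curves_mem hH)).inter
      ((measurableSet_eq_fun (measurable_trace.comp hG) measurable_subtype_coe).compl.inter
        (measurableSet_eq_fun ((measurable_eval 0).comp hG) (measurable_foot_right hcd h𝒥))))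
  · intro x hx
    rw [mem_ofPred_eq, hGg hx]
    exact (hg x hx).2
  · rintro x ⟨h1, h2, h3, h4⟩
    refine ⟨by have := h1.symm; rw [neg_neg] at this; exact this, fun t => h2 _, ?_, ?_, Or.inr
      (by simp [h4])⟩
    · convert h3 using 1
      ext1
      simp
    · rw [revPath_one, h4]
      exact JoinedIn.refl ⟨foot_right_mem hcd h𝒥 x, one_mem_side hcd (foot_right_fst hcd h𝒥 x)⟩

/-- Partners that start at a different point, on the other side of a given level, can be chosen in
a measurable way. -/
lemma exists_measurable_partner_of_ne (hH : PolishSpace H) {S : Set 𝒥} (s τ : ℝ)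
    (hsep : ∀ x ∈ S, ∀ y ∈ S, JoinedIn H (foot c x.1) (foot c y.1) → x = y)
    (hnt : ∀ x ∈ S, ¬ Tripled H (foot c x.1))
    (hS : ∀ x ∈ S, ∃ g, IsPartner H c d σ x.1 g ∧ τ * ((foot c x.1).2 - s) < 0 ∧
      0 < τ * ((g 0).2 - s)) :
    ∃ (D : Set 𝒥) (F : 𝒥 → C(𝕀, ℝ × ℝ)), MeasurableSet D ∧ Measurable F ∧ S ⊆ D ∧
      ∀ x ∈ D, IsPartner H c d σ x.1 (F x) := by
  have hσ : σ ≠ 0 := by rintro rfl; simp at hcd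
  have hcd' : c ≠ d := by rintro rfl; simp at hcd
  have hex : ∀ x : 𝒥, ∃ g k : C(𝕀, ℝ × ℝ), x ∈ S → (g ∈ canonArcs ∧ IsPartner H c d σ x.1 g ∧
      0 < τ * ((g 0).2 - s)) ∧ k ∈ canonArcs ∧ (∀ t, k t ∈ H) ∧ k 0 = foot c x.1 ∧ k 1 = g 0 ∧
      (∀ t, t ≠ 0 → t ≠ 1 → k t ∈ side c σ) ∧ (x.1 : Set (ℝ × ℝ)) ⊆ range k ∧
      range g ⊆ range k := by
    intro x
    by_cases hx : x ∈ S
    · obtain ⟨g, hg, hx1, hx2⟩ := hS x hx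
      obtain ⟨g', hg', hg1, hgH, hgt, hg0, hg1'⟩ := hg.1.exists_canonArc hg.2.1
      obtain ⟨f, hf, fH, hfx⟩ := h𝒥 x x.2
      have hf0 : foot c x.1 = f 0 := by rw [← hfx, hf.foot_left hcd']
      have hf1 : foot d x.1 = f 1 := by rw [← hfx, hf.foot_right hcd']
      have hne : f 0 ≠ g' 0 := by
        rw [← hf0, hg0]
        intro h
        rw [h] at hx1
        exact lt_asymm hx1 hx2
      obtain ⟨h, hinj, hH', h0, h1, hinter, hr, hr'⟩ := exists_arc_of_joinedIn_side hcd hf hg1 fH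
        hgH
        (by rw [← hf1, hg1']; exact hg.2.2.2.1) hne (by rw [← hf0]; exact hnt x hx)
      obtain ⟨k, hk, hk0, hk1, hkr⟩ := exists_canonArc_of_injective h hinj
      refine ⟨g', k, fun _ => ⟨⟨hg', hg.congr hg1 hgH hgt hg0 hg1', by rwa [hg0]⟩, hk, ?_, ?_, ?_,
        ?_, ?_, ?_⟩⟩
      · intro t
        obtain ⟨s, hs⟩ : k t ∈ range h := hkr ▸ mem_range_self t
        exact hs ▸ hH' s
      · rw [hk0, h0, hf0]
      · rw [hk1, h1]
      · intro t ht0 ht1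
        obtain ⟨s, hs0, hs1, hs⟩ := exists_interior_eq hk.1 hk0 hk1 hkr ht0 ht1
        exact hs ▸ hinter s hs0 hs1
      · rw [← hfx, coe_trace, hkr]
        exact hr
      · rw [hkr]
        exact hr'
    · exact ⟨ContinuousMap.const _ 0, ContinuousMap.const _ 0, fun h => absurd h hx⟩
  choose g k hgk using hex
  have hs : ∀ x ∈ S, τ * ((foot c x.1).2 - s) < 0 := fun x hx => by
    obtain ⟨-, -, h, -⟩ := hS x hx
    exact h
  have hk0 : ∀ x ∈ S, k x 0 = foot c x.1 := fun x hx => (hgk x hx).2.2.2.1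
  have hk1 : ∀ x ∈ S, k x 1 = g x 0 := fun x hx => (hgk x hx).2.2.2.2.1
  have hk01 : ∀ x ∈ S, (k x 0).1 = c := fun x hx => by rw [hk0 x hx, foot_left_fst hcd h𝒥]
  have hk11 : ∀ x ∈ S, (k x 1).1 = c := fun x hx => by rw [hk1 x hx, (hgk x hx).1.2.1.1.left]
  have hkside : ∀ x ∈ S, range (k x) ⊆ {z | 0 ≤ σ * (z.1 - c)} := by
    rintro x hx _ ⟨t, rfl⟩
    rw [mem_ofPred_eq]
    by_cases ht0 : t = 0
    · rw [ht0, hk01 x hx]; simp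
    by_cases ht1 : t = 1
    · rw [ht1, hk11 x hx]; simp
    exact ((hgk x hx).2.2.2.2.2.1 t ht0 ht1).le
  have hkd : ∀ x ∈ S, ∀ y ∈ S, (foot c x.1).2 < (foot c y.1).2 →
      Disjoint (range (k x)) (range (k y)) := by
    intro a ha b hb hab
    refine disjoint_range_of_not_joinedIn (hgk a ha).2.2.1 (hgk b hb).2.2.1 fun h => ?_
    rw [hk0 a ha, hk0 b hb] at h
    rw [hsep a ha b hb h] at hab
    exact hab.false
  have hsτ : (∀ x ∈ S, ∀ y ∈ S, (k x 0).2 < (k y 1).2) ∨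
      (∀ x ∈ S, ∀ y ∈ S, (k y 1).2 < (k x 0).2) := by
    rcases lt_or_ge τ 0 with h | h
    · right
      intro x hx y hy
      have h1 := hs x hx
      have h2 := (hgk y hy).1.2.2
      rw [hk0 x hx, hk1 y hy]
      have h1' : 0 < (foot c x.1).2 - s := by by_contra! h'; nlinarith
      have h2' : (g y 0).2 - s < 0 := by by_contra! h'; nlinarith
      linarith
    · left
      intro x hx y hy
      have h1 := hs x hx
      have h2 := (hgk y hy).1.2.2
      rw [hk0 x hx, hk1 y hy]
      have h1' : (foot c x.1).2 - s < 0 := by by_contra! h'; nlinarith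
      have h2' : 0 < (g y 0).2 - s := by by_contra! h'; nlinarith
      linarith
  obtain ⟨F, hF, hFk⟩ := exists_measurable_extension (S := S) (f := k)
    (u := fun x => (foot c x.1).2) (g := fun x => foot c x.1)
    (measurable_foot_left hcd h𝒥).snd (injOn_foot_left hcd h𝒥 hsep)
    (measurable_foot_left hcd h𝒥) (fun x hx => (hgk x hx).2.1) hk0 (by
      intro κ hκ x hx y hy z hz hxy hyz h1 h3
      refine hit_of_loops hσ (hkside x hx) (hkside y hy) (hkside z hz) (hk01 x hx) (hk01 y hy)
        (hk01 z hz) (hk11 y hy) (hkd x hx y hy hxy) (hkd y hy z hz hyz) hκ h1 h3 ?_ ?_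
        (hsτ.imp (fun h => h z hz y hy) fun h => h x hx y hy)
      · rwa [hk0 x hx, hk0 y hy]
      · rwa [hk0 y hy, hk0 z hz])
  obtain ⟨G, hG, hGg⟩ := exists_measurable_extension (S := S) (f := g)
    (u := fun x => (foot c x.1).2) (g := fun x => F x 1)
    (measurable_foot_left hcd h𝒥).snd (injOn_foot_left hcd h𝒥 hsep)
    ((measurable_eval 1).comp hF) (fun x hx => (hgk x hx).1.1)
    (fun x hx => by rw [hFk hx, hk1 x hx]) (by
      intro κ hκ x hx y hy z hz hxy hyz h1 h3
      have hgd : ∀ x ∈ S, ∀ y ∈ S, (foot c x.1).2 < (foot c y.1).2 →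
          Disjoint (range (g y)) (range (g x)) := fun x hx y hy hxy =>
        ((hkd x hx y hy hxy).mono (hgk x hx).2.2.2.2.2.2.2 (hgk y hy).2.2.2.2.2.2.2).symm
      have hanti : ∀ x ∈ S, ∀ y ∈ S, (foot c x.1).2 < (foot c y.1).2 → (g y 0).2 < (g x 0).2 := by
        intro x hx y hy hxy
        have := loops_antitone hσ (hkside x hx) (hkside y hy) (hk01 x hx) (hk01 y hy) (hk11 x hx)
          (hk11 y hy) (hkd x hx y hy hxy) (by rwa [hk0 x hx, hk0 y hy])
          (hsτ.imp (fun h => h y hy x hx) fun h => h x hx y hy)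
        rwa [hk1 x hx, hk1 y hy] at this
      exact hit_of_crossings hcd (hgk z hz).1.2.1.1 (hgk y hy).1.2.1.1 (hgk x hx).1.2.1.1
        (hgd y hy z hz hyz) (hgd x hx y hy hxy) hκ h3 h1 (hanti y hy z hz hyz)
        (hanti x hx y hy hxy))
  refine ⟨{x | (∀ t, F x t ∈ H) ∧ (F x 0).1 = c ∧ (F x 1).1 = c ∧
    (∀ t ∈ {t : 𝕀 | t ≠ 0 ∧ t ≠ 1}, F x t ∈ side c σ) ∧ (x.1 : Set (ℝ × ℝ)) ⊆ trace (F x) ∧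
    (trace (G x) : Set (ℝ × ℝ)) ⊆ trace (F x) ∧ IsCross c d σ (G x) ∧ (∀ t, G x t ∈ H) ∧
    trace (G x) ≠ x.1 ∧ foot c x.1 ≠ G x 0}, G, ?_, hG, ?_, ?_⟩
  · have hD : IsOpen {t : 𝕀 | t ≠ 0 ∧ t ≠ 1} := isOpen_ne.inter isOpen_ne
    refine (hF (measurableSet_curves_mem hH)).inter (MeasurableSet.inter ?_ (MeasurableSet.inter ?_
      ((hF (measurableSet_curves_mapsTo hD (isOpen_side _ _))).inter (MeasurableSet.inter ?_
      (MeasurableSet.inter ?_ ((hG (measurableSet_isCross _ _ _)).inter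
      ((hG (measurableSet_curves_mem hH)).inter (MeasurableSet.inter ?_ ?_))))))))
    · exact measurableSet_eq_fun ((measurable_eval 0).comp hF).fst measurable_const
    · exact measurableSet_eq_fun ((measurable_eval 1).comp hF).fst measurable_const
    · exact (measurable_subtype_coe.prodMk (measurable_trace.comp hF)) measurableSet_subset
    · exact ((measurable_trace.comp hG).prodMk (measurable_trace.comp hF)) measurableSet_subset
    · exact (measurableSet_eq_fun (measurable_trace.comp hG) measurable_subtype_coe).compl
    · exact (measurableSet_eq_fun (measurable_foot_left hcd h𝒥)
        ((measurable_eval 0).comp hG)).compl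
  · intro x hx
    rw [mem_ofPred_eq, hFk hx, hGg hx, coe_trace, coe_trace]
    obtain ⟨⟨h1, h2, h3⟩, h4, h5, h6, h7, h8, h9, h10⟩ := hgk x hx
    refine ⟨h5, hk01 x hx, hk11 x hx, fun t ht => h8 t ht.1 ht.2, h9, h10, h2.1, h2.2.1, h2.2.2.1,
      ?_⟩
    intro h
    have := hs x hx
    rw [h] at this
    exact lt_asymm this h3
  · rintro x ⟨h1, h2, h3, h4, h5, h6, h7, h8, h9, h10⟩
    refine ⟨h7, h8, h9, ?_, Or.inl h10⟩
    rw [coe_trace] at h5 h6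
    rw [coe_trace] at h6
    have hmem : ∀ z ∈ range (F x), z.1 = d → ∃ t, (t ≠ 0 ∧ t ≠ 1) ∧ F x t = z := by
      rintro _ ⟨t, rfl⟩ ht
      refine ⟨t, ⟨?_, ?_⟩, rfl⟩
      · rintro rfl
        exact hcd' (h2.symm.trans ht)
      · rintro rfl
        exact hcd' (h3.symm.trans ht)
    have hfd : foot d x.1 ∈ (x.1 : Set (ℝ × ℝ)) := by
      obtain ⟨f, hf, -, hfx⟩ := h𝒥 x x.2
      rw [← hfx, hf.foot_right hcd', coe_trace]
      exact mem_range_self _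
    obtain ⟨t, ht, ht'⟩ := hmem _ (h5 hfd) (foot_right_fst hcd h𝒥 x)
    obtain ⟨r, hr, hr'⟩ := hmem _ (h6 (mem_range_self 1)) h7.right
    rw [← ht', ← hr']
    exact joinedIn_arc fun y hy => ⟨h1 y, h4 y (ne_of_mem_uIcc ht hr hy)⟩

end Partner

section Involution
open TopologicalSpace
variable {c d σ : ℝ} {H : Set (ℝ × ℝ)} {𝒥 : Set (NonemptyCompacts (ℝ × ℝ))}

/-- Two distinct arcs whose feet on `x = d` are joined off `x = c`, and that do not have the same
foot on `x = c` without having the same foot on `x = d`. -/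
def Adjoining (H : Set (ℝ × ℝ)) (c d σ : ℝ) (I J : NonemptyCompacts (ℝ × ℝ)) : Prop :=
  I ≠ J ∧ JoinedIn (H ∩ side c σ) (foot d I) (foot d J) ∧ (foot c I ≠ foot c J ∨ foot d I = foot d
      J)

lemma Adjoining.symm {I J : NonemptyCompacts (ℝ × ℝ)} (h : Adjoining H c d σ I J) :
    Adjoining H c d σ J I :=
  ⟨h.1.symm, h.2.1.symm, h.2.2.imp Ne.symm Eq.symm⟩

lemma IsPartner.adjoining (hcd : c ≠ d) {I : NonemptyCompacts (ℝ × ℝ)} {g : C(𝕀, ℝ × ℝ)}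
    (h : IsPartner H c d σ I g) : Adjoining H c d σ I (trace g) := by
  obtain ⟨hg, -, hne, hj, ho⟩ := h
  refine ⟨hne.symm, ?_, ?_⟩
  · rwa [hg.foot_right hcd]
  · rwa [hg.foot_right hcd, hg.foot_left hcd]

section
variable (hcd : 0 < σ * (d - c))
  (h𝒥 : ∀ I ∈ 𝒥, ∃ f, IsCross c d σ f ∧ (∀ t, f t ∈ H) ∧ trace f = I)
include hcd h𝒥

lemma Adjoining.exists_isPartner {I : NonemptyCompacts (ℝ × ℝ)} {J : 𝒥}
    (h : Adjoining H c d σ I J.1) : ∃ g, IsPartner H c d σ I g := by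
  have hcd' : c ≠ d := by rintro rfl; simp at hcd
  obtain ⟨g, hg, gH, hgJ⟩ := h𝒥 J J.2
  rw [← hgJ] at h
  obtain ⟨hne, hj, ho⟩ := h
  rw [hg.foot_right hcd'] at hj ho
  rw [hg.foot_left hcd'] at ho
  exact ⟨g, hg, gH, hne.symm, hj, ho⟩

lemma Adjoining.joinedIn {I J : 𝒥} (h : Adjoining H c d σ I.1 J.1) :
    JoinedIn H (foot c I.1) (foot c J.1) :=
  ((joinedIn_foot hcd h𝒥 I).trans (h.2.1.mono inter_subset_left)).trans
    (joinedIn_foot hcd h𝒥 J).symm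

/-- Countably many measurable choices exhaust all partners. -/
lemma exists_measurable_partners (hH : PolishSpace H) {n : 𝒥 → ℕ}
    (hn : ∀ x y, ¬ Tripled H (foot c x.1) → JoinedIn H (foot c x.1) (foot c y.1) → n x = n y →
      x = y) :
    ∃ (D : ℕ ⊕ ℕ × ℚ × Bool → Set 𝒥) (F : ℕ ⊕ ℕ × ℚ × Bool → 𝒥 → C(𝕀, ℝ × ℝ)),
      (∀ i, MeasurableSet (D i)) ∧ (∀ i, Measurable (F i)) ∧
      (∀ i, ∀ x ∈ D i, IsPartner H c d σ x.1 (F i x)) ∧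
      ∀ x : 𝒥, ¬ Tripled H (foot c x.1) → ∀ g, IsPartner H c d σ x.1 g → ∃ i, x ∈ D i := by
  let S : ℕ ⊕ ℕ × ℚ × Bool → Set 𝒥 := fun i => match i with
    | .inl m => {x | ¬ Tripled H (foot c x.1) ∧ n x = m ∧
        ∃ g, IsPartner H c d σ x.1 g ∧ foot d x.1 = g 1}
    | .inr (m, s, b) => {x | ¬ Tripled H (foot c x.1) ∧ n x = m ∧
        ∃ g, IsPartner H c d σ x.1 g ∧ boolSign b * ((foot c x.1).2 - s) < 0 ∧
          0 < boolSign b * ((g 0).2 - s)}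
  have hS : ∀ i, ∃ (D : Set 𝒥) (F : 𝒥 → C(𝕀, ℝ × ℝ)), MeasurableSet D ∧ Measurable F ∧ S i ⊆ D ∧
      ∀ x ∈ D, IsPartner H c d σ x.1 (F x) := by
    rintro (m | ⟨m, s, b⟩)
    · exact exists_measurable_partner_of_eq hcd h𝒥 hH
        (fun x hx y hy h => hn x y hx.1 h (hx.2.1.trans hy.2.1.symm)) fun x hx => hx.2.2
    · exact exists_measurable_partner_of_ne hcd h𝒥 hH s (boolSign b)
        (fun x hx y hy h => hn x y hx.1 h (hx.2.1.trans hy.2.1.symm)) (fun x hx => hx.1)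
        fun x hx => hx.2.2
  choose D F hD hF hSD hDF using hS
  refine ⟨D, F, hD, hF, hDF, fun x hx g hg => ?_⟩
  by_cases he : foot d x.1 = g 1
  · exact ⟨.inl (n x), hSD _ ⟨hx, rfl, g, hg, he⟩⟩
  have hne : (foot c x.1).2 ≠ (g 0).2 := fun h => hg.2.2.2.2.resolve_right he
    (Prod.ext ((foot_left_fst hcd h𝒥 x).trans hg.1.left.symm) h)
  rcases hne.lt_or_gt with h | h
  · obtain ⟨s, h1, h2⟩ := exists_rat_btwn h
    exact ⟨.inr (n x, s, true), hSD _ ⟨hx, rfl, g, hg, by simp [boolSign]; exact h1,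
      by simp [boolSign]; exact h2⟩⟩
  · obtain ⟨s, h1, h2⟩ := exists_rat_btwn h
    exact ⟨.inr (n x, s, false), hSD _ ⟨hx, rfl, g, hg, by simp [boolSign]; exact h2,
      by simp [boolSign]; exact h1⟩⟩

end

lemma Adjoining.eq {b : Bool} (hcd : 0 < boolSign b * (d - c))
    (h𝒥 : ∀ I ∈ 𝒥, ∃ f, IsCross c d (boolSign b) f ∧ (∀ t, f t ∈ H) ∧ trace f = I) {x y z : 𝒥}
    (hx : ¬ Tripled H (foot c x.1)) (hxy : Adjoining H c d (boolSign b) x.1 y.1)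
    (hxz : Adjoining H c d (boolSign b) x.1 z.1) : y = z := by
  have hcd' : c ≠ d := by rintro rfl; simp at hcd
  have hext : ∀ {f g : C(𝕀, ℝ × ℝ)}, range f = range g → trace f = trace g := fun h => by
    ext1
    simpa using h
  obtain ⟨f, hf, fH, hfx⟩ := h𝒥 x x.2
  obtain ⟨g, hg, gH, hgy⟩ := h𝒥 y y.2
  obtain ⟨h, hh, hH, hhz⟩ := h𝒥 z z.2
  rw [← hfx, ← hgy] at hxy
  rw [← hfx, ← hhz] at hxz
  rw [← hfx, hf.foot_left hcd'] at hx
  have j1 := hxy.2.1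
  have j2 := hxz.2.1
  rw [hf.foot_right hcd', hg.foot_right hcd'] at j1
  rw [hf.foot_right hcd', hh.foot_right hcd'] at j2
  rcases range_eq_of_joinedIn_side hcd hf hg hh fH gH hH j1 j2 hx with e | e | e
  · exact absurd (hext e) hxy.1
  · exact absurd (hext e) hxz.1
  · exact Subtype.ext (hgy.symm.trans ((hext e).trans hhz))

/-- The measurable involution that exchanges adjoining arcs. -/
lemma exists_involution {b : Bool} (hcd : 0 < boolSign b * (d - c))
    (h𝒥 : ∀ I ∈ 𝒥, ∃ f, IsCross c d (boolSign b) f ∧ (∀ t, f t ∈ H) ∧ trace f = I)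
    (hH : PolishSpace H)
    (hsurj : ∀ x : 𝒥, ∀ f, IsCross c d (boolSign b) f → (∀ t, f t ∈ H) →
      JoinedIn H (foot c x.1) (f 0) → trace f ∈ 𝒥)
    (hX : MeasurableSet {x : 𝒥 | ¬ Tripled H (foot c x.1)}) {n : 𝒥 → ℕ}
    (hn : ∀ x y, ¬ Tripled H (foot c x.1) → JoinedIn H (foot c x.1) (foot c y.1) → n x = n y →
      x = y) :
    ∃ r : 𝒥 → 𝒥, Function.Involutive r ∧ Measurable r ∧
      (∀ x, JoinedIn H (foot c x.1) (foot c (r x).1)) ∧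
      (∀ x y, ¬ Tripled H (foot c x.1) → Adjoining H c d (boolSign b) x.1 y.1 → y = r x) ∧
      ∀ x, Tripled H (foot c x.1) → r x = x := by
  classical
  have hcd' : c ≠ d := by rintro rfl; simp at hcd
  let r : 𝒥 → 𝒥 := fun x =>
    if h : ¬ Tripled H (foot c x.1) ∧ ∃ y : 𝒥, Adjoining H c d (boolSign b) x.1 y.1
    then h.2.choose else x
  have hr : ∀ x y : 𝒥, ¬ Tripled H (foot c x.1) → Adjoining H c d (boolSign b) x.1 y.1 →
      y = r x := by
    intro x y hx hxy
    have h : ¬ Tripled H (foot c x.1) ∧ ∃ y : 𝒥, Adjoining H c d (boolSign b) x.1 y.1 :=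
      ⟨hx, y, hxy⟩
    rw [show r x = h.2.choose from dif_pos h]
    exact hxy.eq hcd h𝒥 hx h.2.choose_spec
  have hr' : ∀ x : 𝒥, (¬ Tripled H (foot c x.1) ∧ Adjoining H c d (boolSign b) x.1 (r x).1) ∨
      ((¬ ∃ y : 𝒥, ¬ Tripled H (foot c x.1) ∧ Adjoining H c d (boolSign b) x.1 y.1) ∧ r x = x) := by
    intro x
    by_cases h : ¬ Tripled H (foot c x.1) ∧ ∃ y : 𝒥, Adjoining H c d (boolSign b) x.1 y.1
    · obtain ⟨y, hy⟩ := h.2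
      exact Or.inl ⟨h.1, hr x y h.1 hy ▸ hy⟩
    · exact Or.inr ⟨fun ⟨y, hx, hy⟩ => h ⟨hx, y, hy⟩, dif_neg h⟩
  refine ⟨r, fun x => ?_, ?_, fun x => ?_, hr, fun x hx => ?_⟩
  · rcases hr' x with ⟨hx, hxr⟩ | ⟨-, h⟩
    · exact (hr _ _ (fun h => hx (h.congr (hxr.joinedIn hcd h𝒥).symm)) hxr.symm).symm
    · rw [h, h]
  · obtain ⟨D, F, hD, hF, hDF, hcov⟩ := exists_measurable_partners hcd h𝒥 hH hn
    have hval : ∀ i x, ¬ Tripled H (foot c x.1) → x ∈ D i → (r x).1 = trace (F i x) := by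
      intro i x hx hxi
      have hp := hDF i x hxi
      have hm : trace (F i x) ∈ 𝒥 := hsurj x _ hp.1 hp.2.1
        (((joinedIn_foot hcd h𝒥 x).trans (hp.2.2.2.1.mono inter_subset_left)).trans
          (joinedIn_of_mem_arc hp.2.1 1 0))
      rw [← hr x ⟨_, hm⟩ hx (hp.adjoining hcd')]
    rintro _ ⟨B, hB, rfl⟩
    have : r ⁻¹' (Subtype.val ⁻¹' B) =
        (⋃ i, {x | ¬ Tripled H (foot c x.1)} ∩ D i ∩ (fun x => trace (F i x)) ⁻¹' B) ∪
        (⋃ i, {x | ¬ Tripled H (foot c x.1)} ∩ D i)ᶜ ∩ Subtype.val ⁻¹' B := by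
      ext x
      by_cases h : ∃ i, ¬ Tripled H (foot c x.1) ∧ x ∈ D i
      · obtain ⟨i, hx, hxi⟩ := h
        simp only [mem_union, mem_iUnion, mem_inter_iff, mem_preimage, mem_compl_iff, mem_ofPred_eq]
        rw [hval i x hx hxi]
        constructor
        · exact fun h => Or.inl ⟨i, ⟨hx, hxi⟩, h⟩
        · rintro (⟨j, ⟨-, hj⟩, h⟩ | ⟨h, -⟩)
          · rwa [← hval i x hx hxi, hval j x hx hj]
          · exact absurd ⟨i, hx, hxi⟩ h
      · have hrx : r x = x := by
          rcases hr' x with ⟨hx, hxr⟩ | ⟨-, h⟩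
          · obtain ⟨g, hg⟩ := hxr.exists_isPartner hcd h𝒥
            obtain ⟨i, hi⟩ := hcov x hx g hg
            exact absurd ⟨i, hx, hi⟩ h
          · exact h
        simp only [mem_union, mem_iUnion, mem_inter_iff, mem_preimage, mem_compl_iff, mem_ofPred_eq]
        rw [hrx]
        constructor
        · exact fun hx => Or.inr ⟨h, hx⟩
        · rintro (⟨j, hj, -⟩ | ⟨-, hx⟩)
          · exact absurd ⟨j, hj⟩ h
          · exact hx
    rw [this]
    exact (MeasurableSet.iUnion fun i => (hX.inter (hD i)).inter
      ((measurable_trace.comp (hF i)) hB)).union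
      ((MeasurableSet.iUnion fun i => hX.inter (hD i)).compl.inter (measurable_subtype_coe hB))
  · rcases hr' x with ⟨hx, hxr⟩ | ⟨-, h⟩
    · exact hxr.joinedIn hcd h𝒥
    · rw [h]
      exact JoinedIn.refl (foot_left_mem hcd h𝒥 x)
  · exact dif_neg fun h => h.1 hx

end Involution

section CountablePart
variable {X : Type} {E E' : X → X → Prop}

lemma exists_injOn_classes (hE : Equivalence E) (hc : ∀ x, {y | E x y}.Countable) :
    ∃ n : X → ℕ, ∀ x y, E x y → n x = n y → x = y := by
  let s : Setoid X := ⟨E, hE⟩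
  have : ∀ a : Quotient s, ∃ f : X → ℕ, InjOn f {y | Quotient.mk s y = a} := by
    intro a
    obtain ⟨x, rfl⟩ := Quotient.exists_rep a
    exact countable_iff_exists_injOn.1 ((hc x).mono fun y hy => hE.symm (Quotient.exact hy))
  choose f hf using this
  refine ⟨fun x => f (Quotient.mk s x) x, fun x y hxy h => ?_⟩
  have he : Quotient.mk s x = Quotient.mk s y := Quotient.sound hxy
  exact hf _ rfl he.symm (h.trans (congrArg (fun a => f a y) he.symm))

variable [MeasurableSpace X]

/-- A relation that agrees with a hyperfinite one off a countable invariant set is hyperfinite. -/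
lemma IsHyperfinite.of_countable [MeasurableSingletonClass X] (h' : IsHyperfinite E')
    (hE : Equivalence E) {S : Set X} (hS : S.Countable) (hinv : ∀ x y, x ∈ S → E x y → y ∈ S)
    (h₁ : ∀ x y, x ∉ S → (E x y ↔ E' x y)) (h₂ : ∀ x y, x ∈ S → E' x y → y = x) :
    IsHyperfinite E := by
  obtain ⟨F, hF, hmono, hEF⟩ := h'
  obtain ⟨ν, hν⟩ := countable_iff_exists_injOn.1 hS
  have hid : ∀ n x y, x ∈ S → F n x y → y = x := fun n x y hx h => h₂ x y hx ((hEF x y).2 ⟨n, h⟩)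
  refine ⟨fun n x y => F n x y ∨ ((x ∈ S ∧ ν x ≤ n) ∧ (y ∈ S ∧ ν y ≤ n) ∧ E x y),
    fun n => ⟨⟨⟨fun x => Or.inl ((hF n).1.1.refl x), ?_, ?_⟩, ?_⟩, fun x => ?_⟩, ?_, fun x y => ?_⟩
  · rintro x y (h | ⟨hx, hy, h⟩)
    · exact Or.inl ((hF n).1.1.symm h)
    · exact Or.inr ⟨hy, hx, hE.symm h⟩
  · rintro x y z (h | ⟨hx, hy, h⟩) (h' | ⟨hy', hz, h'⟩)
    · exact Or.inl ((hF n).1.1.trans h h')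
    · rw [hid n y x hy'.1 ((hF n).1.1.symm h)]
      exact Or.inr ⟨hy', hz, h'⟩
    · rw [hid n y z hy.1 h']
      exact Or.inr ⟨hx, hy, h⟩
    · exact Or.inr ⟨hx, hz, hE.trans h h'⟩
  · refine (hF n).1.2.union (Set.Countable.measurableSet ?_)
    exact (hS.prod hS).mono fun p hp => mem_prod.2 ⟨hp.1.1, hp.2.1.1⟩
  · have hfin : (S ∩ ν ⁻¹' Iic n).Finite := Set.Finite.of_finite_image
      ((finite_Iic n).subset (image_subset_iff.2 inter_subset_right)) (hν.mono inter_subset_left)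
    exact ((hF n).2 x).union (hfin.subset fun y hy => hy.2.1)
  · rintro n x y (h | ⟨hx, hy, h⟩)
    · exact Or.inl (hmono n x y h)
    · exact Or.inr ⟨⟨hx.1, hx.2.trans n.le_succ⟩, ⟨hy.1, hy.2.trans n.le_succ⟩, h⟩
  · constructor
    · intro h
      by_cases hx : x ∈ S
      · exact ⟨max (ν x) (ν y), Or.inr ⟨⟨hx, le_max_left _ _⟩, ⟨hinv x y hx h, le_max_right _ _⟩,
          h⟩⟩
      · obtain ⟨n, hn⟩ := (hEF x y).1 ((h₁ x y hx).1 h)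
        exact ⟨n, Or.inl hn⟩
    · rintro ⟨n, h | ⟨-, -, h⟩⟩
      · by_cases hx : x ∈ S
        · rw [hid n x y hx h]
          exact hE.refl x
        · exact (h₁ x y hx).2 ((hEF x y).2 ⟨n, h⟩)
      · exact h

lemma IsHyperfinite.isBorelEquivRel (h : IsHyperfinite E) (hE : Equivalence E) :
    IsBorelEquivRel E := by
  obtain ⟨F, hF, -, hEF⟩ := h
  refine ⟨hE, ?_⟩
  have : {p : X × X | E p.1 p.2} = ⋃ n, {p : X × X | F n p.1 p.2} := by
    ext p
    simpa using hEF p.1 p.2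
  rw [this]
  exact MeasurableSet.iUnion fun n => (hF n).1.2

end CountablePart

section Main
open TopologicalSpace
variable {p q : ℝ} {H : Set (ℝ × ℝ)} {𝒥 : Set (NonemptyCompacts (ℝ × ℝ))}

lemma adjoining_of_ne {c d σ σ' : ℝ} {I J : NonemptyCompacts (ℝ × ℝ)} (hne : I ≠ J)
    (hj : JoinedIn (H ∩ side c σ) (foot d I) (foot d J)) (hs : foot c I ∈ H ∩ side d σ') :
    Adjoining H c d σ I J ∨ Adjoining H d c σ' I J := by
  by_cases h : foot c I = foot c J
  · exact Or.inr ⟨hne, h ▸ JoinedIn.refl hs, Or.inr h⟩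
  · exact Or.inl ⟨hne, hj, Or.inl h⟩

lemma trace_revPath (f : C(𝕀, ℝ × ℝ)) : trace (revPath f) = trace f := by
  ext1
  simp

theorem isHyperfinite_joinedIn_foot (hpq : p < q) (hH : PolishSpace H)
    (h𝒥 : ∀ I ∈ 𝒥, ∃ f, IsCross p q 1 f ∧ (∀ t, f t ∈ H) ∧ trace f = I)
    (hsurj : ∀ x : 𝒥, ∀ f, IsCross p q 1 f → (∀ t, f t ∈ H) →
      JoinedIn H (foot p x.1) (f 0) → trace f ∈ 𝒥)
    (hc : ∀ x : 𝒥, {y : 𝒥 | JoinedIn H (foot p x.1) (foot p y.1)}.Countable) :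
    IsHyperfinite fun x y : 𝒥 => JoinedIn H (foot p x.1) (foot p y.1) := by
  have hcd : 0 < boolSign true * (q - p) := by simpa [boolSign] using hpq
  have hdc : 0 < boolSign false * (p - q) := by simpa [boolSign] using hpq
  have hft : boolSign true = 1 := rfl
  have hff : boolSign false = -1 := rfl
  have h𝒥₁ : ∀ I ∈ 𝒥, ∃ f, IsCross p q (boolSign true) f ∧ (∀ t, f t ∈ H) ∧ trace f = I := h𝒥
  have h𝒥₂ : ∀ I ∈ 𝒥, ∃ f, IsCross q p (boolSign false) f ∧ (∀ t, f t ∈ H) ∧ trace f = I := by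
    intro I hI
    obtain ⟨f, hf, fH, rfl⟩ := h𝒥 I hI
    exact ⟨revPath f, hf.symm, fun t => fH _, trace_revPath f⟩
  have hE : Equivalence fun x y : 𝒥 => JoinedIn H (foot p x.1) (foot p y.1) :=
    ⟨fun x => JoinedIn.refl (foot_left_mem hcd h𝒥₁ x), JoinedIn.symm, JoinedIn.trans⟩
  have hj : ∀ x : 𝒥, JoinedIn H (foot p x.1) (foot q x.1) := joinedIn_foot hcd h𝒥₁
  have hp : ∀ x : 𝒥, foot p x.1 ∈ H ∩ side q (-1) := fun x =>
    ⟨foot_left_mem hcd h𝒥₁ x, one_mem_side hdc (foot_left_fst hcd h𝒥₁ x)⟩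
  have hq : ∀ x : 𝒥, foot q x.1 ∈ H ∩ side p 1 := fun x =>
    ⟨foot_right_mem hcd h𝒥₁ x, one_mem_side hcd (foot_right_fst hcd h𝒥₁ x)⟩
  have hX0 : {x : 𝒥 | Tripled H (foot p x.1)}.Countable := by
    obtain ⟨T, hT, hTH⟩ := exists_countable_tripled H
    refine (hT.biUnion (t := fun z _ => {x : 𝒥 | JoinedIn H z (foot p x.1)}) fun z _ => ?_).mono ?_
    · by_cases h : ∃ x : 𝒥, JoinedIn H z (foot p x.1)
      · obtain ⟨x, hx⟩ := h
        exact (hc x).mono fun y hy => hx.symm.trans hy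
      · convert countable_empty (α := 𝒥)
        exact eq_empty_iff_forall_notMem.2 fun x hx => h ⟨x, hx⟩
    · intro x hx
      obtain ⟨z, hz, hxz⟩ := hTH _ hx
      exact mem_iUnion₂.2 ⟨z, hz, hxz.symm⟩
  have hX1 : MeasurableSet {x : 𝒥 | ¬ Tripled H (foot p x.1)} := hX0.measurableSet.compl
  have htr : ∀ x : 𝒥, Tripled H (foot q x.1) ↔ Tripled H (foot p x.1) := fun x =>
    ⟨fun h => h.congr (hj x).symm, fun h => h.congr (hj x)⟩
  obtain ⟨n, hn⟩ := exists_injOn_classes hE hc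
  obtain ⟨r, hr, hmr, hrj, hra, hr0⟩ := exists_involution hcd h𝒥₁ hH hsurj hX1
    fun x y _ h => hn x y h
  obtain ⟨l, hl, hml, hlj, hla, hl0⟩ := exists_involution hdc h𝒥₂ hH
    (fun x f hf fH h => trace_revPath f ▸ hsurj x (revPath f) (by
      have := hf.symm
      rw [hff, neg_neg] at this
      exact this) (fun t => fH _) (((hj x).trans h).trans (by
        rw [revPath_zero]
        exact joinedIn_of_mem_arc fH 0 1)))
    (by simpa only [htr] using hX1)
    fun x y _ h => hn x y (((hj x).trans h).trans (hj y).symm)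
  have hlj : ∀ x, JoinedIn H (foot p x.1) (foot p (l x).1) := fun x =>
    ((hj x).trans (hlj x)).trans (hj _).symm
  have hsub : ∀ {x y : 𝒥}, Relation.ReflTransGen (fun x y => y = r x ∨ y = l x) x y →
      JoinedIn H (foot p x.1) (foot p y.1) := by
    intro x y h
    induction h with
    | refl => exact hE.refl x
    | tail _ h ih =>
      rcases h with rfl | rfl
      · exact ih.trans (hrj _)
      · exact ih.trans (hlj _)
  have hpq' : p ≠ q := hpq.ne
  have hstep : ∀ x y : 𝒥, ¬ Tripled H (foot p x.1) →
      (JoinedIn (H ∩ side p 1) (foot q x.1) (foot q y.1) ∨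
        JoinedIn (H ∩ side q (-1)) (foot p x.1) (foot p y.1)) →
      Relation.ReflTransGen (fun x y => y = r x ∨ y = l x) x y := by
    intro x y hx h
    by_cases hne : x = y
    · exact hne ▸ .refl
    have hne : x.1 ≠ y.1 := fun h => hne (Subtype.ext h)
    have : Adjoining H p q 1 x.1 y.1 ∨ Adjoining H q p (-1) x.1 y.1 :=
      h.elim (fun h => adjoining_of_ne hne h (hp x)) fun h => (adjoining_of_ne hne h (hq x)).symm
    exact .single (this.imp (hra x y hx) (hla x y (by rwa [htr])))
  refine (isHyperfinite_of_involutive hr hl hmr hml).of_countable hE hX0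
    (fun x y hx h => hx.congr h) (fun x y hx => ⟨fun h => ?_, hsub⟩) fun x y hx h => ?_
  · obtain ⟨f, hf, fH, hfx⟩ := h𝒥 x x.2
    obtain ⟨g, hg, gH, hgy⟩ := h𝒥 y y.2
    have hfg : JoinedIn H (f 0) (g 0) := by
      rwa [← hf.foot_left hpq', ← hg.foot_left hpq', hfx, hgy]
    have key : ∀ k, Relation.ReflTransGen (Linked H p q) f k → ∃ hk : trace k ∈ 𝒥,
        IsCross p q 1 k ∧
          Relation.ReflTransGen (fun x y => y = r x ∨ y = l x) x ⟨trace k, hk⟩ := by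
      intro k hk
      induction hk with
      | refl =>
        refine ⟨hfx ▸ x.2, hf, ?_⟩
        rw [show (⟨trace f, hfx ▸ x.2⟩ : 𝒥) = x from Subtype.ext hfx]
      | @tail k k' _ hkk' ih =>
        obtain ⟨hk, hkc, hxk⟩ := ih
        obtain ⟨⟨hk'c, hk'H⟩, hkj⟩ := hkk'
        have hkf := hkc.foot_left hpq'
        have hkf' := hkc.foot_right hpq'
        have hj' : JoinedIn H (foot p (trace k)) (k' 0) := by
          rcases hkj with h | h
          · rw [← hkf'] at h
            exact ((hj ⟨_, hk⟩).trans (h.mono inter_subset_left)).trans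
              (joinedIn_of_mem_arc hk'H 1 0)
          · rw [← hkf] at h
            exact h.mono inter_subset_left
        have hk' := hsurj ⟨_, hk⟩ k' hk'c hk'H hj'
        refine ⟨hk', hk'c, hxk.trans (hstep _ _ (fun h => hx (h.congr (hsub hxk).symm)) ?_)⟩
        rwa [hkf, hkf', hk'c.foot_left hpq', hk'c.foot_right hpq']
    obtain ⟨hk, -, h⟩ := key g (linked_chain hpq hf hg fH gH hfg)
    rwa [show (⟨trace g, hk⟩ : 𝒥) = y from Subtype.ext hgy] at h
  · induction h with
    | refl => rfl
    | tail _ h ih =>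
      subst ih
      rcases h with rfl | rfl
      · exact hr0 _ hx
      · exact hl0 _ ((htr _).2 hx)

end Main

section Members
open TopologicalSpace
variable {p q : ℝ} {H : Set (ℝ × ℝ)}

/-- An injective path that stays off the line `x = c` after its start is on the side of its end. -/
lemma mem_side_of_ne {c σ : ℝ} {f : C(𝕀, ℝ × ℝ)} (h : ∀ t, t ≠ 0 → (f t).1 ≠ c)
    (h1 : f 1 ∈ side c σ) {t : 𝕀} (ht : t ≠ 0) : f t ∈ side c σ := by
  by_contra hn
  rw [mem_side, not_lt] at hn
  obtain ⟨s, hs, hs'⟩ := intermediate_value_Icc (unitInterval.le_one' (t := t))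
    (f := fun x : 𝕀 => σ * ((f x).1 - c)) (by fun_prop) (show (0:ℝ) ∈ _ from ⟨hn, le_of_lt h1⟩)
  rcases mul_eq_zero.1 hs' with h' | h'
  · rw [mem_side, h', zero_mul] at h1
    exact h1.false
  · refine h s ?_ (sub_eq_zero.1 h')
    rintro rfl
    exact ht (le_antisymm hs.1 unitInterval.nonneg')

lemma isCross_of_inter {f : C(𝕀, ℝ × ℝ)} (hpq : p < q) (hinj : Function.Injective f)
    (hp : range f ∩ {z | z.1 = p} = {f 0}) (hq : range f ∩ {z | z.1 = q} = {f 1}) :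
    IsCross p q 1 f := by
  have h0 : (f 0).1 = p := ((Set.ext_iff.1 hp (f 0)).2 rfl).2
  have h1 : (f 1).1 = q := ((Set.ext_iff.1 hq (f 1)).2 rfl).2
  have hp' : ∀ t, t ≠ 0 → (f t).1 ≠ p := fun t ht h =>
    ht (hinj ((Set.ext_iff.1 hp (f t)).1 ⟨mem_range_self t, h⟩))
  have hq' : ∀ t, t ≠ 1 → (f t).1 ≠ q := fun t ht h =>
    ht (hinj ((Set.ext_iff.1 hq (f t)).1 ⟨mem_range_self t, h⟩))
  refine ⟨hinj, h0, h1, fun t ht0 _ => mem_side_of_ne hp' ?_ ht0, fun t _ ht1 => ?_⟩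
  · rw [mem_side, h1]
    linarith
  · have := mem_side_of_ne (c := q) (σ := -1) (f := revPath f) (t := unitInterval.symm t)
      (fun s hs => hq' _ fun h => hs (by simpa using congrArg unitInterval.symm h)) (by
        rw [revPath_one, mem_side, h0]
        linarith) fun h => ht1 (by simpa using congrArg unitInterval.symm h)
    rwa [revPath_apply, unitInterval.symm_symm] at this

lemma IsCross.inter_left {c d σ : ℝ} {f : C(𝕀, ℝ × ℝ)} (hf : IsCross c d σ f) (hcd : c ≠ d) :
    range f ∩ {z | z.1 = c} = {f 0} := by
  ext z
  constructor
  · rintro ⟨⟨t, rfl⟩, ht⟩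
    rw [hf.eq_zero hcd ht]
    rfl
  · rintro rfl
    exact ⟨mem_range_self 0, hf.left⟩

lemma IsCross.inter_right {c d σ : ℝ} {f : C(𝕀, ℝ × ℝ)} (hf : IsCross c d σ f) (hcd : c ≠ d) :
    range f ∩ {z | z.1 = d} = {f 1} := by
  ext z
  constructor
  · rintro ⟨⟨t, rfl⟩, ht⟩
    rw [hf.eq_one hcd ht]
    rfl
  · rintro rfl
    exact ⟨mem_range_self 1, hf.right⟩

/-- A path component that is an injective continuous image of an interval contains only countably
many crossings. -/
lemma countable_crossings (hpq : p ≠ q) {x : ℝ × ℝ} {K : Set ℝ} {φ : ℝ → ℝ × ℝ}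
    (hK : K.OrdConnected) (hφ : ContinuousOn φ K) (hi : InjOn φ K)
    (hx : φ '' K = {y | JoinedIn H x y}) :
    {I : NonemptyCompacts (ℝ × ℝ) | ∃ f, IsCross p q 1 f ∧ (∀ t, f t ∈ H) ∧ trace f = I ∧
      JoinedIn H x (f 0)}.Countable := by
  refine ((countable_arcs hK hφ hi {z | z.1 = p ∨ z.1 = q}).preimage
    (f := fun I : NonemptyCompacts (ℝ × ℝ) => (I : Set (ℝ × ℝ))) SetLike.coe_injective).mono ?_
  rintro _ ⟨f, hf, fH, rfl, hj⟩
  refine ⟨f, hf.inj, (coe_trace f).symm, ?_, Or.inl hf.left, Or.inr hf.right,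
    (Set.toFinite {0, 1}).subset ?_⟩
  · rw [hx]
    show (trace f : Set (ℝ × ℝ)) ⊆ _
    rw [coe_trace]
    rintro _ ⟨t, rfl⟩
    exact hj.trans (joinedIn_of_mem_arc fH 0 t)
  · rintro t (ht | ht)
    · exact Or.inl (hf.eq_zero hpq ht)
    · exact Or.inr (hf.eq_one hpq ht)

end Members

/-- Let `H ⊆ ℝ²` be Polish, `p < q` rationals, `H₀` the set of points of `H` whose arc
component is a continuous injective image of a real interval, and `𝒥_{p,q}` the set of
arcs `J ⊆ H` meeting the vertical lines `x = p` and `x = q` exactly in their endpoints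
`e₁(J) ∈ H₀` and `e₂(J)`, viewed inside the hyperspace of nonempty compact subsets of
the plane. Then the relation on `𝒥_{p,q}` relating `I` and `J` iff `e₁(I)` and `e₁(J)`
lie in the same path component of `H` is a hyperfinite Borel equivalence relation. -/
theorem statement10 (H : Set (ℝ × ℝ)) (hH : PolishSpace H)
    (p q : ℚ) (hpq : p < q)
    (H₀ : Set (ℝ × ℝ))
    (hH₀ : H₀ = {x | x ∈ H ∧ ∃ (K : Set ℝ) (φ : ℝ → ℝ × ℝ), K.OrdConnected ∧
        ContinuousOn φ K ∧ Set.InjOn φ K ∧ φ '' K = {y | JoinedIn H x y}})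
    (𝒥 : Set (TopologicalSpace.NonemptyCompacts (ℝ × ℝ)))
    (h𝒥 : 𝒥 = {J : TopologicalSpace.NonemptyCompacts (ℝ × ℝ) | (J : Set (ℝ × ℝ)) ⊆ H ∧
        ∃ u v : ℝ × ℝ, IsArcWith (J : Set (ℝ × ℝ)) u v ∧
          (J : Set (ℝ × ℝ)) ∩ {z : ℝ × ℝ | z.1 = (p : ℝ)} = {u} ∧
          (J : Set (ℝ × ℝ)) ∩ {z : ℝ × ℝ | z.1 = (q : ℝ)} = {v} ∧ u ∈ H₀})
    (E : 𝒥 → 𝒥 → Prop)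
    (hE : E = fun I J => ∃ x y : ℝ × ℝ,
        x ∈ (I.1 : Set (ℝ × ℝ)) ∧ x.1 = (p : ℝ) ∧
        y ∈ (J.1 : Set (ℝ × ℝ)) ∧ y.1 = (p : ℝ) ∧ JoinedIn H x y) :
    IsBorelEquivRel E ∧ IsHyperfinite E := by
  have hpq' : (p : ℝ) < q := by exact_mod_cast hpq
  have hmem : ∀ I ∈ 𝒥, ∃ f : C(unitInterval, ℝ × ℝ), IsCross (p : ℝ) q 1 f ∧ (∀ t, f t ∈ H) ∧
      trace f = I ∧ f 0 ∈ H₀ := by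
    intro I hI
    rw [h𝒥] at hI
    obtain ⟨hIH, _, _, ⟨f, hf, hinj, hfI, rfl, rfl⟩, hp, hq, hu⟩ := hI
    rw [← hfI] at hp hq hIH
    exact ⟨⟨f, hf⟩, isCross_of_inter hpq' hinj hp hq, fun t => hIH (mem_range_self t),
      by ext1; rw [coe_trace]; exact hfI, hu⟩
  have hmem' : ∀ I ∈ 𝒥, ∃ f : C(unitInterval, ℝ × ℝ), IsCross (p : ℝ) q 1 f ∧ (∀ t, f t ∈ H) ∧
      trace f = I := fun I hI => by
    obtain ⟨f, hf, fH, h, -⟩ := hmem I hI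
    exact ⟨f, hf, fH, h⟩
  have hcd : (0 : ℝ) < 1 * (q - p) := by linarith
  have hfoot : ∀ x : 𝒥, foot p x.1 ∈ H₀ := by
    intro x
    obtain ⟨f, hf, -, hfx, h0⟩ := hmem x x.2
    rwa [← hfx, hf.foot_left hpq'.ne]
  have hEq : ∀ x y : 𝒥, E x y ↔ JoinedIn H (foot p x.1) (foot p y.1) := by
    have hu : ∀ x : 𝒥, foot p x.1 ∈ (x.1 : Set (ℝ × ℝ)) ∧
        ∀ z ∈ (x.1 : Set (ℝ × ℝ)), z.1 = p → z = foot p x.1 := by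
      intro x
      obtain ⟨f, hf, -, hfx⟩ := hmem' x x.2
      rw [← hfx, hf.foot_left hpq'.ne, coe_trace]
      refine ⟨mem_range_self 0, fun z hz hzp => ?_⟩
      exact (Set.ext_iff.1 (hf.inter_left hpq'.ne) z).1 ⟨hz, hzp⟩
    intro x y
    rw [hE]
    constructor
    · rintro ⟨a, b, ha, hap, hb, hbp, h⟩
      rwa [(hu x).2 a ha hap, (hu y).2 b hb hbp] at h
    · exact fun h => ⟨_, _, (hu x).1, foot_left_fst hcd hmem' x, (hu y).1,
        foot_left_fst hcd hmem' y, h⟩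
  have hEq' : E = fun x y : 𝒥 => JoinedIn H (foot p x.1) (foot p y.1) :=
    funext₂ fun x y => propext (hEq x y)
  have hhyp : IsHyperfinite E := by
    rw [hEq']
    refine isHyperfinite_joinedIn_foot hpq' hH hmem' (fun x f hf fH h => ?_) fun x => ?_
    · have hx := hfoot x
      rw [hH₀] at hx
      obtain ⟨-, K, φ, hK, hφ, hi, hKφ⟩ := hx
      rw [h𝒥, mem_ofPred_eq, coe_trace]
      refine ⟨range_subset_iff.2 fH, f 0, f 1, ⟨f, f.continuous, hf.inj, rfl, rfl, rfl⟩,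
        hf.inter_left hpq'.ne, hf.inter_right hpq'.ne, ?_⟩
      rw [hH₀]
      exact ⟨fH 0, K, φ, hK, hφ, hi, hKφ.trans
        (Set.ext fun y => ⟨fun hy => h.symm.trans hy, fun hy => h.trans hy⟩)⟩
    · have hx := hfoot x
      rw [hH₀] at hx
      obtain ⟨-, K, φ, hK, hφ, hi, hKφ⟩ := hx
      refine ((countable_crossings hpq'.ne hK hφ hi hKφ).preimage Subtype.val_injective).mono
        fun y hy => ?_
      obtain ⟨f, hf, fH, hfy⟩ := hmem' y y.2
      refine ⟨f, hf, fH, hfy, ?_⟩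
      rwa [← hf.foot_left hpq'.ne, hfy]
  refine ⟨hhyp.isBorelEquivRel ?_, hhyp⟩
  rw [hEq']
  exact ⟨fun x => JoinedIn.refl (foot_left_mem hcd hmem' x), JoinedIn.symm, JoinedIn.trans⟩
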